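/- arXiv:1907.10760 — 6 statements merged into one kernel-verified Lean document; each statement's English description precedes it below -/
import Mathlib

section
/- The cyclic Steiner triple system of order 13 is not sequenceable. Precisely: let V = ℤ/13ℤ and let the blocks be the 26 triples {i, i+1, i+4} and {i, i+2, i+7} for i ∈ ℤ/13ℤ (arithmetic mod 13). This collection of blocks forms a partial Steiner triple system on V, and there is no sequence listing each point of V exactly once in which no proper segment can be partitioned into pairwise disjoint blocks. -/
/-- A partial Steiner triple system on point set `V` with block set `B`:
each block is a 3-element subset of `V`, and two distinct blocks meet in
at most one point. -/
def IsPSTS {α : Type*} [DecidableEq α] (V : Finset α) (B : Finset (Finset α)) : Prop :=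
  (∀ b ∈ B, b ⊆ V ∧ b.card = 3) ∧
    ∀ b₁ ∈ B, ∀ b₂ ∈ B, b₁ ≠ b₂ → (b₁ ∩ b₂).card ≤ 1

/-- `S` can be partitioned into pairwise disjoint blocks from `B`. -/
def IsBlockPartition {α : Type*} [DecidableEq α] (B : Finset (Finset α))
    (S : Finset α) : Prop :=
  ∃ P : Finset (Finset α), P ⊆ B ∧ (P : Set (Finset α)).Pairwise Disjoint ∧
    P.biUnion id = S

/-- A PSTS is sequenceable if some sequence listing each point of `V` exactly once
has no proper (nonempty, not the whole sequence) segment that can be partitioned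
into pairwise disjoint blocks. -/
def Sequenceable {α : Type*} [DecidableEq α] (V : Finset α)
    (B : Finset (Finset α)) : Prop :=
  ∃ l : List α, l.Nodup ∧ l.toFinset = V ∧
    ∀ i m : ℕ, (l.drop i).take m ≠ [] → ((l.drop i).take m).length < l.length →
      ¬ IsBlockPartition B ((l.drop i).take m).toFinset

/-- Four blocks partitioning the complement of a point. -/
def nearClass (a : ZMod 13) : Finset (Finset (ZMod 13)) :=
  {{a + 7, a + 7 + 1, a + 7 + 4}, {a + 2, a + 2 + 2, a + 2 + 7},
    {a + 3, a + 3 + 2, a + 3 + 7}, {a + 12, a + 12 + 2, a + 12 + 7}}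

theorem near_cover : ∀ a x : ZMod 13,
    (((x = a + 7 ∨ x = a + 7 + 1 ∨ x = a + 7 + 4) ∨ (x = a + 2 ∨ x = a + 2 + 2 ∨ x = a + 2 + 7) ∨
    (x = a + 3 ∨ x = a + 3 + 2 ∨ x = a + 3 + 7) ∨ (x = a + 12 ∨ x = a + 12 + 2 ∨ x = a + 12 + 7))
      ↔ x ≠ a) := by
  decide +kernel

theorem near_disj_aux : ∀ a : ZMod 13,
    Disjoint ({a + 7, a + 7 + 1, a + 7 + 4} : Finset (ZMod 13))
      ({a + 2, a + 2 + 2, a + 2 + 7} : Finset (ZMod 13)) ∧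
    Disjoint ({a + 7, a + 7 + 1, a + 7 + 4} : Finset (ZMod 13))
      ({a + 3, a + 3 + 2, a + 3 + 7} : Finset (ZMod 13)) ∧
    Disjoint ({a + 7, a + 7 + 1, a + 7 + 4} : Finset (ZMod 13))
      ({a + 12, a + 12 + 2, a + 12 + 7} : Finset (ZMod 13)) ∧
    Disjoint ({a + 2, a + 2 + 2, a + 2 + 7} : Finset (ZMod 13))
      ({a + 3, a + 3 + 2, a + 3 + 7} : Finset (ZMod 13)) ∧
    Disjoint ({a + 2, a + 2 + 2, a + 2 + 7} : Finset (ZMod 13))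
      ({a + 12, a + 12 + 2, a + 12 + 7} : Finset (ZMod 13)) ∧
    Disjoint ({a + 3, a + 3 + 2, a + 3 + 7} : Finset (ZMod 13))
      ({a + 12, a + 12 + 2, a + 12 + 7} : Finset (ZMod 13)) := by
  decide +kernel

theorem four_disj {A B C D : Finset (ZMod 13)} (h : Disjoint A B ∧ Disjoint A C ∧ Disjoint A D ∧
    Disjoint B C ∧ Disjoint B D ∧ Disjoint C D) :
    ∀ x ∈ ({A, B, C, D} : Finset (Finset (ZMod 13))),
      ∀ y ∈ ({A, B, C, D} : Finset (Finset (ZMod 13))), x ≠ y → Disjoint x y := by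
  obtain ⟨h1, h2, h3, h4, h5, h6⟩ := h
  intro x hx y hy hxy
  simp only [Finset.mem_insert, Finset.mem_singleton] at hx hy
  rcases hx with rfl | rfl | rfl | rfl <;> rcases hy with rfl | rfl | rfl | rfl <;>
    first
    | exact absurd rfl hxy
    | assumption
    | (apply Disjoint.symm; assumption)

theorem near_disj (a : ZMod 13) :
    ∀ x ∈ nearClass a, ∀ y ∈ nearClass a, x ≠ y → Disjoint x y :=
  four_disj (near_disj_aux a)

theorem near_parallel (a : ZMod 13) :
    nearClass a ⊆
      ((Finset.univ.image fun i : ZMod 13 => ({i, i + 1, i + 4} : Finset (ZMod 13))) ∪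
        (Finset.univ.image fun i : ZMod 13 => ({i, i + 2, i + 7} : Finset (ZMod 13)))) ∧
    (∀ x ∈ nearClass a, ∀ y ∈ nearClass a, x ≠ y → Disjoint x y) ∧
    (nearClass a).biUnion id = Finset.univ.erase a := by
  refine ⟨?_, near_disj a, ?_⟩
  · intro b hb
    simp only [nearClass, Finset.mem_insert, Finset.mem_singleton] at hb
    rw [Finset.mem_union, Finset.mem_image, Finset.mem_image]
    rcases hb with rfl | rfl | rfl | rfl
    · exact Or.inl ⟨_, Finset.mem_univ _, rfl⟩
    · exact Or.inr ⟨_, Finset.mem_univ _, rfl⟩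
    · exact Or.inr ⟨_, Finset.mem_univ _, rfl⟩
    · exact Or.inr ⟨_, Finset.mem_univ _, rfl⟩
  · ext x
    have h := near_cover a x
    simp only [nearClass, Finset.biUnion_insert, Finset.singleton_biUnion, id, Finset.mem_union,
      Finset.mem_insert, Finset.mem_singleton, Finset.mem_erase, Finset.mem_univ, and_true]
    exact h

theorem blk_card : ∀ i : ZMod 13, ({i, i + 1, i + 4} : Finset (ZMod 13)).card = 3 ∧
    ({i, i + 2, i + 7} : Finset (ZMod 13)).card = 3 := by
  decide +kernel

theorem blk_inter : ∀ i j : ZMod 13,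
    (i ≠ j → (({i, i + 1, i + 4} : Finset (ZMod 13)) ∩ {j, j + 1, j + 4}).card ≤ 1) ∧
    (i ≠ j → (({i, i + 2, i + 7} : Finset (ZMod 13)) ∩ {j, j + 2, j + 7}).card ≤ 1) ∧
    (({i, i + 1, i + 4} : Finset (ZMod 13)) ∩ {j, j + 2, j + 7}).card ≤ 1 := by
  decide +kernel

/-- The cyclic Steiner triple system of order 13, with blocks
`{i, i+1, i+4}` and `{i, i+2, i+7}` for `i ∈ ℤ/13ℤ`, is a partial Steiner
triple system on `ℤ/13ℤ` which is not sequenceable. -/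
theorem cyclic_sts_13_not_sequenceable :
    IsPSTS (Finset.univ : Finset (ZMod 13))
      ((Finset.univ.image fun i : ZMod 13 => ({i, i + 1, i + 4} : Finset (ZMod 13))) ∪
        (Finset.univ.image fun i : ZMod 13 => ({i, i + 2, i + 7} : Finset (ZMod 13)))) ∧
    ¬ Sequenceable (Finset.univ : Finset (ZMod 13))
      ((Finset.univ.image fun i : ZMod 13 => ({i, i + 1, i + 4} : Finset (ZMod 13))) ∪
        (Finset.univ.image fun i : ZMod 13 => ({i, i + 2, i + 7} : Finset (ZMod 13)))) := by
  constructor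
  · refine ⟨?_, ?_⟩
    · intro b hb
      rw [Finset.mem_union, Finset.mem_image, Finset.mem_image] at hb
      rcases hb with ⟨i, -, rfl⟩ | ⟨i, -, rfl⟩
      · exact ⟨Finset.subset_univ _, (blk_card i).1⟩
      · exact ⟨Finset.subset_univ _, (blk_card i).2⟩
    · intro b hb c hc hbc
      rw [Finset.mem_union, Finset.mem_image, Finset.mem_image] at hb hc
      rcases hb with ⟨i, -, rfl⟩ | ⟨i, -, rfl⟩ <;> rcases hc with ⟨j, -, rfl⟩ | ⟨j, -, rfl⟩
      · exact (blk_inter i j).1 (fun e => hbc (by rw [e]))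
      · exact (blk_inter i j).2.2
      · rw [Finset.inter_comm]
        exact (blk_inter j i).2.2
      · exact (blk_inter i j).2.1 (fun e => hbc (by rw [e]))
  · rintro ⟨l, hnd, hl, h⟩
    have hlen : l.length = 13 := by
      rw [← List.toFinset_card_of_nodup hnd, hl]
      rfl
    cases l with
    | nil => simp at hlen
    | cons a t =>
      have ht : t.length = 12 := by simpa using hlen
      have htake : ((a :: t).drop 1).take 12 = t := by
        simp [List.take_of_length_le ht.le]
      have h1 := h 1 12
      rw [htake] at h1
      refine h1 ?_ (by simp) ?_
      · rintro rfl
        simp at ht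
      · have hat : a ∉ t := (List.nodup_cons.1 hnd).1
        have hset : t.toFinset = Finset.univ.erase a := by
          rw [← hl, List.toFinset_cons, Finset.erase_insert (by simpa using hat)]
        rw [hset]
        obtain ⟨hB, hd, hu⟩ := near_parallel a
        exact ⟨_, hB, fun x hx y hy hxy => hd x hx y hy hxy, hu⟩
end

section
/- Every partial Steiner triple system that does not contain three pairwise disjoint blocks (that is, has at most two pairwise disjoint blocks) is sequenceable. -/
/-- `B` contains `k` pairwise disjoint blocks. -/
def HasDisjointBlocks {α : Type*} [DecidableEq α] (B : Finset (Finset α))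
    (k : ℕ) : Prop :=
  ∃ P : Finset (Finset α), P ⊆ B ∧ P.card = k ∧
    (P : Set (Finset α)).Pairwise Disjoint

namespace SeqPf

variable {α : Type*}

def Bad6 (T : α → α → α → Prop) (a b c d e f : α) : Prop :=
  (T a b c ∧ T d e f) ∨ (T a b d ∧ T c e f) ∨ (T a b e ∧ T c d f) ∨ (T a b f ∧ T c d e) ∨
  (T a c d ∧ T b e f) ∨ (T a c e ∧ T b d f) ∨ (T a c f ∧ T b d e) ∨
  (T a d e ∧ T b c f) ∨ (T a d f ∧ T b c e) ∨ (T a e f ∧ T b c d)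

def Gd3 (T : α → α → α → Prop) : List α → Prop
  | a :: b :: c :: t => ¬ T a b c ∧ Gd3 T (b :: c :: t)
  | _ => True

def Gd6 (T : α → α → α → Prop) : List α → Prop
  | a :: b :: c :: d :: e :: f :: t =>
      ¬ Bad6 T a b c d e f ∧ Gd6 T (b :: c :: d :: e :: f :: t)
  | _ => True

theorem Gd3.drop {T : α → α → α → Prop} : ∀ (l : List α) (_ : Gd3 T l) (i : ℕ) (a b c : α)
    (t : List α), l.drop i = a :: b :: c :: t → ¬ T a b c := by
  intro l
  induction l with
  | nil => intro _ i a b c t h; simp at h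
  | cons x l ih =>
    intro hg i a b c t h
    cases i with
    | zero =>
      simp only [List.drop_zero] at h
      rw [h] at hg
      exact hg.1
    | succ i =>
      simp only [List.drop_succ_cons] at h
      refine ih ?_ i a b c t h
      match l, hg with
      | [], _ => trivial
      | [_], _ => trivial
      | _ :: _ :: _, hg => exact hg.2

theorem Gd6.drop {T : α → α → α → Prop} : ∀ (l : List α) (_ : Gd6 T l) (i : ℕ)
    (a b c d e f : α)
    (t : List α), l.drop i = a :: b :: c :: d :: e :: f :: t → ¬ Bad6 T a b c d e f := by
  intro l
  induction l with
  | nil => intro _ i a b c d e f t h; simp at h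
  | cons x l ih =>
    intro hg i a b c d e f t h
    cases i with
    | zero =>
      simp only [List.drop_zero] at h
      rw [h] at hg
      exact hg.1
    | succ i =>
      simp only [List.drop_succ_cons] at h
      refine ih ?_ i a b c d e f t h
      match l, hg with
      | [], _ => trivial
      | [_], _ => trivial
      | [_, _], _ => trivial
      | [_, _, _], _ => trivial
      | [_, _, _, _], _ => trivial
      | _ :: _ :: _ :: _ :: _ :: _, hg => exact hg.2

/-- the triple predicate of a block set -/
def TB [DecidableEq α] (B : Finset (Finset α)) (x y z : α) : Prop := ({x, y, z} : Finset α) ∈ B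

theorem split6 : ∀ s : Finset (Fin 6), s.card = 3 → 0 ∈ s →
    (s = {0,1,2} ∧ sᶜ = {3,4,5}) ∨ (s = {0,1,3} ∧ sᶜ = {2,4,5}) ∨
    (s = {0,1,4} ∧ sᶜ = {2,3,5}) ∨ (s = {0,1,5} ∧ sᶜ = {2,3,4}) ∨
    (s = {0,2,3} ∧ sᶜ = {1,4,5}) ∨ (s = {0,2,4} ∧ sᶜ = {1,3,5}) ∨
    (s = {0,2,5} ∧ sᶜ = {1,3,4}) ∨ (s = {0,3,4} ∧ sᶜ = {1,2,5}) ∨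
    (s = {0,3,5} ∧ sᶜ = {1,2,4}) ∨ (s = {0,4,5} ∧ sᶜ = {1,2,3}) := by
  decide

theorem bad6_aux [DecidableEq α] {B : Finset (Finset α)} {a b c d e f : α}
    (hn : [a, b, c, d, e, f].Nodup) {p q : Finset α} (hp : p ∈ B) (hq : q ∈ B)
    (hp3 : p.card = 3) (hd : Disjoint p q) (hu : p ∪ q = {a, b, c, d, e, f}) (ha : a ∈ p) :
    Bad6 (TB B) a b c d e f := by
  let g : Fin 6 → α := ![a, b, c, d, e, f]
  have hg : Function.Injective g := by
    have := List.nodup_iff_injective_get.1 hn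
    intro i j hij
    apply this
    fin_cases i <;> fin_cases j <;> simpa [g] using hij
  have himg : Finset.univ.image g = {a, b, c, d, e, f} := by
    ext x
    simp only [Finset.mem_image, Finset.mem_univ, true_and, Finset.mem_insert,
      Finset.mem_singleton, Fin.exists_fin_succ]
    simp [g, eq_comm, Fin.exists_fin_succ]
  let s : Finset (Fin 6) := Finset.univ.filter (fun i => g i ∈ p)
  have hs : s.image g = p := by
    ext x
    simp only [s, Finset.mem_image, Finset.mem_filter, Finset.mem_univ, true_and]
    constructor
    · rintro ⟨i, hi, rfl⟩; exact hi
    · intro hx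
      have : x ∈ Finset.univ.image g := by
        rw [himg, ← hu]; exact Finset.mem_union_left _ hx
      obtain ⟨i, _, rfl⟩ := Finset.mem_image.1 this
      exact ⟨i, hx, rfl⟩
  have hs' : sᶜ.image g = q := by
    ext x
    simp only [s, Finset.mem_image, Finset.mem_filter, Finset.mem_univ, true_and,
      Finset.mem_compl]
    constructor
    · rintro ⟨i, hi, rfl⟩
      have : g i ∈ p ∪ q := by
        rw [hu, ← himg]; exact Finset.mem_image_of_mem _ (Finset.mem_univ _)
      rcases Finset.mem_union.1 this with h | h
      · exact absurd h hi
      · exact h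
    · intro hx
      have : x ∈ Finset.univ.image g := by
        rw [himg, ← hu]; exact Finset.mem_union_right _ hx
      obtain ⟨i, _, rfl⟩ := Finset.mem_image.1 this
      exact ⟨i, fun h => Finset.disjoint_left.1 hd h hx, rfl⟩
  have hc : s.card = 3 := by
    rw [← hp3, ← hs, Finset.card_image_of_injective _ hg]
  have h0 : (0 : Fin 6) ∈ s := by simpa [s, g] using ha
  have g0 : g 0 = a := rfl
  have g1 : g 1 = b := rfl
  have g2 : g 2 = c := rfl
  have g3 : g 3 = d := rfl
  have g4 : g 4 = e := rfl
  have g5 : g 5 = f := rfl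
  rw [← hs] at hp
  rw [← hs'] at hq
  unfold Bad6 TB
  rcases split6 s hc h0 with h | h | h | h | h | h | h | h | h | h <;>
  · rw [h.1] at hp
    rw [h.2] at hq
    simp only [Finset.image_insert, Finset.image_singleton, g0, g1, g2, g3, g4, g5] at hp hq
    simp only [hp, hq, true_and, and_true, true_or, or_true, and_self]

theorem finish [DecidableEq α] {V : Finset α} {B : Finset (Finset α)} (hT : IsPSTS V B)
    (h : ¬ HasDisjointBlocks B 3) (l : List α) (hn : l.Nodup) (hV : l.toFinset = V)
    (h3 : l.length = 3 ∨ Gd3 (TB B) l) (h6 : l.length = 6 ∨ Gd6 (TB B) l) :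
    Sequenceable V B := by
  refine ⟨l, hn, hV, ?_⟩
  intro i m hne hlt ⟨P, hPB, hPd, hPu⟩
  set s := (l.drop i).take m with hs
  have hsn : s.Nodup := hn.sublist ((List.take_sublist _ _).trans (List.drop_sublist _ _))
  have hdrop : l.drop i = s ++ (l.drop i).drop m := (List.take_append_drop _ _).symm
  have hcard : s.length = P.card * 3 := by
    rw [← List.toFinset_card_of_nodup hsn, ← hPu, Finset.card_biUnion]
    · exact Finset.sum_const_nat (fun b hb => (hT.1 b (hPB hb)).2)
    · intro x hx y hy hxy; exact hPd hx hy hxy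
  have hP2 : P.card ≤ 2 := by
    by_contra hc
    obtain ⟨Q, hQ, hQc⟩ := Finset.exists_subset_card_eq (show 3 ≤ P.card by omega)
    exact h ⟨Q, hQ.trans hPB, hQc, hPd.mono (by exact_mod_cast hQ)⟩
  have hP0 : s.length ≠ 0 := by simpa using hne
  have : P.card = 1 ∨ P.card = 2 := by omega
  rcases this with h1 | h2
  · obtain ⟨b, rfl⟩ := Finset.card_eq_one.1 h1
    have hl3 : s.length = 3 := by omega
    obtain ⟨x, y, z, hxyz⟩ := List.length_eq_three.1 hl3
    rw [hxyz] at hdrop hPu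
    rcases h3 with h3 | h3
    · omega
    · refine Gd3.drop l h3 i x y z _ hdrop ?_
      have : b = {x, y, z} := by simpa using hPu
      unfold TB
      rw [← this]
      exact hPB (by simp)
  · obtain ⟨p, q, hpq, rfl⟩ := Finset.card_eq_two.1 h2
    have hl6 : s.length = 6 := by omega
    rcases h6 with h6 | h6
    · omega
    match s, hl6, hdrop, hPu, hsn with
    | [a, b, c, d, e, f], _, hdrop, hPu, hsn =>
      refine Gd6.drop l h6 i a b c d e f _ hdrop ?_
      have hu : p ∪ q = {a, b, c, d, e, f} := by
        simpa using hPu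
      have hp : p ∈ B := hPB (by simp)
      have hq : q ∈ B := hPB (by simp)
      have hd : Disjoint p q := hPd (by simp) (by simp) hpq
      have ha : a ∈ p ∪ q := by rw [hu]; simp
      rcases Finset.mem_union.1 ha with ha | ha
      · exact bad6_aux hsn hp hq (hT.1 p hp).2 hd hu ha
      · exact bad6_aux hsn hq hp (hT.1 q hq).2 hd.symm (by rw [Finset.union_comm]; exact hu) ha

/-- configuration -/
structure Conf (V : Finset α) (T : α → α → α → Prop) (a₁ a₂ a₃ c₁ c₂ c₃ : α) (W : List α) :
    Prop where
  s1 : ∀ x y z, T x y z → T y x z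
  s2 : ∀ x y z, T x y z → T x z y
  lin : ∀ x y z w, T x y z → T x y w → z = w
  tA : T a₁ a₂ a₃
  tC : T c₁ c₂ c₃
  no3 : ∀ x y z p q r u v w, [x, y, z, p, q, r, u, v, w].Nodup →
    T x y z → T p q r → T u v w → False
  nd : (a₁ :: a₂ :: a₃ :: c₁ :: c₂ :: c₃ :: W).Nodup
  mem : ∀ x, x ∈ V ↔ x ∈ a₁ :: a₂ :: a₃ :: c₁ :: c₂ :: c₃ :: W

def Goal [DecidableEq α] (V : Finset α) (T : α → α → α → Prop) : Prop :=
  ∃ l : List α, l.Nodup ∧ l.toFinset = V ∧ (l.length = 3 ∨ Gd3 T l) ∧ (l.length = 6 ∨ Gd6 T l)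

section conf
variable {V : Finset α} {T : α → α → α → Prop} {a₁ a₂ a₃ c₁ c₂ c₃ : α} {W : List α}

theorem Conf.perm (h : Conf V T a₁ a₂ a₃ c₁ c₂ c₃ W) {b₁ b₂ b₃ d₁ d₂ d₃ : α} {W' : List α}
    (hp : (a₁ :: a₂ :: a₃ :: c₁ :: c₂ :: c₃ :: W).Perm (b₁ :: b₂ :: b₃ :: d₁ :: d₂ :: d₃ :: W'))
    (hA : T b₁ b₂ b₃) (hC : T d₁ d₂ d₃) : Conf V T b₁ b₂ b₃ d₁ d₂ d₃ W' where
  s1 := h.s1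
  s2 := h.s2
  lin := h.lin
  tA := hA
  tC := hC
  no3 := h.no3
  nd := hp.nodup_iff.1 h.nd
  mem := fun x => (h.mem x).trans hp.mem_iff

theorem Conf.sA (h : Conf V T a₁ a₂ a₃ c₁ c₂ c₃ W) : Conf V T a₂ a₁ a₃ c₁ c₂ c₃ W :=
  h.perm (List.Perm.swap _ _ _) (h.s1 _ _ _ h.tA) h.tC

theorem Conf.rA (h : Conf V T a₁ a₂ a₃ c₁ c₂ c₃ W) : Conf V T a₁ a₃ a₂ c₁ c₂ c₃ W :=
  h.perm (List.Perm.cons _ (List.Perm.swap _ _ _)) (h.s2 _ _ _ h.tA) h.tC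

theorem Conf.sAC (h : Conf V T a₁ a₂ a₃ c₁ c₂ c₃ W) : Conf V T c₁ c₂ c₃ a₁ a₂ a₃ W :=
  h.perm (by
    have : ([a₁, a₂, a₃] ++ [c₁, c₂, c₃]).Perm ([c₁, c₂, c₃] ++ [a₁, a₂, a₃]) :=
      List.perm_append_comm
    simpa using this.append_right W) h.tC h.tA

theorem Conf.sC (h : Conf V T a₁ a₂ a₃ c₁ c₂ c₃ W) : Conf V T a₁ a₂ a₃ c₂ c₁ c₃ W :=
  h.sAC.sA.sAC

theorem Conf.rC (h : Conf V T a₁ a₂ a₃ c₁ c₂ c₃ W) : Conf V T a₁ a₂ a₃ c₁ c₃ c₂ W :=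
  h.sAC.rA.sAC

theorem Conf.pW (h : Conf V T a₁ a₂ a₃ c₁ c₂ c₃ W) {W' : List α} (hp : W.Perm W') :
    Conf V T a₁ a₂ a₃ c₁ c₂ c₃ W' :=
  h.perm (by simpa using hp) h.tA h.tC

theorem Conf.goal [DecidableEq α] (h : Conf V T a₁ a₂ a₃ c₁ c₂ c₃ W) (l : List α)
    (hp : (a₁ :: a₂ :: a₃ :: c₁ :: c₂ :: c₃ :: W).Perm l)
    (h3 : Gd3 T l) (h6 : l.length = 6 ∨ Gd6 T l) : Goal V T :=
  ⟨l, hp.nodup_iff.1 h.nd, by ext x; rw [List.mem_toFinset, ← hp.mem_iff, h.mem], Or.inr h3, h6⟩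

theorem Conf.goal' [DecidableEq α] (h : Conf V T a₁ a₂ a₃ c₁ c₂ c₃ W) (l : List α)
    (hp : l.Nodup ∧ ∀ x, x ∈ a₁ :: a₂ :: a₃ :: c₁ :: c₂ :: c₃ :: W ↔ x ∈ l)
    (h3 : Gd3 T l) (h6 : l.length = 6 ∨ Gd6 T l) : Goal V T :=
  h.goal l ((List.perm_ext_iff_of_nodup h.nd hp.1).2 hp.2) h3 h6

theorem bad6_cases {x y z u v w : α} {F : Prop}
    (hF : ∀ p q r p' q' r', [x, y, z, u, v, w].Perm [p, q, r, p', q', r'] →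
      T p q r → T p' q' r' → F) (hb : Bad6 T x y z u v w) : F := by
  rcases hb with h | h | h | h | h | h | h | h | h | h <;>
    exact hF _ _ _ _ _ _ (by classical simp [List.perm_iff_count, List.count_cons]; try omega) h.1 h.2

theorem Conf.noC (h : Conf V T a₁ a₂ a₃ c₁ c₂ c₃ W) {x y z u v w : α}
    (hn : [x, y, z, u, v, w, c₁, c₂, c₃].Nodup) : ¬ Bad6 T x y z u v w := by
  intro hb
  refine bad6_cases ?_ hb
  intro p q r p' q' r' hp h1 h2
  refine h.no3 p q r p' q' r' c₁ c₂ c₃ ?_ h1 h2 h.tC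
  have := hp.append_right [c₁, c₂, c₃]
  exact this.nodup_iff.1 hn

theorem Conf.noA (h : Conf V T a₁ a₂ a₃ c₁ c₂ c₃ W) {x y z u v w : α}
    (hn : [x, y, z, u, v, w, a₁, a₂, a₃].Nodup) : ¬ Bad6 T x y z u v w :=
  h.sAC.noC hn

theorem Conf.noW (h : Conf V T a₁ a₂ a₃ c₁ c₂ c₃ W) {x y z : α}
    (hn : [x, y, z, a₁, a₂, a₃, c₁, c₂, c₃].Nodup) : ¬ T x y z :=
  fun ht => h.no3 _ _ _ _ _ _ _ _ _ hn ht h.tA h.tC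

theorem Conf.pr (h : Conf V T a₁ a₂ a₃ c₁ c₂ c₃ W) {x y z : α} (ht : T x y z) (w : α) :
    (T x y w ↔ w = z) ∧ (T y x w ↔ w = z) ∧ (T x w y ↔ w = z) ∧ (T y w x ↔ w = z) ∧
    (T w x y ↔ w = z) ∧ (T w y x ↔ w = z) := by
  obtain ⟨s1, s2, lin, -, -, -, -, -⟩ := h
  have k : T x y w ↔ w = z := ⟨fun h => lin _ _ _ _ h ht, fun h => h ▸ ht⟩
  have k1 : T y x w ↔ T x y w := ⟨s1 _ _ _, s1 _ _ _⟩
  have k2 : T x w y ↔ T x y w := ⟨s2 _ _ _, s2 _ _ _⟩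
  have k3 : T y w x ↔ T y x w := ⟨s2 _ _ _, s2 _ _ _⟩
  have k4 : T w x y ↔ T x w y := ⟨s1 _ _ _, s1 _ _ _⟩
  have k5 : T w y x ↔ T y w x := ⟨s1 _ _ _, s1 _ _ _⟩
  refine ⟨k, k1.trans k, k2.trans k, k3.trans (k1.trans k), k4.trans (k2.trans k),
    k5.trans (k3.trans (k1.trans k))⟩

theorem Conf.pA (h : Conf V T a₁ a₂ a₃ c₁ c₂ c₃ W) (w : α) :
    ((T a₁ a₂ w ↔ w = a₃) ∧ (T a₂ a₁ w ↔ w = a₃) ∧ (T a₁ w a₂ ↔ w = a₃) ∧ (T a₂ w a₁ ↔ w = a₃) ∧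
    (T w a₁ a₂ ↔ w = a₃) ∧ (T w a₂ a₁ ↔ w = a₃)) ∧
    ((T a₁ a₃ w ↔ w = a₂) ∧ (T a₃ a₁ w ↔ w = a₂) ∧ (T a₁ w a₃ ↔ w = a₂) ∧ (T a₃ w a₁ ↔ w = a₂) ∧
    (T w a₁ a₃ ↔ w = a₂) ∧ (T w a₃ a₁ ↔ w = a₂)) ∧
    ((T a₂ a₃ w ↔ w = a₁) ∧ (T a₃ a₂ w ↔ w = a₁) ∧ (T a₂ w a₃ ↔ w = a₁) ∧ (T a₃ w a₂ ↔ w = a₁) ∧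
    (T w a₂ a₃ ↔ w = a₁) ∧ (T w a₃ a₂ ↔ w = a₁)) :=
  ⟨h.pr h.tA w, h.pr (h.s2 _ _ _ h.tA) w, h.pr (h.s2 _ _ _ (h.s1 _ _ _ h.tA)) w⟩

theorem Conf.ng (h : Conf V T a₁ a₂ a₃ c₁ c₂ c₃ W) {x y z : α} (ht : ¬ T x y z) :
    ¬ T x y z ∧ ¬ T x z y ∧ ¬ T y x z ∧ ¬ T y z x ∧ ¬ T z x y ∧ ¬ T z y x := by
  obtain ⟨s1, s2, lin, -, -, -, -, -⟩ := h
  refine ⟨ht, fun k => ht (s2 _ _ _ k), fun k => ht (s1 _ _ _ k),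
    fun k => ht (s1 _ _ _ (s2 _ _ _ k)), fun k => ht (s2 _ _ _ (s1 _ _ _ k)),
    fun k => ht (s1 _ _ _ (s2 _ _ _ (s1 _ _ _ k)))⟩

theorem Conf.m0 [DecidableEq α] (h : Conf V T a₁ a₂ a₃ c₁ c₂ c₃ []) : Goal V T := by
  have nd := h.nd
  have nd' := List.nodup_reverse.2 nd
  have pA := h.pA
  have pC := h.sAC.pA
  simp at nd nd'
  refine h.goal [a₁, a₂, c₁, a₃, c₂, c₃] ?_ ?_ (Or.inl rfl)
  · simp only [List.perm_iff_count, List.count_cons, List.count_nil]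
    intro a; omega
  · simp [Gd3, pA, pC, nd, nd']

theorem Conf.m1 [DecidableEq α] {w : α} (h : Conf V T a₁ a₂ a₃ c₁ c₂ c₃ [w])
    (h1 : ¬ T a₃ c₂ w) : Goal V T := by
  have nd := h.nd
  have nd' := List.nodup_reverse.2 nd
  have pA := h.pA
  have pC := h.sAC.pA
  have n1 := h.ng h1
  simp at nd nd'
  refine h.goal [a₁, a₂, c₁, a₃, c₂, w, c₃] ?_ ?_ (Or.inr ?_)
  · simp only [List.perm_iff_count, List.count_cons, List.count_nil]
    intro a; omega
  · simp [Gd3, pA, pC, nd, nd', n1]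
  · simp [Gd6, Bad6, pA, pC, nd, nd', n1]

theorem Conf.m2 [DecidableEq α] {w v : α} (h : Conf V T a₁ a₂ a₃ c₁ c₂ c₃ [w, v])
    (h1 : ¬ T w a₂ c₁) : Goal V T := by
  have nd := h.nd
  have nd' := List.nodup_reverse.2 nd
  have pA := h.pA
  have pC := h.sAC.pA
  have n1 := h.ng h1
  simp at nd nd'
  refine h.goal [a₁, w, a₂, c₁, a₃, c₂, c₃, v] ?_ ?_ (Or.inr ?_)
  · simp only [List.perm_iff_count, List.count_cons, List.count_nil]
    intro a; omega
  · simp [Gd3, pA, pC, nd, nd', n1]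
  · simp [Gd6, Bad6, pA, pC, nd, nd', n1]

theorem Conf.m3 [DecidableEq α] {u v w : α} (h : Conf V T a₁ a₂ a₃ c₁ c₂ c₃ [u, v, w])
    (h1 : ¬ T u v a₁) (h2 : ¬ T u v c₃) (h3 : ¬ T v c₃ a₂) : Goal V T := by
  have nd := h.nd
  have nd' := List.nodup_reverse.2 nd
  have pA := h.pA
  have pC := h.sAC.pA
  have n1 := h.ng h1
  have n2 := h.ng h2
  have n3 := h.ng h3
  simp at nd nd'
  refine h.goal [u, a₁, v, a₂, c₃, a₃, c₂, c₁, w] ?_ ?_ (Or.inr ?_)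
  · simp only [List.perm_iff_count, List.count_cons, List.count_nil]
    intro a; omega
  · simp [Gd3, pA, pC, nd, nd', n1, n2, n3]
  · simp [Gd6, Bad6, pA, pC, nd, nd', n1, n2, n3]

/-- order 10 -/
theorem Conf.m4 [DecidableEq α] {w₁ w₂ w₃ w₄ : α}
    (h : Conf V T a₁ a₂ a₃ c₁ c₂ c₃ [w₁, w₂, w₃, w₄])
    (h1 : ¬ T w₁ w₂ a₁) (h2 : ¬ T w₂ w₃ a₁) (h3 : ¬ T w₁ w₃ a₁)
    (h4 : ¬ T w₁ w₂ a₂) (h5 : ¬ T w₂ w₃ a₂) (h6 : ¬ T w₁ w₃ a₂)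
    (h7 : ¬ T w₂ w₃ c₃) (h8 : ¬ T w₃ a₂ c₃) : Goal V T := by
  have nd := h.nd
  have nd' := List.nodup_reverse.2 nd
  have pA := h.pA
  have pC := h.sAC.pA
  have n1 := h.ng h1
  have n2 := h.ng h2
  have n3 := h.ng h3
  have n4 := h.ng h4
  have n5 := h.ng h5
  have n6 := h.ng h6
  have n7 := h.ng h7
  have n8 := h.ng h8
  simp at nd nd'
  have n9 := h.ng (h.noW (x := w₁) (y := w₂) (z := w₃) (by simp [nd, nd']))
  refine h.goal [w₁, w₂, a₁, w₃, a₂, c₃, a₃, c₂, c₁, w₄] ?_ ?_ (Or.inr ?_)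
  · simp only [List.perm_iff_count, List.count_cons, List.count_nil]
    intro a; omega
  · simp [Gd3, pA, pC, nd, nd', n1, n2, n3, n4, n5, n6, n7, n8]
  · simp [Gd6, Bad6, pA, pC, nd, nd', n1, n2, n3, n4, n5, n6, n7, n8, n9]

def BadP (T : α → α → α → Prop) (x y z a c c' : α) : Prop :=
  (T y z c ∧ T x a c') ∨ (T x z c ∧ T y a c') ∨ (T x y c ∧ T z a c')

/-- order 11 -/
theorem Conf.m5 [DecidableEq α] {w v x y z : α}
    (h : Conf V T a₁ a₂ a₃ c₁ c₂ c₃ [w, v, x, y, z])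
    (h1 : ¬ T x y a₂) (h2 : ¬ T y z a₂) (h3 : ¬ T x z a₂)
    (h4 : ¬ T x y a₃) (h5 : ¬ T y z a₃) (h6 : ¬ T x z a₃)
    (h7 : ¬ T y z c₃)
    (h8 : ¬ BadP T x y z a₃ c₃ c₂) (h9 : ¬ BadP T x y z a₃ c₂ c₃) : Goal V T := by
  have nd := h.nd
  have nd' := List.nodup_reverse.2 nd
  have pA := h.pA
  have pC := h.sAC.pA
  have n1 := h.ng h1
  have n2 := h.ng h2
  have n3 := h.ng h3
  have n4 := h.ng h4
  have n5 := h.ng h5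
  have n6 := h.ng h6
  have n7 := h.ng h7
  simp at nd nd'
  have n9 := h.ng (h.noW (x := x) (y := y) (z := z) (by simp [nd, nd']))
  refine h.goal [a₁, w, a₂, a₃, x, y, z, c₃, c₂, v, c₁] ?_ ?_ (Or.inr ?_)
  · simp only [List.perm_iff_count, List.count_cons, List.count_nil]
    intro a; omega
  · simp [Gd3, pA, pC, nd, nd', n1, n2, n3, n4, n5, n6, n7, n9]
  · simp only [Gd6]
    refine ⟨h.noC ?_, h.noC ?_, ?_, ?_, h.noA ?_, h.noA ?_, trivial⟩
    · simp [nd, nd']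
    · simp [nd, nd']
    · simp [Bad6, pA, pC, nd, nd', n1, n2, n3, n4, n5, n6, n7, n9]
    · unfold BadP at h8 h9
      have s1 := h.s1
      have s2 := h.s2
      simp [Bad6, pA, pC, nd, nd', n1, n2, n3, n4, n5, n6, n7, n9]
      grind
    · simp [nd, nd']
    · simp [nd, nd']

/-- order 12 -/
theorem Conf.m6 [DecidableEq α] {w v x y s t : α}
    (h : Conf V T a₁ a₂ a₃ c₁ c₂ c₃ [w, v, x, y, s, t])
    (h1 : ¬ T x y a₃) (h2 : ¬ T s t c₃) (h3 : ¬ Bad6 T a₃ x y s t c₃) : Goal V T := by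
  have nd := h.nd
  have nd' := List.nodup_reverse.2 nd
  have pA := h.pA
  have pC := h.sAC.pA
  have n1 := h.ng h1
  have n2 := h.ng h2
  simp at nd nd'
  have n8 := h.ng (h.noW (x := x) (y := y) (z := s) (by simp [nd, nd']))
  have n9 := h.ng (h.noW (x := y) (y := s) (z := t) (by simp [nd, nd']))
  refine h.goal [a₁, w, a₂, a₃, x, y, s, t, c₃, c₂, v, c₁] ?_ ?_ (Or.inr ?_)
  · simp only [List.perm_iff_count, List.count_cons, List.count_nil]
    intro a; omega
  · simp [Gd3, pA, pC, nd, nd', n1, n2, n8, n9]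
  · simp only [Gd6]
    refine ⟨h.noC ?_, h.noC ?_, h.noC ?_, h3, h.noA ?_, h.noA ?_, h.noA ?_, trivial⟩ <;>
    simp [nd, nd']

theorem Conf.gd6A (h : Conf V T a₁ a₂ a₃ c₁ c₂ c₃ W) : ∀ l : List α,
    (l ++ [a₁, a₂, a₃]).Nodup → Gd6 T l
  | a :: b :: c :: d :: e :: f :: t, hn => by
    refine ⟨h.noA ?_, h.gd6A (b :: c :: d :: e :: f :: t) (List.nodup_cons.1 hn).2⟩
    refine hn.sublist ?_
    simp
  | [], _ => trivial
  | [_], _ => trivial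
  | [_, _], _ => trivial
  | [_, _, _], _ => trivial
  | [_, _, _, _], _ => trivial
  | [_, _, _, _, _], _ => trivial

theorem Conf.gd3W (h : Conf V T a₁ a₂ a₃ c₁ c₂ c₃ W) (s t : α) (r : List α)
    (hr : Gd3 T (s :: t :: r)) : ∀ l : List α,
    (l ++ [s, t, a₁, a₂, a₃, c₁, c₂, c₃]).Nodup → Gd3 T (l ++ s :: t :: r)
  | [], _ => hr
  | [a], hn => ⟨h.noW (by refine hn.sublist ?_; simp), hr⟩
  | [a, b], hn => ⟨h.noW (by refine hn.sublist ?_; simp),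
      h.gd3W s t r hr [b] (List.nodup_cons.1 hn).2⟩
  | a :: b :: c :: l, hn => ⟨h.noW (by
        refine hn.sublist ?_
        simp only [List.cons_append, List.cons_sublist_cons]
        refine List.Sublist.trans ?_ (List.sublist_append_right _ _)
        simp),
      h.gd3W s t r hr (b :: c :: l) (List.nodup_cons.1 hn).2⟩

/-- order at least 13 -/
theorem Conf.m7 [DecidableEq α] {w v x y z s t : α} {l : List α}
    (h : Conf V T a₁ a₂ a₃ c₁ c₂ c₃ (x :: y :: s :: t :: w :: v :: z :: l))
    (h1 : ¬ T x y a₃) (h2 : ¬ T s t c₃) : Goal V T := by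
  have nd := h.nd
  have nd0 := h.nd
  replace nd : [a₁, a₂, a₃, c₁, c₂, c₃, x, y, s, t, w, v, z].Nodup :=
    nd.sublist (by simp)
  have nd' := List.nodup_reverse.2 nd
  have pA := h.pA
  have pC := h.sAC.pA
  have n1 := h.ng h1
  have n2 := h.ng h2
  simp at nd nd'
  have hp : (a₁ :: a₂ :: a₃ :: c₁ :: c₂ :: c₃ :: x :: y :: s :: t :: w :: v :: z :: l).Perm
      (a₁ :: w :: a₂ :: a₃ :: ((x :: y :: z :: l) ++ [s, t, c₃, c₂, v, c₁])) := by
    simp only [List.perm_iff_count, List.count_cons, List.count_append, List.count_nil]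
    intro a; omega
  have hn := hp.nodup_iff.1 h.nd
  refine h.goal _ hp ?_ (Or.inr ?_)
  · have key : Gd3 T ((x :: y :: z :: l) ++ s :: t :: [c₃, c₂, v, c₁]) := by
      apply h.gd3W
      · simp [Gd3, pA, pC, nd, nd', n2]
      · have hp : (x :: y :: s :: t :: w :: v :: z :: l ++ [a₁, a₂, a₃, c₁, c₂, c₃]).Nodup := by
          have : ([a₁, a₂, a₃, c₁, c₂, c₃] ++ x :: y :: s :: t :: w :: v :: z :: l).Nodup := nd0
          exact (List.perm_append_comm.nodup_iff).1 this
        have hq : (x :: y :: s :: t :: w :: v :: z :: l ++ [a₁, a₂, a₃, c₁, c₂, c₃]).Perm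
          ([w, v] ++ (x :: y :: z :: l ++ [s, t, a₁, a₂, a₃, c₁, c₂, c₃])) := by
          simp only [List.perm_iff_count, List.count_cons, List.count_append, List.count_nil]
          intro a; omega
        exact (List.nodup_append.1 (hq.nodup_iff.1 hp)).2.1
    refine ⟨?_, ?_, ?_, ?_, key⟩ <;> simp [pA, pC, nd, nd', n1]
  · have key : Gd6 T ((x :: y :: z :: l) ++ s :: t :: [c₃, c₂, v, c₁]) := by
      apply h.gd6A
      have hq : (a₁ :: w :: a₂ :: a₃ :: ((x :: y :: z :: l) ++ [s, t, c₃, c₂, v, c₁])).Perm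
        ([w] ++ (((x :: y :: z :: l) ++ s :: t :: [c₃, c₂, v, c₁]) ++ [a₁, a₂, a₃])) := by
        simp only [List.perm_iff_count, List.count_cons, List.count_append, List.count_nil]
        intro a; omega
      exact (List.nodup_append.1 (hq.nodup_iff.1 hn)).2.1
    rcases l with _ | ⟨p, _ | ⟨q, l⟩⟩
    · refine ⟨h.noC ?_, h.noC ?_, h.noC ?_, h.noC ?_, key⟩ <;> simp [nd, nd']
    · have nr := List.nodup_reverse.2 nd0
      simp at nd0 nr
      refine ⟨h.noC ?_, h.noC ?_, h.noC ?_, h.noC ?_, key⟩ <;> simp [nd0, nr]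
    · replace nd0 : [a₁, a₂, a₃, c₁, c₂, c₃, x, y, s, t, w, v, z, p, q].Nodup :=
        nd0.sublist (by simp)
      have nr := List.nodup_reverse.2 nd0
      simp at nd0 nr
      refine ⟨h.noC ?_, h.noC ?_, h.noC ?_, h.noC ?_, key⟩ <;> simp [nd0, nr]

theorem Conf.pickA1 (h : Conf V T a₁ a₂ a₃ c₁ c₂ c₃ W) (P : α → Prop)
    (hP : ∀ x y, P x → P y → x = y) :
    ∃ b₁ b₂ b₃, Conf V T b₁ b₂ b₃ c₁ c₂ c₃ W ∧ ¬ P b₁ := by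
  by_cases h1 : P a₁
  · refine ⟨_, _, _, h.sA, fun h2 => ?_⟩
    have nd := h.nd
    have := hP _ _ h1 h2
    simp [this] at nd
  · exact ⟨_, _, _, h, h1⟩

theorem Conf.pickA2 (h : Conf V T a₁ a₂ a₃ c₁ c₂ c₃ W) (P : α → Prop)
    (hP : ∀ x y, P x → P y → x = y) :
    ∃ b₂ b₃, Conf V T a₁ b₂ b₃ c₁ c₂ c₃ W ∧ ¬ P b₂ := by
  by_cases h1 : P a₂
  · refine ⟨_, _, h.rA, fun h2 => ?_⟩
    have nd := h.nd
    have := hP _ _ h1 h2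
    simp [this] at nd
  · exact ⟨_, _, h, h1⟩

theorem Conf.pickC1 (h : Conf V T a₁ a₂ a₃ c₁ c₂ c₃ W) (P : α → Prop)
    (hP : ∀ x y, P x → P y → x = y) :
    ∃ b₁ b₂ b₃, Conf V T a₁ a₂ a₃ b₁ b₂ b₃ W ∧ ¬ P b₁ := by
  obtain ⟨b₁, b₂, b₃, h', h1⟩ := h.sAC.pickA1 P hP
  exact ⟨_, _, _, h'.sAC, h1⟩

theorem Conf.pickC3 (h : Conf V T a₁ a₂ a₃ c₁ c₂ c₃ W) (P Q : α → Prop)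
    (hP : ∀ x y, P x → P y → x = y) (hQ : ∀ x y, Q x → Q y → x = y) :
    ∃ b₁ b₂ b₃, Conf V T a₁ a₂ a₃ b₁ b₂ b₃ W ∧ ¬ P b₃ ∧ ¬ Q b₃ := by
  have nd := h.nd
  have nd' : [c₁, c₂, c₃].Nodup := by
    simp at nd
    simp [nd]
  simp at nd'
  by_cases h1 : ¬ P c₁ ∧ ¬ Q c₁
  · exact ⟨_, _, _, h.sC.rC, h1⟩
  by_cases h2 : ¬ P c₂ ∧ ¬ Q c₂
  · exact ⟨_, _, _, h.rC, h2⟩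
  by_cases h3 : ¬ P c₃ ∧ ¬ Q c₃
  · exact ⟨_, _, _, h, h3⟩
  exfalso
  grind

theorem four_pig {P₁ P₂ P₃ : α → Prop}
    (h1 : ∀ x y, P₁ x → P₁ y → x = y) (h2 : ∀ x y, P₂ x → P₂ y → x = y)
    (h3 : ∀ x y, P₃ x → P₃ y → x = y) {x y z w : α} (hn : [x, y, z, w].Nodup)
    (hx : P₁ x ∨ P₂ x ∨ P₃ x) (hy : P₁ y ∨ P₂ y ∨ P₃ y) (hz : P₁ z ∨ P₂ z ∨ P₃ z)
    (hw : P₁ w ∨ P₂ w ∨ P₃ w) : False := by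
  simp at hn
  grind

theorem Conf.pick2 (h : Conf V T a₁ a₂ a₃ c₁ c₂ c₃ W) (P₁ P₂ P₃ : α → Prop)
    (h1 : ∀ x y, P₁ x → P₁ y → x = y) (h2 : ∀ x y, P₂ x → P₂ y → x = y)
    (h3 : ∀ x y, P₃ x → P₃ y → x = y) :
    ∃ b₁ b₂ b₃ d₁ d₂ d₃, Conf V T b₁ b₂ b₃ d₁ d₂ d₃ W ∧ ¬ (P₁ b₁ ∨ P₂ b₁ ∨ P₃ b₁) ∧
      ¬ (P₁ b₂ ∨ P₂ b₂ ∨ P₃ b₂) := by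
  have key : ∀ {a₁ a₂ a₃ c₁ c₂ c₃ : α}, Conf V T a₁ a₂ a₃ c₁ c₂ c₃ W →
      (P₁ a₁ ∨ P₂ a₁ ∨ P₃ a₁) → (P₁ a₂ ∨ P₂ a₂ ∨ P₃ a₂) →
      ∃ b₁ b₂ b₃ d₁ d₂ d₃, Conf V T b₁ b₂ b₃ d₁ d₂ d₃ W ∧ ¬ (P₁ b₁ ∨ P₂ b₁ ∨ P₃ b₁) ∧
      ¬ (P₁ b₂ ∨ P₂ b₂ ∨ P₃ b₂) := by
    intro a₁ a₂ a₃ c₁ c₂ c₃ h ha₁ ha₂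
    have nd := h.nd
    have n1 : [a₁, a₂, c₁, c₂].Nodup := nd.sublist (by simp)
    have n2 : [a₁, a₂, c₁, c₃].Nodup := nd.sublist (by simp)
    have n3 : [a₁, a₂, c₂, c₃].Nodup := nd.sublist (by simp)
    by_cases k1 : P₁ c₁ ∨ P₂ c₁ ∨ P₃ c₁
    · refine ⟨_, _, _, _, _, _, h.sAC.rA.sA.rA, ?_, ?_⟩
      · exact fun k => four_pig h1 h2 h3 n2 ha₁ ha₂ k1 k
      · exact fun k => four_pig h1 h2 h3 n1 ha₁ ha₂ k1 k
    · by_cases k2 : P₁ c₂ ∨ P₂ c₂ ∨ P₃ c₂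
      · refine ⟨_, _, _, _, _, _, h.sAC.rA, k1, ?_⟩
        exact fun k => four_pig h1 h2 h3 n3 ha₁ ha₂ k2 k
      · exact ⟨_, _, _, _, _, _, h.sAC, k1, k2⟩
  by_cases k1 : P₁ a₁ ∨ P₂ a₁ ∨ P₃ a₁
  · by_cases k2 : P₁ a₂ ∨ P₂ a₂ ∨ P₃ a₂
    · exact key h k1 k2
    · by_cases k3 : P₁ a₃ ∨ P₂ a₃ ∨ P₃ a₃
      · exact key h.rA k1 k3
      · exact ⟨_, _, _, _, _, _, h.sA.rA, k2, k3⟩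
  · by_cases k2 : P₁ a₂ ∨ P₂ a₂ ∨ P₃ a₂
    · by_cases k3 : P₁ a₃ ∨ P₂ a₃ ∨ P₃ a₃
      · exact key h.sA.rA k2 k3
      · exact ⟨_, _, _, _, _, _, h.rA, k1, k3⟩
    · exact ⟨_, _, _, _, _, _, h, k1, k2⟩

theorem Conf.l' (h : Conf V T a₁ a₂ a₃ c₁ c₂ c₃ W) (u v : α) :
    ∀ x y, T u v x → T u v y → x = y := fun x y => h.lin u v x y

theorem Conf.M1 [DecidableEq α] {w : α} (h : Conf V T a₁ a₂ a₃ c₁ c₂ c₃ [w]) : Goal V T := by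
  obtain ⟨_, _, _, h', k⟩ := h.pickC1 (T a₃ w) (h.l' _ _)
  exact h'.sC.m1 (h.ng k).2.1

theorem Conf.M2 [DecidableEq α] {w v : α} (h : Conf V T a₁ a₂ a₃ c₁ c₂ c₃ [w, v]) :
    Goal V T := by
  obtain ⟨_, _, _, h', k⟩ := h.pickC1 (T w a₂) (h.l' _ _)
  exact h'.m2 k

theorem Conf.M3 [DecidableEq α] {u v w : α} (h : Conf V T a₁ a₂ a₃ c₁ c₂ c₃ [u, v, w]) :
    Goal V T := by
  obtain ⟨_, _, _, h', k1⟩ := h.pickC1 (T u v) (h.l' _ _)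
  obtain ⟨_, _, _, h', k2⟩ := h'.pickA1 (T u v) (h.l' _ _)
  obtain ⟨_, _, h', k3⟩ := h'.pickA2 (T v _) (h.l' _ _)
  exact h'.sC.rC.m3 k2 k1 k3

theorem Conf.M4 [DecidableEq α] {w₁ w₂ w₃ w₄ : α}
    (h : Conf V T a₁ a₂ a₃ c₁ c₂ c₃ [w₁, w₂, w₃, w₄]) : Goal V T := by
  obtain ⟨_, b₂, _, _, _, _, h, k1, k2⟩ := h.pick2 (T w₁ w₂) (T w₂ w₃) (T w₁ w₃)
    (h.l' _ _) (h.l' _ _) (h.l' _ _)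
  obtain ⟨_, _, _, h, k3, k4⟩ := h.pickC3 (T w₂ w₃) (T w₃ b₂) (h.l' _ _) (h.l' _ _)
  push Not at k1 k2
  exact h.m4 k1.1 k1.2.1 k1.2.2 k2.1 k2.2.1 k2.2.2 k3 k4

theorem Conf.m5a [DecidableEq α] {w v x y z : α}
    (h : Conf V T a₁ a₂ a₃ c₁ c₂ c₃ [w, v, x, y, z])
    (h2 : ¬ (T x y a₂ ∨ T y z a₂ ∨ T x z a₂))
    (h3 : ¬ (T x y a₃ ∨ T y z a₃ ∨ T x z a₃)) :
    Goal V T ∨ BadP T x y z a₃ c₃ c₂ ∨ BadP T x y z a₃ c₂ c₃ := by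
  by_contra hc
  push Not at hc h2 h3
  obtain ⟨hG, h8, h9⟩ := hc
  have nd := h.nd
  have nd' := List.nodup_reverse.2 nd
  simp at nd nd'
  by_cases k : T y z c₃
  · have h' : Conf V T a₁ a₂ a₃ c₁ c₂ c₃ [w, v, y, x, z] := h.pW (by grind)
    apply hG
    refine h'.m5 ?_ ?_ ?_ ?_ ?_ ?_ ?_ ?_ ?_
    · exact (h.ng h2.1).2.2.1
    · exact h2.2.2
    · exact h2.2.1
    · exact (h.ng h3.1).2.2.1
    · exact h3.2.2
    · exact h3.2.1
    · intro k'
      have := h.lin z c₃ x y (h.s1 _ _ _ (h.s2 _ _ _ (h.s1 _ _ _ (h.s2 _ _ _ (h.s1 _ _ _ (h.s2 _ _ _ (h.s1 _ _ _ (h.s1 _ _ _ (h.s2 _ _ _ (h.s1 _ _ _ k')))))))))) (h.s2 _ _ _ (h.s1 _ _ _ k))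
      simp [this] at nd
    · have := h.s1 y x c₃
      unfold BadP at h8 ⊢
      grind
    · have := h.s1 y x c₂
      unfold BadP at h9 ⊢
      grind
  · exact hG (h.m5 h2.1 h2.2.1 h2.2.2 h3.1 h3.2.1 h3.2.2 k h8 h9)

theorem Conf.M5 [DecidableEq α] {w v x y z : α}
    (h : Conf V T a₁ a₂ a₃ c₁ c₂ c₃ [w, v, x, y, z]) : Goal V T := by
  obtain ⟨a₂, a₃, a₁, c₁, c₂, c₃, h, k2, k3⟩ := h.pick2 (T x y) (T y z) (T x z)
    (h.l' _ _) (h.l' _ _) (h.l' _ _)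
  replace h : Conf V T a₁ a₂ a₃ c₁ c₂ c₃ [w, v, x, y, z] := h.rA.sA
  by_contra hG
  have nd := h.nd
  have nd' := List.nodup_reverse.2 nd
  have s2 := h.s2
  have u1 : ∀ c a p q, T p a c → T q a c → p = q := fun c a p q hp hq =>
    h.lin a c p q (s2 _ _ _ (h.s1 _ _ _ hp)) (s2 _ _ _ (h.s1 _ _ _ hq))
  have u2 : ∀ c a a' p, T p a c → T p a' c → a = a' := fun c a a' p hp hq =>
    h.lin p c a a' (s2 _ _ _ hp) (s2 _ _ _ hq)
  have b1 := (h.m5a k2 k3).resolve_left hG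
  have b2 := (h.rC.sC.m5a k2 k3).resolve_left hG
  have b3 := (h.sC.m5a k2 k3).resolve_left hG
  have l1 := h.l' x y
  have l2 := h.l' y z
  have l3 := h.l' x z
  have n3 : [c₁, c₂, c₃].Nodup := by
    simp at nd
    simp [nd]
  simp at n3
  have hxyz : [x, y, z].Nodup := by
    simp at nd
    simp [nd]
  simp at hxyz
  have q1 : T x y c₁ ∨ T y z c₁ ∨ T x z c₁ := by
    unfold BadP at *
    grind
  have q2 : T x y c₂ ∨ T y z c₂ ∨ T x z c₂ := by
    unfold BadP at *
    grind
  have q3 : T x y c₃ ∨ T y z c₃ ∨ T x z c₃ := by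
    unfold BadP at *
    grind
  have k1 : ¬ (T x y a₁ ∨ T y z a₁ ∨ T x z a₁) := by
    intro k1
    refine four_pig l1 l2 l3 (x := c₁) (y := c₂) (z := c₃) (w := a₁) ?_ q1 q2 q3 k1
    simp at nd nd'
    simp [nd, nd']
  have b5 := (h.rA.m5a k3 k2).resolve_left hG
  have b6 := (h.sA.rA.m5a k3 k1).resolve_left hG
  have na : [a₁, a₂, a₃].Nodup := by
    simp at nd
    simp [nd]
  simp at na
  clear b2 b3 k1 k2 k3 nd nd' q1
  unfold BadP at *
  grind

theorem Conf.m6a [DecidableEq α] {w v x y s t : α}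
    (h : Conf V T a₁ a₂ a₃ c₁ c₂ c₃ [w, v, x, y, s, t])
    (h1 : ¬ T x y a₃) (h2 : ¬ T y s a₃) (h3 : ¬ T x s a₃) (h4 : ¬ T s t c₃)
    (h5 : ¬ (T x t a₃ ∧ T y s c₃)) (h6 : ¬ (T y t a₃ ∧ T x s c₃))
    (h7 : ¬ (T s t a₃ ∧ T x y c₃)) : Goal V T := by
  refine h.m6 h1 h4 ?_
  have nd := h.nd
  have nd' := List.nodup_reverse.2 nd
  simp at nd nd'
  have n1 := h.ng h1
  have n2 := h.ng h2
  have n3 := h.ng h3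
  have n4 := h.ng h4
  have n5 := h.ng (h.noW (x := x) (y := y) (z := s) (by simp [nd, nd']))
  have n6 := h.ng (h.noW (x := x) (y := y) (z := t) (by simp [nd, nd']))
  have n7 := h.ng (h.noW (x := x) (y := s) (z := t) (by simp [nd, nd']))
  have n8 := h.ng (h.noW (x := y) (y := s) (z := t) (by simp [nd, nd']))
  have k : ∀ p q, T a₃ p q → T p q a₃ := fun p q hh => h.s2 _ _ _ (h.s1 _ _ _ hh)
  simp only [Bad6, n1, n2, n3, n4, n5, n6, n7, n8, and_false, false_and, or_false, false_or]
  grind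

theorem Conf.m6b [DecidableEq α] {w v x y s t : α}
    (h : Conf V T a₁ a₂ a₃ c₁ c₂ c₃ [w, v, x, y, s, t])
    (h1 : ¬ T x y a₃) (h2 : ¬ T y s a₃) (h3 : ¬ T x s a₃)
    (h5 : ¬ (T x t a₃ ∧ T y s c₃)) (h6 : ¬ (T y t a₃ ∧ T x s c₃))
    (h7 : ¬ (T s t a₃ ∧ T x y c₃)) : Goal V T := by
  by_cases k : T s t c₃
  · have h' : Conf V T a₁ a₂ a₃ c₁ c₂ c₃ [w, v, x, s, y, t] := h.pW (by grind)
    have hs := h.s1 s y c₃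
    refine h'.m6a h3 (h.ng h2).2.2.1 h1 ?_ (by tauto) h7 h6
    intro k'
    have := h.lin t c₃ s y (h.s2 _ _ _ (h.s1 _ _ _ (h.s2 _ _ _ (h.s1 _ _ _ (h.s2 _ _ _ (h.s2 _ _ _ (h.s1 _ _ _ (h.s2 _ _ _ (h.s1 _ _ _ (h.s1 _ _ _ k))))))))))
      (h.s2 _ _ _ (h.s1 _ _ _ k'))
    have nd := h.nd
    simp [this] at nd
  · exact h.m6a h1 h2 h3 k h5 h6 h7

theorem Conf.m6c [DecidableEq α] {w v x y s t : α}
    (h : Conf V T a₁ a₂ a₃ c₁ c₂ c₃ [w, v, x, y, s, t])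
    (h1 : ¬ T x y a₃) (h2 : ¬ T y s a₃) (h3 : ¬ T x s a₃) : Goal V T := by
  by_contra hG
  have h' : Conf V T a₁ a₂ a₃ c₁ c₂ c₃ [t, v, x, y, s, w] := h.pW (by grind)
  have e1 : (T x t a₃ ∧ T y s c₃) ∨ (T y t a₃ ∧ T x s c₃) ∨ (T s t a₃ ∧ T x y c₃) := by
    by_contra hc
    simp only [not_or] at hc
    exact hG (h.m6b h1 h2 h3 hc.1 hc.2.1 hc.2.2)
  have e2 : (T x w a₃ ∧ T y s c₃) ∨ (T y w a₃ ∧ T x s c₃) ∨ (T s w a₃ ∧ T x y c₃) := by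
    by_contra hc
    simp only [not_or] at hc
    exact hG (h'.m6b h1 h2 h3 hc.1 hc.2.1 hc.2.2)
  have nd : [x, y, s, t, w].Nodup := by
    have nd := h.nd
    have nd' := List.nodup_reverse.2 nd
    simp at nd nd'
    simp [nd, nd']
  simp at nd
  have u1 : ∀ c a p q, T p a c → T p q c → a = q := fun c a p q hp hq =>
    h.lin p c _ _ (h.s2 _ _ _ hp) (h.s2 _ _ _ hq)
  have u2 : ∀ c a p q, T p a c → T q a c → p = q := fun c a p q hp hq =>
    u1 c _ _ _ (h.s1 _ _ _ hp) (h.s1 _ _ _ hq)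
  have := h.s1 x y c₃
  grind

theorem Conf.m6e [DecidableEq α] {p e f g u v : α}
    (h : Conf V T a₁ a₂ a₃ c₁ c₂ c₃ [p, e, f, g, u, v])
    (h1 : ¬ T p e a₃) (h2 : ¬ T p f a₃) (h3 : ¬ T p g a₃) : Goal V T := by
  by_cases k : T e f a₃
  · have h' : Conf V T a₁ a₂ a₃ c₁ c₂ c₃ [u, v, p, e, g, f] := h.pW (by grind)
    refine h'.m6c h1 ?_ h3
    intro k'
    have := h.lin e a₃ f g (h.s2 _ _ _ k) (h.s2 _ _ _ k')
    have nd := h.nd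
    simp [this] at nd
  · have h' : Conf V T a₁ a₂ a₃ c₁ c₂ c₃ [u, v, p, e, f, g] := h.pW (by grind)
    exact h'.m6c h1 k h2

theorem Conf.M6 [DecidableEq α] {w₁ w₂ w₃ w₄ w₅ w₆ : α}
    (h : Conf V T a₁ a₂ a₃ c₁ c₂ c₃ [w₁, w₂, w₃, w₄, w₅, w₆]) : Goal V T := by
  have nd : [w₂, w₃, w₄, w₅].Nodup := by
    have nd := h.nd
    simp at nd
    simp [nd]
  simp at nd
  have u1 : ∀ q r, T w₁ q a₃ → T w₁ r a₃ → q = r := fun q r hp hq =>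
    h.lin w₁ a₃ _ _ (h.s2 _ _ _ hp) (h.s2 _ _ _ hq)
  by_cases k2 : T w₁ w₂ a₃
  · have h' : Conf V T a₁ a₂ a₃ c₁ c₂ c₃ [w₁, w₃, w₄, w₅, w₂, w₆] := h.pW (by grind)
    exact h'.m6e (by grind) (by grind) (by grind)
  by_cases k3 : T w₁ w₃ a₃
  · have h' : Conf V T a₁ a₂ a₃ c₁ c₂ c₃ [w₁, w₂, w₄, w₅, w₃, w₆] := h.pW (by grind)
    exact h'.m6e (by grind) (by grind) (by grind)
  by_cases k4 : T w₁ w₄ a₃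
  · have h' : Conf V T a₁ a₂ a₃ c₁ c₂ c₃ [w₁, w₂, w₃, w₅, w₄, w₆] := h.pW (by grind)
    exact h'.m6e (by grind) (by grind) (by grind)
  · exact h.m6e k2 k3 k4

theorem Conf.m7a [DecidableEq α] {x y s t w v z : α} {l : List α}
    (h : Conf V T a₁ a₂ a₃ c₁ c₂ c₃ (x :: y :: s :: t :: w :: v :: z :: l))
    (h1 : ¬ T x y a₃) : Goal V T := by
  by_cases k : T s t c₃
  · have h' : Conf V T a₁ a₂ a₃ c₁ c₂ c₃ (x :: y :: s :: w :: t :: v :: z :: l) := h.pW (by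
      simp only [List.perm_iff_count, List.count_cons]
      intro a; omega)
    refine h'.m7 h1 ?_
    intro k'
    have := h.lin s c₃ t w (h.s2 _ _ _ k) (h.s2 _ _ _ k')
    have nd := h.nd
    simp [this] at nd
  · exact h.m7 h1 k

theorem Conf.M7 [DecidableEq α] {x y s t w v z : α} {l : List α}
    (h : Conf V T a₁ a₂ a₃ c₁ c₂ c₃ (x :: y :: s :: t :: w :: v :: z :: l)) : Goal V T := by
  by_cases k : T x y a₃
  · have h' : Conf V T a₁ a₂ a₃ c₁ c₂ c₃ (x :: s :: y :: t :: w :: v :: z :: l) := h.pW (by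
      simp only [List.perm_iff_count, List.count_cons]
      intro a; omega)
    refine h'.m7a ?_
    intro k'
    have := h.lin x a₃ y s (h.s2 _ _ _ k) (h.s2 _ _ _ k')
    have nd := h.nd
    simp [this] at nd
  · exact h.m7a k

theorem Conf.M [DecidableEq α] : ∀ {W : List α}, Conf V T a₁ a₂ a₃ c₁ c₂ c₃ W → Goal V T
  | [], h => h.m0
  | [_], h => h.M1
  | [_, _], h => h.M2
  | [_, _, _], h => h.M3
  | [_, _, _, _], h => h.M4
  | [_, _, _, _, _], h => h.M5
  | [_, _, _, _, _, _], h => h.M6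
  | _ :: _ :: _ :: _ :: _ :: _ :: _ :: _, h => h.M7

end conf

theorem gd3_of {T : α → α → α → Prop} : ∀ l : List α,
    (∀ x y z, [x, y, z].Sublist l → ¬ T x y z) → Gd3 T l
  | [], _ => trivial
  | [_], _ => trivial
  | [_, _], _ => trivial
  | a :: b :: c :: t, h => ⟨h a b c (by simp), gd3_of (b :: c :: t)
      (fun x y z hs => h x y z (hs.trans (List.sublist_cons_self _ _)))⟩

theorem gd6_of {T : α → α → α → Prop} : ∀ l : List α,
    (∀ x y z u v w, [x, y, z, u, v, w].Sublist l → ¬ Bad6 T x y z u v w) → Gd6 T l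
  | [], _ => trivial
  | [_], _ => trivial
  | [_, _], _ => trivial
  | [_, _, _], _ => trivial
  | [_, _, _, _], _ => trivial
  | [_, _, _, _, _], _ => trivial
  | a :: b :: c :: d :: e :: f :: t, h => ⟨h a b c d e f (by simp),
      gd6_of (b :: c :: d :: e :: f :: t)
      (fun x y z u v w hs => h x y z u v w (hs.trans (List.sublist_cons_self _ _)))⟩

theorem T_nd [DecidableEq α] {V : Finset α} {B : Finset (Finset α)} (hT : IsPSTS V B)
    {x y z : α} (h : TB B x y z) : x ≠ y ∧ x ≠ z ∧ y ≠ z := by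
  have := (hT.1 _ h).2
  refine ⟨?_, ?_, ?_⟩ <;> rintro rfl
  · have k := Finset.card_le_two (a := x) (b := z)
    simp at this
    omega
  · have k := Finset.card_le_two (a := y) (b := x)
    have e : ({x, y, x} : Finset α) = {y, x} := by ext; simp
    rw [e] at this
    omega
  · have k := Finset.card_le_two (a := x) (b := y)
    simp at this
    omega

theorem T_s1 [DecidableEq α] {B : Finset (Finset α)} {x y z : α} (h : TB B x y z) :
    TB B y x z := by
  unfold TB at *
  rwa [Finset.insert_comm]

theorem T_s2 [DecidableEq α] {B : Finset (Finset α)} {x y z : α} (h : TB B x y z) :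
    TB B x z y := by
  unfold TB at *
  rwa [Finset.pair_comm]

theorem T_lin [DecidableEq α] {V : Finset α} {B : Finset (Finset α)} (hT : IsPSTS V B)
    {x y z w : α} (h : TB B x y z) (h' : TB B x y w) : z = w := by
  by_contra hzw
  have n := T_nd hT h
  have hne : ({x, y, z} : Finset α) ≠ {x, y, w} := by
    intro he
    have : z ∈ ({x, y, w} : Finset α) := by rw [← he]; simp
    simp at this
    grind
  have h1 := hT.2 _ h _ h' hne
  have h2 : ({x, y} : Finset α) ⊆ {x, y, z} ∩ {x, y, w} := by
    intro a ha
    simp at ha ⊢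
    tauto
  have h3 := Finset.card_le_card h2
  rw [Finset.card_pair n.1] at h3
  omega

theorem T_no3 [DecidableEq α] {B : Finset (Finset α)}
    (h : ¬ HasDisjointBlocks B 3) (x y z p q r u v w : α)
    (hn : [x, y, z, p, q, r, u, v, w].Nodup) (h1 : TB B x y z) (h2 : TB B p q r)
    (h3 : TB B u v w) : False := by
  have hn' := List.nodup_reverse.2 hn
  simp at hn hn'
  have d1 : Disjoint ({x, y, z} : Finset α) {p, q, r} := by simp [hn, hn']
  have d2 : Disjoint ({x, y, z} : Finset α) {u, v, w} := by simp [hn, hn']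
  have d3 : Disjoint ({p, q, r} : Finset α) {u, v, w} := by simp [hn, hn']
  have e1 : ({x, y, z} : Finset α) ≠ {p, q, r} := d1.ne (by simp)
  have e2 : ({x, y, z} : Finset α) ≠ {u, v, w} := d2.ne (by simp)
  have e3 : ({p, q, r} : Finset α) ≠ {u, v, w} := d3.ne (by simp)
  refine h ⟨{{x, y, z}, {p, q, r}, {u, v, w}}, ?_, Finset.card_eq_three.2 ⟨_, _, _, e1, e2, e3, rfl⟩, ?_⟩
  · intro b hb
    simp at hb
    rcases hb with rfl | rfl | rfl <;> assumption
  · intro b hb c hc hbc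
    simp only [Finset.coe_insert, Finset.coe_singleton, Set.mem_insert_iff,
      Set.mem_singleton_iff] at hb hc
    rcases hb with rfl | rfl | rfl <;> rcases hc with rfl | rfl | rfl <;>
      first | exact absurd rfl hbc | assumption | (apply Disjoint.symm; assumption)

/-- no two disjoint blocks -/
theorem one_case [DecidableEq α] {V : Finset α} {B : Finset (Finset α)} (hT : IsPSTS V B)
    (h2 : ∀ x y z u v w, [x, y, z, u, v, w].Nodup → TB B x y z → TB B u v w → False)
    {a₁ a₂ a₃ : α} (hA : TB B a₁ a₂ a₃) (W : List α) (hn : (a₁ :: a₂ :: a₃ :: W).Nodup)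
    (hm : ∀ x, x ∈ V ↔ x ∈ a₁ :: a₂ :: a₃ :: W) : Goal V (TB B) := by
  have g6 : ∀ l : List α, l.Nodup → Gd6 (TB B) l := by
    intro l hl
    refine gd6_of l ?_
    intro x y z u v w hs hb
    have hs' := hl.sublist hs
    refine bad6_cases ?_ hb
    intro p q r p' q' r' hp k1 k2
    exact h2 _ _ _ _ _ _ (hp.nodup_iff.1 hs') k1 k2
  have fin : ∀ l : List α, (a₁ :: a₂ :: a₃ :: W).Perm l → (l.length = 3 ∨ Gd3 (TB B) l) →
      Goal V (TB B) := by
    intro l hp h3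
    refine ⟨l, hp.nodup_iff.1 hn, ?_, h3, Or.inr (g6 l (hp.nodup_iff.1 hn))⟩
    ext x
    rw [List.mem_toFinset, ← hp.mem_iff, hm]
  have a1 : ∀ w, TB B a₁ w a₂ → w = a₃ := fun w k => T_lin hT (T_s2 k) hA
  have a2 : ∀ w, TB B w a₂ a₃ → w = a₁ := fun w k =>
    T_lin hT (T_s2 (T_s1 k)) (T_s2 (T_s1 hA))
  have a3 : ∀ w, TB B a₂ a₃ w → w = a₁ := fun w k =>
    T_lin hT k (T_s2 (T_s1 hA))
  have gW : ∀ l : List α, l.Sublist W → Gd3 (TB B) l := by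
    intro l hl
    refine gd3_of l ?_
    intro x y z hs ht
    refine h2 a₁ a₂ a₃ x y z ?_ hA ht
    exact hn.sublist (by simpa using hs.trans hl)
  match W, hn, fin, gW with
  | [], _, fin, _ => exact fin _ (List.Perm.refl _) (Or.inl rfl)
  | [w], hn, fin, _ =>
    refine fin [a₁, w, a₂, a₃] (by grind) (Or.inr ?_)
    simp only [Gd3]
    grind
  | [w, v], hn, fin, _ =>
    refine fin [a₁, w, a₂, a₃, v] (by grind) (Or.inr ?_)
    simp only [Gd3]
    grind
  | w :: x :: y :: l, hn, fin, gW =>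
    have nn : [a₁, a₂, a₃, w, x, y].Nodup := hn.sublist (by simp)
    by_cases k : TB B a₃ x y
    · refine fin (a₁ :: x :: a₂ :: a₃ :: w :: y :: l) ?_ (Or.inr ?_)
      · simp only [List.perm_iff_count, List.count_cons]
        intro a; omega
      · have k' : ¬ TB B a₃ w y := by
          intro k'
          have := T_lin hT (T_s2 k) (T_s2 k')
          simp [this] at hn
        have := gW (w :: y :: l) (by simp)
        exact ⟨fun q => by simp [a1 _ q] at nn, fun q => by simp [a2 _ q] at nn,
          fun q => by simp [a3 _ q] at nn, k', this⟩
    · refine fin (a₁ :: w :: a₂ :: a₃ :: x :: y :: l) ?_ (Or.inr ?_)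
      · simp only [List.perm_iff_count, List.count_cons]
        intro a; omega
      · have := gW (x :: y :: l) (by simp)
        exact ⟨fun q => by simp [a1 _ q] at nn, fun q => by simp [a2 _ q] at nn,
          fun q => by simp [a3 _ q] at nn, k, this⟩

theorem main_goal [DecidableEq α] {V : Finset α} {B : Finset (Finset α)} (hT : IsPSTS V B)
    (h : ¬ HasDisjointBlocks B 3) : Goal V (TB B) := by
  by_cases h0 : ∀ x y z, ¬ TB B x y z
  · refine ⟨V.toList, V.nodup_toList, V.toList_toFinset, Or.inr (gd3_of _ fun x y z _ => h0 x y z),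
      Or.inr (gd6_of _ fun x y z u v w _ hb => ?_)⟩
    unfold Bad6 at hb
    simp [h0] at hb
  by_cases h2 : ∀ x y z u v w, [x, y, z, u, v, w].Nodup → TB B x y z → TB B u v w → False
  · push Not at h0
    obtain ⟨x, y, z, hA⟩ := h0
    have hs := (hT.1 _ hA).1
    have n := T_nd hT hA
    refine one_case hT h2 hA (V \ {x, y, z}).toList ?_ ?_
    · have := Finset.nodup_toList (V \ {x, y, z})
      simp [this, n]
    · intro a
      have := @hs a
      simp at this ⊢
      tauto
  · push Not at h2
    obtain ⟨x, y, z, u, v, w, hn, hA, hC, -⟩ := h2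
    have hs := (hT.1 _ hA).1
    have hs' := (hT.1 _ hC).1
    have c : Conf V (TB B) x y z u v w (V \ {x, y, z, u, v, w}).toList := by
      refine ⟨fun _ _ _ => T_s1, fun _ _ _ => T_s2, fun _ _ _ _ => T_lin hT, hA, hC,
        T_no3 h, ?_, ?_⟩
      · have := Finset.nodup_toList (V \ {x, y, z, u, v, w})
        simp at hn
        simp [this, hn]
      · intro a
        have := @hs a
        have := @hs' a
        simp at *
        tauto
    exact c.M

end SeqPf

/-- Every partial Steiner triple system with at most two pairwise disjoint
blocks (i.e. without three pairwise disjoint blocks) is sequenceable. -/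
theorem sequenceable_of_at_most_two_disjoint_blocks {α : Type*} [DecidableEq α]
    (V : Finset α) (B : Finset (Finset α)) (hT : IsPSTS V B)
    (h : ¬ HasDisjointBlocks B 3) :
    Sequenceable V B := by
  obtain ⟨l, h1, h2, h3, h4⟩ := SeqPf.main_goal hT h
  exact SeqPf.finish hT h l h1 h2 h3 h4
end

section
/- Every partial Steiner triple system of order 9 that has three pairwise disjoint blocks is sequenceable. -/
namespace SeqNine

/-- Two sets that may both be blocks. -/
def Compat (p q : Finset (Fin 9)) : Prop := (p ∩ q).card ≠ 2

instance (p q : Finset (Fin 9)) : Decidable (Compat p q) :=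
  inferInstanceAs (Decidable ((p ∩ q).card ≠ 2))

/-- A set that is compatible with the three given blocks. -/
def Good (p : Finset (Fin 9)) : Prop :=
  Compat p {0, 1, 2} ∧ Compat p {3, 4, 5} ∧ Compat p {6, 7, 8}

instance (p : Finset (Fin 9)) : Decidable (Good p) :=
  inferInstanceAs (Decidable (Compat p {0, 1, 2} ∧ Compat p {3, 4, 5} ∧ Compat p {6, 7, 8}))

abbrev l1 : List (Fin 9) := [0, 4, 1, 2, 7, 8, 5, 6, 3]
abbrev l2 : List (Fin 9) := [0, 4, 1, 2, 8, 6, 5, 7, 3]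

abbrev S1 : Finset (Fin 9) := {4, 1, 2, 7, 8, 5}
abbrev S2 : Finset (Fin 9) := {4, 1, 2, 8, 6, 5}


theorem inter_card (p q : Finset (Fin 9)) :
    (p ∩ q).card = ∑ i : Fin 9, (decide (i ∈ p) && decide (i ∈ q)).toNat := by
  rw [Finset.card_eq_sum_ones, ← Finset.sum_filter_add_sum_filter_not Finset.univ (· ∈ p ∩ q)
    (fun i => (decide (i ∈ p) && decide (i ∈ q)).toNat)]
  rw [Finset.sum_eq_zero (s := Finset.univ.filter (fun i => ¬ i ∈ p ∩ q))]
  · rw [add_zero, Finset.filter_mem_eq_inter, Finset.univ_inter]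
    refine Finset.sum_congr rfl fun i hi => ?_
    obtain ⟨h1, h2⟩ := Finset.mem_inter.1 hi
    simp [h1, h2]
  · intro i hi
    have := (Finset.mem_filter.1 hi).2
    rw [Finset.mem_inter] at this
    by_cases h1 : i ∈ p <;> by_cases h2 : i ∈ q <;> simp_all

/-- Not exactly two of three. -/
abbrev NotTwo (a b c : Bool) : Prop := a.toNat + b.toNat + c.toNat ≠ 2

theorem good_bool {p : Finset (Fin 9)} (h : Good p) :
    NotTwo (decide (0 ∈ p)) (decide (1 ∈ p)) (decide (2 ∈ p)) ∧
    NotTwo (decide (3 ∈ p)) (decide (4 ∈ p)) (decide (5 ∈ p)) ∧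
    NotTwo (decide (6 ∈ p)) (decide (7 ∈ p)) (decide (8 ∈ p)) := by
  simpa [Good, Compat, inter_card, Fin.sum_univ_succ, add_assoc] using h

theorem three1 : ∀ i < 7, ¬ Good ((l1.drop i).take 3).toFinset := by
  intro i hi h
  have := good_bool h
  interval_cases i <;> simp at this

theorem three2 : ∀ i < 7, ¬ Good ((l2.drop i).take 3).toFinset := by
  intro i hi h
  have := good_bool h
  interval_cases i <;> simp at this

/-- A six-element set consisting of a block `g` and a non-block. -/
theorem six_aux {S g : Finset (Fin 9)} (hg : g.card = 3) (hgS : g ⊆ S) (hS : ¬ Good (S \ g))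
    {p : Finset (Fin 9)} (hpS : p ⊆ S) (hp : p.card = 3) (hq : (S \ p).card = 3)
    (hpg : Compat p g) (hqg : Compat (S \ p) g) (h1 : Good p) (h2 : Good (S \ p)) : False := by
  have key : (p ∩ g).card + ((S \ p) ∩ g).card = g.card := by
    rw [← Finset.card_union_of_disjoint, ← Finset.union_inter_distrib_right,
      Finset.union_sdiff_of_subset hpS, Finset.inter_eq_right.2 hgS]
    exact Finset.disjoint_sdiff.mono Finset.inter_subset_left Finset.inter_subset_left
  have e : ∀ r : Finset (Fin 9), r.card = 3 → (r ∩ g).card = 3 → r = g := fun r hr h =>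
    (Finset.eq_of_subset_of_card_le Finset.inter_subset_left (by omega)).symm.trans
      (Finset.eq_of_subset_of_card_le Finset.inter_subset_right (by omega))
  unfold Compat at hpg hqg
  have : (p ∩ g).card = 3 ∨ ((S \ p) ∩ g).card = 3 := by omega
  rcases this with h | h
  · rw [e p hp h] at h2; exact hS h2
  · rw [← e _ hq h, Finset.sdiff_sdiff_eq_self hpS] at hS; exact hS h1

theorem six_aux1 : ∀ i < 4, i ≠ 1 → ∃ g ∈ ([{0, 1, 2}, {3, 4, 5}, {6, 7, 8}] : List (Finset (Fin 9))),
    g ⊆ ((l1.drop i).take 6).toFinset ∧ ¬ Good (((l1.drop i).take 6).toFinset \ g) := by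
  intro i hi h
  interval_cases i
  · exact ⟨{0, 1, 2}, by simp, by decide, fun h => by simpa using good_bool h⟩
  · exact absurd rfl h
  · exact ⟨{6, 7, 8}, by simp, by decide, fun h => by simpa using good_bool h⟩
  · exact ⟨{6, 7, 8}, by simp, by decide, fun h => by simpa using good_bool h⟩

theorem six_aux2 : ∀ i < 4, i ≠ 1 → ∃ g ∈ ([{0, 1, 2}, {3, 4, 5}, {6, 7, 8}] : List (Finset (Fin 9))),
    g ⊆ ((l2.drop i).take 6).toFinset ∧ ¬ Good (((l2.drop i).take 6).toFinset \ g) := by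
  intro i hi h
  interval_cases i
  · exact ⟨{0, 1, 2}, by simp, by decide, fun h => by simpa using good_bool h⟩
  · exact absurd rfl h
  · exact ⟨{6, 7, 8}, by simp, by decide, fun h => by simpa using good_bool h⟩
  · exact ⟨{6, 7, 8}, by simp, by decide, fun h => by simpa using good_bool h⟩

theorem six_of {S : Finset (Fin 9)} (hS : S.card = 6)
    (h : ∃ g ∈ ([{0, 1, 2}, {3, 4, 5}, {6, 7, 8}] : List (Finset (Fin 9))),
      g ⊆ S ∧ ¬ Good (S \ g)) :
    ∀ p ∈ Finset.powersetCard 3 S, Good p → ¬ Good (S \ p) := by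
  intro p hp h1 h2
  obtain ⟨hpS, hp3⟩ := Finset.mem_powersetCard.1 hp
  have hq : (S \ p).card = 3 := by rw [Finset.card_sdiff_of_subset hpS]; omega
  obtain ⟨g, hg, hgS, hgG⟩ := h
  simp only [List.mem_cons, List.not_mem_nil, or_false] at hg
  rcases hg with rfl | rfl | rfl
  · exact six_aux rfl hgS hgG hpS hp3 hq h1.1 h2.1 h1 h2
  · exact six_aux rfl hgS hgG hpS hp3 hq h1.2.1 h2.2.1 h1 h2
  · exact six_aux rfl hgS hgG hpS hp3 hq h1.2.2 h2.2.2 h1 h2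

theorem six1 : ∀ i < 4, i ≠ 1 → ∀ p ∈ Finset.powersetCard 3 ((l1.drop i).take 6).toFinset,
    Good p → ¬ Good (((l1.drop i).take 6).toFinset \ p) := by
  intro i hi hi1
  exact six_of (by interval_cases i <;> rfl) (six_aux1 i hi hi1)

theorem six2 : ∀ i < 4, i ≠ 1 → ∀ p ∈ Finset.powersetCard 3 ((l2.drop i).take 6).toFinset,
    Good p → ¬ Good (((l2.drop i).take 6).toFinset \ p) := by
  intro i hi hi1
  exact six_of (by interval_cases i <;> rfl) (six_aux2 i hi hi1)

abbrev Cnt (a b c d e : Bool) : Prop := a.toNat + (b.toNat + (c.toNat + (d.toNat + e.toNat))) ≠ 2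

theorem bool_clash : ∀ a b c x y z : Bool,
    Cnt (a && x) (!a && !x) (b && y) (!b && !y) (!c && !z) →
    Cnt (a && !x) (!a && x) (b && !y) (!b && y) (!c && z) →
    Cnt (!a && x) (a && !x) (!b && y) (b && !y) (c && !z) →
    ¬ Cnt (!a && !x) (a && x) (!b && !y) (b && y) (c && z) := by
  decide +kernel

theorem bool_pair : ∀ a b : Bool, ¬ a.toNat + b.toNat = 2 → ¬ (!a).toNat + (!b).toNat = 2 →
    b = !a := by
  decide

theorem clash : ∀ p ∈ Finset.powersetCard 3 S1, Good p → Good (S1 \ p) →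
    ∀ q ∈ Finset.powersetCard 3 S2, Good q → Good (S2 \ q) →
    ¬ (Compat p q ∧ Compat p (S2 \ q) ∧ Compat (S1 \ p) q ∧ Compat (S1 \ p) (S2 \ q)) := by
  rintro p hp g1 g2 q hq g3 g4 ⟨c1, c2, c3, c4⟩
  have hpS := (Finset.mem_powersetCard.1 hp).1
  have hqS := (Finset.mem_powersetCard.1 hq).1
  have p0 : 0 ∉ p := fun h => absurd (hpS h) (by decide)
  have p3 : 3 ∉ p := fun h => absurd (hpS h) (by decide)
  have p6 : 6 ∉ p := fun h => absurd (hpS h) (by decide)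
  have q0 : 0 ∉ q := fun h => absurd (hqS h) (by decide)
  have q3 : 3 ∉ q := fun h => absurd (hqS h) (by decide)
  have q7 : 7 ∉ q := fun h => absurd (hqS h) (by decide)
  replace g1 := good_bool g1
  replace g2 := good_bool g2
  replace g3 := good_bool g3
  replace g4 := good_bool g4
  unfold Compat at c1 c2 c3 c4
  rw [inter_card] at c1 c2 c3 c4
  simp only [Fin.sum_univ_succ] at c1 c2 c3 c4
  simp [p0, p3, p6, q0, q3, q7] at g1 g2 g3 g4 c1 c2 c3 c4
  rw [bool_pair _ _ g1.1 g2.1, bool_pair _ _ g1.2.1 g2.2.1, bool_pair _ _ g1.2.2 g2.2.2,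
    bool_pair _ _ g3.1 g4.1, bool_pair _ _ g3.2.1 g4.2.1, bool_pair _ _ g3.2.2 g4.2.2]
    at c1 c2 c3 c4
  exact bool_clash (decide (1 ∈ p)) (decide (4 ∈ p)) (decide (7 ∈ p)) (decide (1 ∈ q))
    (decide (4 ∈ q)) (decide (6 ∈ q)) (by simpa using c1) (by simpa using c2) (by simpa using c3)
    (by simpa using c4)

theorem part_card {B : Finset (Finset (Fin 9))} (hB : ∀ b ∈ B, b.card = 3)
    {S : Finset (Fin 9)} (h : IsBlockPartition B S) :
    3 ∣ S.card ∧ (S.card = 3 → S ∈ B) ∧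
      (S.card = 6 → ∃ p ∈ Finset.powersetCard 3 S, p ∈ B ∧ S \ p ∈ B) := by
  obtain ⟨P, hP, hd, rfl⟩ := h
  have hc : (P.biUnion id).card = P.card * 3 := by
    rw [Finset.card_biUnion (t := id) (fun x hx y hy hxy => hd hx hy hxy)]
    exact Finset.sum_const_nat (fun x hx => hB x (hP hx))
  refine ⟨⟨P.card, by omega⟩, fun h => ?_, fun h => ?_⟩
  · obtain ⟨p, rfl⟩ := Finset.card_eq_one.1 (show P.card = 1 by omega)
    simpa using hP
  · obtain ⟨p, q, hpq, rfl⟩ := Finset.card_eq_two.1 (show P.card = 2 by omega)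
    have hp : p ∈ B := hP (by simp)
    have hq : q ∈ B := hP (by simp)
    have hdis : Disjoint p q := hd (by simp) (by simp) hpq
    have hu : ({p, q} : Finset (Finset (Fin 9))).biUnion id = p ∪ q := by
      simp [Finset.biUnion_insert]
    rw [hu]
    refine ⟨p, Finset.mem_powersetCard.2 ⟨Finset.subset_union_left, hB p hp⟩, hp, ?_⟩
    rwa [Finset.union_sdiff_cancel_left hdis]

theorem seq_of {B : Finset (Finset (Fin 9))} (hB : ∀ b ∈ B, b.card = 3)
    (hG : ∀ b ∈ B, Good b) (l : List (Fin 9)) (hl : l.Nodup) (hlen : l.length = 9)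
    (h3 : ∀ i < 7, ¬ Good ((l.drop i).take 3).toFinset)
    (h6 : ∀ i < 4, i ≠ 1 → ∀ p ∈ Finset.powersetCard 3 ((l.drop i).take 6).toFinset,
      Good p → ¬ Good (((l.drop i).take 6).toFinset \ p))
    (h1 : ¬ ∃ p ∈ Finset.powersetCard 3 ((l.drop 1).take 6).toFinset,
      p ∈ B ∧ ((l.drop 1).take 6).toFinset \ p ∈ B)
    (i m : ℕ) (hne : (l.drop i).take m ≠ []) (hlt : ((l.drop i).take m).length < l.length) :
    ¬ IsBlockPartition B ((l.drop i).take m).toFinset := by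
  intro h
  obtain ⟨hd, hc3, hc6⟩ := part_card hB h
  have hnd : ((l.drop i).take m).Nodup := hl.sublist
    ((List.take_sublist _ _).trans (List.drop_sublist _ _))
  rw [List.toFinset_card_of_nodup hnd] at hd hc3 hc6
  have hpos := List.length_pos_iff.2 hne
  have hmin : ((l.drop i).take m).length = min m (9 - i) := by simp [hlen]
  have heq : (l.drop i).take m = (l.drop i).take ((l.drop i).take m).length := by
    rw [List.take_eq_take_iff]; simp
  generalize hn : ((l.drop i).take m).length = n at *
  rw [heq] at hc3 hc6
  have : n = 3 ∨ n = 6 := by omega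
  rcases this with rfl | rfl
  · exact h3 i (by omega) (hG _ (hc3 rfl))
  · obtain ⟨p, hp, hpB, hqB⟩ := hc6 rfl
    by_cases hi : i = 1
    · subst hi
      exact h1 ⟨p, hp, hpB, hqB⟩
    · exact h6 i (by omega) hi p hp (hG _ hpB) (hG _ hqB)

theorem fin_case (B : Finset (Finset (Fin 9))) (hT : IsPSTS Finset.univ B)
    (ha : {0, 1, 2} ∈ B) (hb : {3, 4, 5} ∈ B) (hc : {6, 7, 8} ∈ B) :
    Sequenceable Finset.univ B := by
  have hB : ∀ b ∈ B, b.card = 3 := fun b hb => (hT.1 b hb).2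
  have hC : ∀ p ∈ B, ∀ q ∈ B, Compat p q := by
    intro p hp q hq h2
    by_cases h : p = q
    · subst h
      rw [Finset.inter_self, hB p hp] at h2
      omega
    · have := hT.2 p hp q hq h
      omega
  have hG : ∀ b ∈ B, Good b := fun b h => ⟨hC _ h _ ha, hC _ h _ hb, hC _ h _ hc⟩
  by_cases h1 : ∃ p ∈ Finset.powersetCard 3 S1, p ∈ B ∧ S1 \ p ∈ B
  · refine ⟨l2, by decide, by decide, seq_of hB hG l2 (by decide) rfl three2 six2 ?_⟩
    rintro ⟨q, hq, hqB, hqB'⟩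
    obtain ⟨p, hp, hpB, hpB'⟩ := h1
    exact clash p hp (hG _ hpB) (hG _ hpB') q hq (hG _ hqB) (hG _ hqB')
      ⟨hC _ hpB _ hqB, hC _ hpB _ hqB', hC _ hpB' _ hqB, hC _ hpB' _ hqB'⟩
  · exact ⟨l1, by decide, by decide, seq_of hB hG l1 (by decide) rfl three1 six1 h1⟩

theorem transfer {α : Type*} [DecidableEq α] (V : Finset α) (B : Finset (Finset α))
    (hT : IsPSTS V B) (e : Fin 9 ↪ α) (hV : Finset.univ.map e = V)
    (ha : ({0, 1, 2} : Finset (Fin 9)).map e ∈ B) (hb : ({3, 4, 5} : Finset (Fin 9)).map e ∈ B)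
    (hc : ({6, 7, 8} : Finset (Fin 9)).map e ∈ B) : Sequenceable V B := by
  have key : Sequenceable Finset.univ
      (Finset.univ.filter (fun s : Finset (Fin 9) => s.map e ∈ B)) := by
    refine fin_case _ ⟨fun b hb => ?_, fun p hp q hq hpq => ?_⟩ (by simpa using ha)
      (by simpa using hb) (by simpa using hc)
    · have := (hT.1 _ (Finset.mem_filter.1 hb).2).2
      exact ⟨Finset.subset_univ _, by simpa using this⟩
    · have := hT.2 _ (Finset.mem_filter.1 hp).2 _ (Finset.mem_filter.1 hq).2
        (fun h => hpq (Finset.map_injective e h))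
      rwa [← Finset.map_inter, Finset.card_map] at this
  obtain ⟨l, hl, hu, h⟩ := key
  refine ⟨l.map e, hl.map e.injective, ?_, fun i m hne hlt hP => ?_⟩
  · rw [← hV, ← hu]; ext x; simp
  · rw [← List.map_drop, ← List.map_take] at hne hlt hP
    refine h i m (by simpa using hne) (by simpa only [List.length_map] using hlt) ?_
    obtain ⟨P, hPB, hd, hun⟩ := hP
    refine ⟨Finset.univ.filter (fun s : Finset (Fin 9) => s.map e ∈ P), ?_, ?_, ?_⟩
    · intro s hs
      simp only [Finset.mem_filter, Finset.mem_univ, true_and] at hs ⊢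
      exact hPB hs
    · intro s hs t ht hst
      have hs' : s.map e ∈ P := by simpa using hs
      have ht' : t.map e ∈ P := by simpa using ht
      exact (Finset.disjoint_map e).1 (hd hs' ht' (fun h => hst (Finset.map_injective e h)))
    · ext x
      have hx : x ∈ ((l.drop i).take m).toFinset ↔
          e x ∈ (((l.drop i).take m).map e).toFinset := by
        simp [-List.map_take, -List.map_drop]
      rw [hx, ← hun]
      simp only [Finset.mem_biUnion, Finset.mem_filter, Finset.mem_univ, true_and, id]
      constructor
      · rintro ⟨s, hs, hxs⟩
        exact ⟨_, hs, Finset.mem_map_of_mem e hxs⟩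
      · rintro ⟨p, hp, hxp⟩
        have hpV : p ⊆ Finset.univ.map e := hV ▸ (hT.1 p (hPB hp)).1
        obtain ⟨s, -, rfl⟩ := Finset.subset_map_iff.1 hpV
        exact ⟨s, hp, by simpa using hxp⟩

end SeqNine

/-- Every partial Steiner triple system of order 9 having three pairwise
disjoint blocks is sequenceable. -/
theorem sequenceable_order_nine {α : Type*} [DecidableEq α]
    (V : Finset α) (B : Finset (Finset α)) (hT : IsPSTS V B)
    (h9 : V.card = 9) (h3 : HasDisjointBlocks B 3) :
    Sequenceable V B := by
  obtain ⟨P, hPB, hc, hd⟩ := h3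
  obtain ⟨p, q, r, hpq, hpr, hqr, rfl⟩ := Finset.card_eq_three.1 hc
  have hp : p ∈ B := hPB (by simp)
  have hq : q ∈ B := hPB (by simp)
  have hr : r ∈ B := hPB (by simp)
  have dpq : Disjoint p q := hd (by simp) (by simp) hpq
  have dpr : Disjoint p r := hd (by simp) (by simp) hpr
  have dqr : Disjoint q r := hd (by simp) (by simp) hqr
  have hV : p ∪ q ∪ r = V := by
    apply Finset.eq_of_subset_of_card_le
    · exact Finset.union_subset (Finset.union_subset (hT.1 p hp).1 (hT.1 q hq).1) (hT.1 r hr).1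
    · rw [Finset.card_union_of_disjoint (Finset.disjoint_union_left.2 ⟨dpr, dqr⟩),
        Finset.card_union_of_disjoint dpq, (hT.1 p hp).2, (hT.1 q hq).2, (hT.1 r hr).2, h9]
  obtain ⟨a, b, c, hab, hac, hbc, rfl⟩ := Finset.card_eq_three.1 (hT.1 p hp).2
  obtain ⟨a', b', c', hab', hac', hbc', rfl⟩ := Finset.card_eq_three.1 (hT.1 q hq).2
  obtain ⟨x, y, z, hxy, hxz, hyz, rfl⟩ := Finset.card_eq_three.1 (hT.1 r hr).2
  have hnd : [a, b, c, a', b', c', x, y, z].Nodup := by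
    simp only [Finset.disjoint_insert_left, Finset.disjoint_singleton_left, Finset.mem_insert,
      Finset.mem_singleton, not_or] at dpq dpr dqr
    simp only [List.nodup_cons, List.mem_cons, List.not_mem_nil, or_false, not_or, not_false_eq_true,
      List.nodup_nil, and_true]
    tauto
  let e : Fin 9 ↪ α := ⟨fun i => [a, b, c, a', b', c', x, y, z].get i,
    List.nodup_iff_injective_get.1 hnd⟩
  have h012 : ({0, 1, 2} : Finset (Fin 9)).map e = {a, b, c} := by
    simp only [Finset.map_insert, Finset.map_singleton]; rfl
  have h345 : ({3, 4, 5} : Finset (Fin 9)).map e = {a', b', c'} := by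
    simp only [Finset.map_insert, Finset.map_singleton]; rfl
  have h678 : ({6, 7, 8} : Finset (Fin 9)).map e = {x, y, z} := by
    simp only [Finset.map_insert, Finset.map_singleton]; rfl
  refine SeqNine.transfer V B hT e ?_ (h012 ▸ hp) (h345 ▸ hq) (h678 ▸ hr)
  rw [← hV, ← h012, ← h345, ← h678, ← Finset.map_union, ← Finset.map_union]
  congr 1
end

section
/- Every partial Steiner triple system of order 10 that has three pairwise disjoint blocks is sequenceable. -/
namespace SeqTen

inductive Tr where
  | L (p : ℕ)
  | N (t : ℕ) (l r : Tr)

noncomputable def cnd (c x y : Bool) : Bool := Bool.rec y x c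

noncomputable def flt (p : ℕ → Bool) (l : List ℕ) : (List ℕ → Bool) → Bool :=
  List.rec (motive := fun _ => (List ℕ → Bool) → Bool) (fun k => k [])
    (fun a _ ih k => Bool.rec (ih k) (ih (fun r => k (List.cons a r))) (p a)) l

noncomputable def anyb (p : ℕ → Bool) (l : List ℕ) : Bool :=
  List.rec (motive := fun _ => Bool) false (fun a _ ih => Bool.rec ih true (p a)) l

noncomputable def part (n : ℕ) : List ℕ → ℕ → Bool :=
  Nat.rec (motive := fun _ => List ℕ → ℕ → Bool) (fun _ _ => true)
    (fun _ ih A m => flt (fun a => Nat.beq (Nat.land a m) a) A fun sub =>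
      anyb (fun a => Bool.rec (ih sub (Nat.xor m a)) false
        (Nat.beq (Nat.land a (Nat.xor m (Nat.land m (Nat.sub m 1)))) 0)) sub) n

def mk : List ℕ → ℕ
  | [] => 0
  | x :: l => Nat.lor (2 ^ x) (mk l)

def dig : ℕ → ℕ → List ℕ
  | 0, _ => []
  | n + 1, p => (p % 10) :: dig n (p / 10)

noncomputable def leafOK (d A : List ℕ) : Bool :=
  Nat.beq (mk d) 1023 && [1, 2, 3].all fun n => (List.range (11 - 3 * n)).all fun i =>
    !part n A (mk ((d.drop i).take (3 * n)))

noncomputable def compat (t a : ℕ) : Bool :=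
  cnd (Nat.beq a t) true (Nat.beq (Nat.land (Nat.land a t) (Nat.sub (Nat.land a t) 1)) 0)

noncomputable def chk (T : Tr) : List ℕ → Bool :=
  Tr.rec (motive := fun _ => List ℕ → Bool) (fun p A => leafOK (dig 10 p) A)
    (fun t _ _ l r A => cnd (flt (compat t) A l) (flt (fun a => cnd (Nat.beq a t) false true) A r)
      false) T

def pcb (m : ℕ) : ℕ := (List.range 10).foldr (fun k s => (m.testBit k).toNat + s) 0

noncomputable def root (k : List ℕ → Bool) : Bool :=
  flt (fun m => Nat.beq (pcb m) 3 && compat 14 m && compat 112 m && compat 896 m)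
    (List.range 1024) k

open Tr in
def tree : Tr :=
  
  (N 146 (N 290 (N 164 (N 584 (L 2150698374) (N 73 (L 1345760892) 
  (N 276 (L 3142580796) (N 25 (L 1243508769) (N 529 (L 3142586907) (N 580 (L 3142586907) (N 328 (L 1243576809) 
  (N 536 (L 5120743896) (N 577 (L 2145768093) (L 1253684907)))))))))) (N 580 (N 41 (L 1245769083) (L 3152476908)) (N 69 (L 4136275809) 
  (N 548 (N 200 (L 4125607398) (N 280 (N 578 (L 6125398047) (L 2173498506)) (N 584 (L 2153476908) (N 324 (L 3142695807) 
  (N 73 (L 1263478095) (N 168 (L 5102389647) (L 1243675908))))))) (N 517 (L 6134275908) (N 41 (L 1243705698) (N 584 (N 21 (L 2143790856) (L 2143586907)) (N 200 (L 4135296708) 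
  (N 276 (N 521 (L 1345769082) (L 4156732098)) (N 25 (L 5124693087) (N 328 (L 5130268947) (N 168 (N 536 (L 1263470895) (L 6137245809)) (L 8170453269))))))))))))) (N 324 (N 552 (N 164 (L 2143685907) (L 3152698074)) (N 41 
  (N 532 (L 7124360598) (N 578 (L 2143586907) (L 3142679085))) 
  (N 545 (N 200 (L 1345768092) (N 280 (L 1345768092) (L 5120647389))) (N 536 (L 5134276809) (N 164 (N 578 (L 2163874509) (N 200 (L 3152890764) (L 3194576208))) (L 3152476809)))))) (N 276 (N 552 
  (N 67 (L 2153697084) (L 6124509387)) 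
  (N 41 (L 2143780569) (N 584 (N 37 (L 5124609387) (N 546 (L 5124609387) (L 5124376908))) (N 322 (N 196 (L 3142680795) (N 548 
  (N 168 (L 3162570894) (L 1240596783)) 
  (N 168 (L 8120473659) (N 521 (L 1349756082) (L 4102379568))))) (N 577 (L 3142685907) (N 73 (L 2143780659) 
  (N 545 (L 3142586907) (L 2351486907)))))))) (N 548 
  (N 321 (N 280 (L 1253689074) (L 2143687095)) (N 265 (L 1245768093) (L 3182479506))) 
  (N 296 (N 577 (N 164 (L 1245768093) (L 1243759806)) (N 259 (L 2146807953) (N 517 (L 4136287095) (N 196 (L 6124375809) 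
  (N 578 (L 2107498635) (N 536 (L 3172458906) (N 200 (L 1243890675) (L 2183957406)))))))) (N 584 (N 259 (L 3172469805) (N 37 (L 6124395807) (N 164 (L 4136507298) 
  (N 261 (L 4135279086) (N 168 (N 196 (L 6143592807) (L 3192687405)) (N 280 (L 4165273908) (L 1273458906))))))) (N 37 (N 200 (L 1245807693) (N 536 (L 6124379508) 
  (N 578 (L 3142786905) (N 328 (L 2143679085) (L 7134268509))))) (N 73 (N 164 (L 1345760892) 
  (N 532 (L 7124350698) (N 546 (L 7124359608) (N 536 (L 6138925047) (N 578 (L 3142596807) (N 168 (L 6134295708) (L 2143576908))))))) (N 536 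
  (N 289 (L 2143597086) (N 196 (L 1253890476) (N 578 (L 7162340589) (N 168 (L 6124570938) (N 164 (L 3152684709) (L 6125384709)))))) 
  (N 328 (N 517 (L 6153284709) (L 5124376809)) (N 517 (L 5134278096) (N 321 (N 196 (N 578 (L 3142870695) (L 3152689074)) (L 3152486709)) (N 168 (N 273 (L 4126389075) 
  (N 265 (L 1243580796) (N 578 (L 2145769083) (N 196 (L 4125396807) (L 1246370985))))) (N 265 (L 2143580796) 
  (N 196 (N 546 (L 1345768092) (N 578 (L 3142680975) (L 2143607958))) (N 578 (N 164 (L 2153689074) (L 3152476809)) (N 545 (L 1346758092) (N 164 (N 532 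
  (N 546 (L 3142597086) (L 2145790863)) 
  (N 546 (L 5142379086) (L 2143968705))) (N 532 
  (N 546 (L 8143276509) (L 2173586409)) (L 5138264709)))))))))))))))))))) (N 276 (N 164 (N 578 (N 25 (L 2145769083) (L 3142695708)) (N 67 (L 5134276089) 
  (N 515 (L 6134295078) (N 200 (L 5163027498) (N 536 (L 5162374908) (N 290 (N 580 
  (N 25 (L 2153678094) (L 2163495807)) (L 4136295807)) (N 328 (L 4163028597) 
  (N 552 (L 4162385907) (N 19 (N 41 (L 1253678094) (N 580 (L 8134260579) (L 1204586739))) (N 73 (L 6134208759) (N 41 (L 1253708496) (N 25 (L 1243807596) 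
  (N 580 (L 7135260489) (L 1204576839)))))))))))))) (N 168 (N 578 
  (N 196 (L 2143587096) (L 3172460985)) 
  (N 67 (N 536 (L 5124389607) (N 548 (L 6124385907) (L 1243589076))) (N 515 (N 196 (L 4138269705) (N 328 (L 4126398075) (L 1253674809))) (N 580 (L 1263485709) (N 290 (N 536 (L 5162374809) 
  (N 196 (L 6153492708) (L 6124385079))) (L 6124507389)))))) (N 290 
  (N 137 (L 1340579682) (N 584 (N 145 (L 1253478096) (L 2143586907)) (N 193 (L 3152680794) (N 200 (N 515 (L 1356748092) (L 5124607389)) (N 529 (L 2163970485) 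
  (N 578 (L 2183769405) (N 536 (L 2163790485) (N 548 (L 3142589076) (N 196 (L 1240586793) (L 1283567904)))))))))) 
  (N 578 (N 328 (N 161 (L 1346759082) (L 3162574809)) (N 41 (L 3142507869) (N 161 (L 2105694837) (L 3152694807)))) (N 200 (N 545 (L 3142586709) (N 546 (L 3172450986) (N 536 
  (N 35 (L 2153687094) (L 6152374809)) 
  (N 35 (L 5163972408) (N 296 (L 2143786509) (L 1253486709)))))) (N 194 (N 41 (N 546 (L 1245867093) (L 2145867093)) (N 545 (L 2163579084) (L 3142586709))) (N 552 (N 67 (L 6142783509) 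
  (N 131 (L 2163579084) (N 328 (L 6142573809) (L 6135408297)))) (N 35 
  (N 137 (L 2145867093) (L 4136752089)) 
  (N 73 (N 530 (L 7124359608) (N 548 (L 7124359608) (L 3152479086))) (N 536 (N 196 (N 296 (L 1243596708) (L 8135240679)) (N 546 (L 8142376509) (L 6237185409))) (N 580 (N 25 (L 1253674809) (N 322 (L 5127934068) (L 8142375609))) (N 515 (L 2140698375) (N 545 (L 1246758093) 
  (N 546 (N 137 (L 2145867093) (L 6135294807)) (N 19 (L 2163574908) (N 37 (L 4126375908) (N 328 (L 7124380659) (N 137 (L 2143678095) (L 4201387659))))))))))))))))))) (N 290 (N 164 (N 25 (L 1346750892) 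
  (N 584 (N 19 (L 4125386907) (N 532 (L 4125386907) (L 4125609378))) (N 324 (N 536 (L 1250497386) (N 529 (L 1247568093) (N 194 (L 3152678094) 
  (N 73 (L 2143576809) (N 152 (L 8120364759) (L 2153794608)))))) (N 536 (N 194 (L 2150498376) (L 5102378496)) (N 577 (L 3142596807) (N 73 (L 1243576809) 
  (N 529 (L 3142587096) (L 1342586907)))))))) (N 196 
  (N 536 (L 3142697085) (N 25 (N 530 (L 1245867093) (L 2145867093)) (N 529 (N 152 (L 2153489076) (L 1263479085)) (L 3142586709)))) 
  (N 536 (N 328 (N 133 (L 4129367805) (L 6130458279)) (N 69 (L 6134572809) (N 133 (L 5163482097) (L 6125384907)))) (N 200 (N 517 (L 6134572809) (N 532 (L 3172450896) (N 578 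
  (N 21 (L 1245760983) (L 3160458729)) 
  (N 21 (L 2153496708) (N 324 (L 5142386709) (L 4125386709)))))) (N 152 (N 69 (N 532 (L 3162578094) (L 1243679085)) (N 517 (L 1263497085) (L 6125384709))) (N 580 (N 145 (L 1263479085) 
  (N 328 (L 3142576809) (N 25 (L 3142679085) (L 3142586907)))) (N 21 
  (N 137 (L 1245867093) (L 5134672809)) 
  (N 73 (N 530 (L 7124350698) (N 548 (L 7124359608) (L 3172549806))) (N 552 (N 194 (N 280 (L 2143675908) (L 8142350679)) (N 532 (L 8143276509) (L 6137284509))) (N 578 (N 265 (L 2153680794) (N 148 (L 3160479285) 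
  (N 324 (L 4125793608) (L 8174235609)))) (N 517 (L 1250698374) (N 529 (L 2145096783) 
  (N 532 (N 137 (L 1245867093) (L 6135284907)) (N 328 (N 131 (L 2143679085) (L 4137256809)) (N 137 (L 1253678094) (N 193 (L 2145790683) (L 1243670895))))))))))))))))) (N 280 (N 168 
  (N 67 (L 2153679084) (N 580 (N 19 (L 1243586907) (N 546 (L 1243586907) (L 1243695708))) (N 292 (N 578 (L 2163580974) (N 515 (L 2146758093) 
  (N 148 (L 1243580796) (N 69 (L 5124376809) (N 194 (L 8120346759) (L 5164793208)))))) (N 578 (N 148 (L 2163470985) (L 2146957083)) (N 517 (L 6124309587) 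
  (N 69 (L 4125386709) (N 515 (L 2143587096) (L 4165382907)))))))) 
  (N 164 (N 578 (L 2157469083) (N 67 (N 530 (L 3152678094) (L 2143689075)) (N 515 (N 194 (L 2163498075) (L 3162597084)) (L 6125408379)))) (N 578 (N 324 (N 161 (L 1246759083) (L 2163574809)) (N 37 (L 2143507869) (N 161 (L 3105694827) (L 2153694807)))) (N 196 (N 545 (L 2143586709) (N 546 (L 2173450986) 
  (N 532 (N 35 (L 3152687094) (L 6152374809)) (N 35 (L 5162973408) (N 292 (L 3142786509) (L 1243586709)))))) (N 194 (N 37 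
  (N 546 (L 1345867092) (L 2146759083)) 
  (N 545 (L 3162579084) (L 2143586709))) (N 548 
  (N 67 (L 6143782509) (N 131 (L 3162579084) (N 324 (L 6143572809) (L 6125408397)))) 
  (N 35 (N 133 (L 2146759083) (L 4126753089)) (N 69 (N 530 (L 7134259608) (N 552 (L 7124350698) (L 2153479086))) (N 532 (N 200 (N 292 (L 1253496708) (L 8125340679)) (N 546 (L 8143276509) (L 6237815049))) (N 584 (N 21 (L 1243785609) 
  (N 322 (L 5137924068) (L 8143275609))) (N 515 (L 3140698275) 
  (N 545 (L 1346758092) (N 546 (N 133 (L 2147509863) (L 6125394807)) (N 521 (L 6124308957) (N 324 (N 131 (L 1248567093) (L 4165273809)) (N 133 (L 3142678095) 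
  (N 193 (L 1345790682) (L 3152670894)))))))))))))))))) (N 546 
  (N 584 (N 296 (N 133 (L 1245769083) (N 148 (L 1243590786) (N 322 (L 2153680974) 
  (N 196 (L 4126378095) (N 21 (L 1245769083) (L 5246781309)))))) (N 261 (L 1253680794) (N 137 (L 2143578096) (N 148 
  (N 259 (L 2153689074) (L 5124370968)) 
  (N 21 (L 1245869073) (N 164 (N 322 (L 2153780694) (L 6153482709)) (N 322 (N 145 (L 2145768093) (L 1273849506)) (N 196 (N 273 (L 1345769082) (L 3142780965)) (N 145 (L 2153679084) 
  (N 168 (N 194 (L 2153670984) (L 2145709683)) (L 1273849506))))))))))) (N 21 (N 73 (L 7124359608) (N 168 (L 3142507968) (N 322 (L 3142687095) 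
  (N 196 (L 3142596708) (N 67 (N 292 (L 1345768092) (L 2153486709)) (N 200 (L 2153486709) (N 296 (L 7134260598) (L 8135267409)))))))) (N 196 (N 25 (N 322 (L 1345760892) (L 3152968704)) (N 265 
  (N 152 (L 2143589076) (L 1243678095)) 
  (N 168 (N 322 (L 5129734068) (L 4153286709)) (L 4120657938)))) (N 321 (N 200 (L 2143576908) 
  (N 152 (L 1243670985) (N 164 (L 3152486709) (N 532 (L 2145769083) (N 296 (L 6137254089) (L 1345769082)))))) (N 137 
  (N 261 (L 4125379086) (N 322 (L 2153670894) (N 292 (L 1346759082) (N 532 (L 1347568092) (N 580 (L 3152680794) (L 5162483097)))))) 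
  (N 152 (N 37 (L 3142675908) (N 322 (L 2153684709) (N 292 (L 2173849506) (N 580 
  (N 296 (L 1243576908) (L 2143576908)) 
  (N 296 (N 194 (L 1263807495) (L 2163790584)) (L 2143596807)))))) (N 164 (N 322 (L 5164207398) (N 580 (N 194 (L 3152670894) (L 3142678095)) (N 536 (L 1253904687) 
  (N 328 (L 4125396807) (N 73 (L 1263478095) (N 194 (L 1243576809) (L 8124360579))))))) (N 296 (N 73 (N 532 (L 1345768092) (L 6137824059)) (N 194 (L 6137824059) 
  (N 131 (L 3142596708) (L 6142375908)))) (N 322 (N 37 (L 3152708694) 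
  (N 532 (L 5137902486) (L 3245961087))) (N 273 (L 3152407869) 
  (N 200 (L 2143596708) (N 131 (L 3182769504) (N 265 (N 532 (L 1253680794) (L 4126378095)) (N 517 (L 4136278095) (N 324 (L 4137290865) 
  (N 532 (L 5136284097) (N 292 (L 5137294806) (L 1293547806)))))))))))))))))) 
  (N 322 (N 529 (L 5127394806) (N 580 (N 145 (L 3142685709) (N 161 (L 1246859073) 
  (N 168 (L 2163589074) (N 41 (L 2143586907) (N 289 (L 3142590786) (N 152 (L 1263489075) (N 164 (L 1246750893) 
  (N 536 (L 2163574908) (N 200 (L 1345768092) (L 1253476809)))))))))) (N 536 (N 161 (L 3172869405) 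
  (N 37 (L 2146758093) (L 2153684907))) (N 532 
  (N 168 (L 2149568073) (N 41 (L 3162847905) (N 164 (L 3142596807) (N 200 (L 5124396807) (N 137 (L 3152470896) 
  (N 292 (L 5120468379) (L 5136284907))))))) 
  (N 292 (N 515 (L 3172849605) (N 137 (L 4126379085) (N 168 (L 2143580976) (N 148 (L 1283579406) 
  (N 200 (L 1245790863) (L 6145732089)))))) (N 164 (N 521 (L 1245769083) (L 3172958604)) (N 168 (N 21 (L 1345768092) (L 2143685709)) (N 41 (L 6125384907) (N 133 (L 3142670895) 
  (N 545 (L 1243957806) (N 148 (L 3142576809) (N 273 (L 3152479086) (L 1273849506))))))))))))) (N 164 (N 529 (L 3142590876) (N 530 (N 265 (L 2145768093) 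
  (N 321 (L 2143689075) (L 3172859406))) (N 67 (L 3152678094) 
  (N 584 (L 2183940567) (N 265 (N 577 (L 2143580796) (L 3142580796)) (N 19 (N 328 (L 6102348597) (L 6134285709)) (N 259 (N 536 (L 3172469805) (L 3142580796)) (N 200 
  (N 580 (L 3142670895) (N 552 (L 2143570896) (L 4163285709))) 
  (N 580 (N 41 (L 2145769083) (L 3162584907)) (N 536 (L 6125479038) (N 521 (L 4125376908) (N 296 (N 152 (L 2143695708) 
  (N 194 (L 1346790852) (L 4162379085))) (N 324 (L 6143892507) (L 1207589436)))))))))))))) (N 532 (N 584 (N 259 (L 2145768093) 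
  (N 273 (N 162 (L 3162574908) (L 2145768093)) (N 161 (L 1245760983) (N 168 (L 2143907586) (N 194 (L 2153679084) (L 2143576908)))))) (N 324 
  (N 259 (L 3152408697) (N 515 (N 168 (L 1345768092) (L 4120396587)) (N 194 (N 41 (L 1345768092) (L 4135296708)) (L 3142098675)))) 
  (N 168 (N 67 (L 1345768092) (N 259 (L 1356748092) (L 6124507398))) (N 193 (L 3152680974) (N 41 (L 2143695807) (N 194 (N 265 (L 2145768093) (L 5136274908)) (N 259 (L 6234581709) 
  (N 289 (L 3162579084) (N 67 (L 4236591708) (N 200 (L 1246073985) (N 296 (L 1253684907) (L 2164058739)))))))))))) (N 200 (N 19 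
  (N 265 (L 2145768093) (N 292 (L 3162578094) (L 5124386709))) 
  (N 530 (N 261 (L 2145860793) (N 289 (L 3172648905) (L 2173869405))) (N 296 (N 324 (N 515 (L 2145768093) (L 6145792308)) (N 517 (L 1245769083) (N 578 (L 3172849605) (L 5146382907)))) (N 324 (N 545 (L 1245768093) (N 536 (L 2153849706) (L 2143685907))) (N 259 (L 2143680795) (N 37 (L 6135482907) 
  (N 578 (L 4138725069) (N 517 (L 3152678094) (L 5230781649))))))))) (N 580 
  (N 41 (L 4125376908) (N 19 (L 3107486529) (N 152 (N 289 (L 3152680794) (N 530 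
  (N 296 (L 1243695807) (L 1243580796)) (L 1432069587))) (N 131 (L 3142670985) (N 273 
  (N 168 (L 2143580976) (N 161 (L 1246759083) (N 552 (L 1263578094) (N 194 (L 2146750893) (L 4126395708))))) 
  (N 37 (N 296 (L 3152709684) (L 3142675809)) (N 73 (N 296 (L 4126390857) (L 1243586709)) (N 296 (L 4125308967) (N 536 (N 162 (L 3142576908) (L 6143029578)) (N 168 (L 7135206498) 
  (N 148 (N 35 (L 7134250698) (N 194 (L 7135240698) (L 7140235689))) (L 1260459837)))))))))))) 
  (N 69 (N 584 (N 137 (L 4125376809) (N 162 (L 3162807594) (N 296 (L 1253670894) 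
  (N 19 (L 2145768093) (N 152 (L 1243680795) (L 6120398457)))))) (N 296 (L 1253670894) (N 152 (L 1243690785) (N 530 (L 5124389607) 
  (N 552 (L 1243576908) (N 162 (N 529 (L 1243586907) (L 2143576809)) (N 19 (L 6125384709) (N 25 (L 2143589076) (N 41 (L 2143586907) (L 7134250698)))))))))) (N 552 (N 19 (L 6234581709) (N 194 (N 21 
  (N 328 (L 3152679084) (L 2163578094)) 
  (N 261 (L 1246758093) (L 4126375908))) (N 133 (L 4126375908) 
  (N 131 (L 6234571809) (N 265 (L 4125309867) (N 321 (L 2143670985) (N 324 (L 4126380957) (N 148 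
  (N 515 (L 1246759083) (L 1283967405)) 
  (N 530 (L 5134692708) (N 152 (L 3152496807) (L 5143279086))))))))))) (N 152 (N 328 (N 515 (L 1345768092) 
  (N 194 (L 8124603759) (N 37 (L 1245708693) (N 548 (N 19 (L 1245968073) (L 1243596807)) (L 6125493807))))) (N 289 (L 1243570986) 
  (N 515 (N 292 (L 1247658093) (N 321 (L 3172458906) (L 1253487096))) (N 194 (N 274 (L 6235194708) (L 5134296708)) (N 577 (L 2153678094) (N 292 (L 1273948506) (N 274 
  (N 161 (L 3152697084) (L 2153487096)) 
  (N 35 (L 3162475908) (N 261 (L 3142578096) (N 196 (L 3152869704) (L 5138274069))))))))))) (N 521 (N 296 (L 1243576908) 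
  (N 133 (L 1243589076) (N 145 (L 8124350679) (N 274 (L 1345869072) (L 1243690785))))) (N 328 
  (N 37 (L 1245768093) (N 161 (L 1253670984) (N 19 (N 194 (L 3152670894) (L 2143698075)) (N 194 (L 4160238597) (N 35 
  (N 148 (L 5142673908) (N 530 (L 2153678094) (L 5164273809))) 
  (N 530 (L 2153496807) (N 529 (L 1243690785) (N 148 (N 168 (L 8126350479) (L 2143576809)) (N 168 (N 292 (L 4125307869) (L 7125306489)) (L 2143695708)))))))))) 
  (N 161 (N 530 (L 2143590786) (N 194 (N 21 (L 3142678095) (N 25 (L 3152408967) (L 8125340679))) (L 3145207698))) (N 19 (N 292 (L 3142570896) (N 261 (L 2156748093) (L 6135284907))) (N 194 (N 273 (L 2143675809) (N 21 (L 1256748093) 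
  (N 292 (N 530 (L 3152679084) (L 4120659387)) (L 3142586709)))) (N 292 (N 137 (L 1243586709) 
  (N 530 (L 6143275809) (N 577 (L 1245768093) (N 148 (L 3162485709) (N 162 (L 4135278096) (N 536 
  (N 67 (L 1345769082) (L 4128356907)) 
  (N 578 (L 1273698504) (L 2143586907)))))))) (N 530 
  (N 261 (L 3142689075) (N 41 (L 1248657093) (L 4102398657))) 
  (N 41 (L 1243685907) (N 133 (L 6134572908) (N 259 (L 4120387596) (N 196 (L 5120648379) (N 584 
  (N 273 (L 1245768093) (L 2146093875)) 
  (N 168 (N 529 (L 2143590876) (L 1206574389)) (L 4126395708)))))))))))))))))))))))))))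

set_option maxRecDepth 100000 in
theorem root_ok : root (chk tree) = true := by decide +kernel

theorem flt_eq (p : ℕ → Bool) (l : List ℕ) (k : List ℕ → Bool) : flt p l k = k (l.filter p) := by
  induction l generalizing k with
  | nil => rfl
  | cons a l ih =>
    have h : flt p (a :: l) k = Bool.rec (flt p l k) (flt p l (fun r => k (a :: r))) (p a) := rfl
    rw [h, List.filter_cons]
    cases p a <;> simp [ih]

theorem anyb_eq (p : ℕ → Bool) (l : List ℕ) : anyb p l = l.any p := by
  induction l with
  | nil => rfl
  | cons a l ih =>
    have h : anyb p (a :: l) = Bool.rec (anyb p l) true (p a) := rfl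
    rw [h, List.any_cons]
    cases p a <;> simp [ih]

theorem cnd_eq (c x y : Bool) : cnd c x y = cond c x y := by cases c <;> rfl

theorem part_succ (n : ℕ) (A : List ℕ) (m : ℕ) (h : ∃ a ∈ A, a &&& m = a ∧
    a &&& (m ^^^ (m &&& (m - 1))) ≠ 0 ∧
    part n (A.filter (fun a => Nat.beq (Nat.land a m) a)) (m ^^^ a) = true) :
    part (n + 1) A m = true := by
  obtain ⟨a, ha, h1, h2, h3⟩ := h
  have h : part (n + 1) A m = flt (fun a => Nat.beq (Nat.land a m) a) A (fun sub =>
      anyb (fun a => Bool.rec (part n sub (Nat.xor m a)) false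
        (Nat.beq (Nat.land a (Nat.xor m (Nat.land m (Nat.sub m 1)))) 0)) sub) := rfl
  rw [h, flt_eq, anyb_eq, List.any_eq_true]
  refine ⟨a, ?_, ?_⟩
  · rw [List.mem_filter]
    exact ⟨ha, Nat.beq_eq.mpr h1⟩
  · have : Nat.beq (Nat.land a (Nat.xor m (Nat.land m (Nat.sub m 1)))) 0 = false := by
      rw [Bool.eq_false_iff]
      intro hh
      exact h2 (Nat.beq_eq.mp hh)
    rw [this]
    exact h3

theorem low_bit : ∀ m < 1024, m ≠ 0 → ∃ k < 10, m.testBit k = true ∧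
    (m ^^^ (m &&& (m - 1))) = 2 ^ k := by decide +kernel

def S {α : Type*} [DecidableEq α] (e : ℕ → α) (m : ℕ) : Finset α :=
  ((Finset.range 10).filter (fun k => m.testBit k = true)).image e

theorem small_bits {m : ℕ} (hm : m < 1024) {k : ℕ} (h : m.testBit k = true) : k < 10 := by
  by_contra hk
  have : m < 2 ^ k := lt_of_lt_of_le hm (by
    calc 1024 = 2 ^ 10 := by norm_num
      _ ≤ 2 ^ k := Nat.pow_le_pow_right (by norm_num) (by omega))
  rw [Nat.testBit_lt_two_pow this] at h
  exact absurd h (by simp)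

section
variable {α : Type*} [DecidableEq α] {e : ℕ → α}

theorem mem_S (he : Set.InjOn e (Set.Iio 10)) {m k : ℕ} (hk : k < 10) :
    e k ∈ S e m ↔ m.testBit k = true := by
  simp only [S, Finset.mem_image, Finset.mem_filter, Finset.mem_range]
  constructor
  · rintro ⟨j, ⟨hj, h⟩, hjk⟩
    rw [← he hj hk hjk]; exact h
  · intro h; exact ⟨k, ⟨hk, h⟩, rfl⟩

theorem exists_of_mem_S {m : ℕ} {x : α} (h : x ∈ S e m) : ∃ k < 10, e k = x := by
  simp only [S, Finset.mem_image, Finset.mem_filter, Finset.mem_range] at h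
  obtain ⟨k, ⟨hk, _⟩, h⟩ := h
  exact ⟨k, hk, h⟩

theorem S_sub (he : Set.InjOn e (Set.Iio 10)) {a m : ℕ} (ha : a < 1024)
    (h : S e a ⊆ S e m) : a &&& m = a := by
  apply Nat.eq_of_testBit_eq
  intro k
  rw [Nat.testBit_and]
  by_cases hk : a.testBit k = true
  · have h10 := small_bits ha hk
    have := (mem_S he h10).1 (h ((mem_S he h10).2 hk))
    simp [hk, this]
  · simp [hk]

theorem S_ext (he : Set.InjOn e (Set.Iio 10)) {s : Finset α} {m : ℕ}
    (hs : ∀ x ∈ s, ∃ k < 10, e k = x) (h : ∀ k < 10, e k ∈ s ↔ m.testBit k = true) :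
    S e m = s := by
  ext x
  constructor
  · intro hx
    obtain ⟨k, hk, rfl⟩ := exists_of_mem_S hx
    exact (h k hk).2 ((mem_S he hk).1 hx)
  · intro hx
    obtain ⟨k, hk, rfl⟩ := hs x hx
    exact (mem_S he hk).2 ((h k hk).1 hx)

theorem S_sdiff (he : Set.InjOn e (Set.Iio 10)) {a m : ℕ}
    (h : S e a ⊆ S e m) : S e (m ^^^ a) = S e m \ S e a := by
  apply S_ext he
  · intro x hx
    exact exists_of_mem_S (Finset.mem_sdiff.1 hx).1
  · intro k hk
    have := @h (e k)
    rw [mem_S he hk, mem_S he hk] at this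
    rw [Finset.mem_sdiff, mem_S he hk, mem_S he hk, Nat.testBit_xor]
    cases h1 : m.testBit k <;> cases h2 : a.testBit k <;> simp_all

theorem S_inter (he : Set.InjOn e (Set.Iio 10)) {a m : ℕ} :
    S e (m &&& a) = S e m ∩ S e a := by
  apply S_ext he
  · intro x hx
    exact exists_of_mem_S (Finset.mem_inter.1 hx).1
  · intro k hk
    rw [Finset.mem_inter, mem_S he hk, mem_S he hk, Nat.testBit_and]
    simp

theorem testBit_mk (s : List ℕ) (k : ℕ) : (mk s).testBit k = true ↔ k ∈ s := by
  induction s with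
  | nil => simp [mk]
  | cons a s ih =>
    have : mk (a :: s) = 2 ^ a ||| mk s := rfl
    rw [this, Nat.testBit_or, Nat.testBit_two_pow, List.mem_cons, Bool.or_eq_true, ih]
    simp [eq_comm]

theorem mk_lt (s : List ℕ) (hs : ∀ x ∈ s, x < 10) : mk s < 1024 := by
  induction s with
  | nil => simp [mk]
  | cons a s ih =>
    have : mk (a :: s) = 2 ^ a ||| mk s := rfl
    rw [this]
    apply Nat.or_lt_two_pow (n := 10)
    · exact Nat.pow_lt_pow_right (by norm_num) (hs a (by simp))
    · exact ih (fun x hx => hs x (by simp [hx]))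

theorem S_mk (he : Set.InjOn e (Set.Iio 10)) (s : List ℕ) (hs : ∀ x ∈ s, x < 10) :
    S e (mk s) = (s.map e).toFinset := by
  apply S_ext he
  · intro x hx
    simp only [List.mem_toFinset, List.mem_map] at hx
    obtain ⟨k, hk, h⟩ := hx
    exact ⟨k, hs k hk, h⟩
  · intro k hk
    rw [testBit_mk]
    simp only [List.mem_toFinset, List.mem_map]
    constructor
    · rintro ⟨j, hj, h⟩
      rw [← he (hs j hj) hk h]; exact hj
    · intro h; exact ⟨k, h, rfl⟩

theorem S_card (he : Set.InjOn e (Set.Iio 10)) (m : ℕ) :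
    (S e m).card = ((Finset.range 10).filter (fun k => m.testBit k = true)).card := by
  apply Finset.card_image_of_injOn
  intro x hx y hy h
  simp only [Finset.coe_filter, Finset.mem_range, Set.mem_ofPred_eq] at hx hy
  exact he hx.1 hy.1 h

theorem exists_S (he : Set.InjOn e (Set.Iio 10)) {b : Finset α}
    (hb : b ⊆ (Finset.range 10).image e) : ∃ a < 1024, S e a = b := by
  classical
  refine ⟨mk ((List.range 10).filter (fun k => decide (e k ∈ b))), mk_lt _ ?_, S_ext he ?_ ?_⟩
  · intro x hx
    simp at hx
    exact hx.1
  · intro x hx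
    have := hb hx
    simp only [Finset.mem_image, Finset.mem_range] at this
    exact this
  · intro k hk
    rw [testBit_mk]
    simp [hk]

theorem part_sound (he : Set.InjOn e (Set.Iio 10)) (B : Finset (Finset α))
    (hB : ∀ b ∈ B, b ⊆ (Finset.range 10).image e ∧ b.card = 3) :
    ∀ (n : ℕ) (P : Finset (Finset α)) (A : List ℕ) (m : ℕ), m < 1024 → P ⊆ B →
      (P : Set (Finset α)).Pairwise Disjoint → P.biUnion id = S e m → P.card = n →
      (∀ a < 1024, S e a ∈ B → S e a ⊆ S e m → a ∈ A) → part n A m = true := by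
  intro n
  induction n with
  | zero => intros; rfl
  | succ n ih =>
    intro P A m hm hPB hP hU hc hA
    have hne : P.Nonempty := by rw [← Finset.card_pos]; omega
    have hm0 : m ≠ 0 := by
      rintro rfl
      obtain ⟨b, hb⟩ := hne
      have h3 := (hB b (hPB hb)).2
      have : b ⊆ S e 0 := by
        rw [← hU]; exact Finset.subset_biUnion_of_mem id hb
      have h0 : S e 0 = ∅ := by simp [S]
      rw [h0, Finset.subset_empty] at this
      simp [this] at h3
    obtain ⟨k, hk, hkm, hlow⟩ := low_bit m hm hm0
    have hkS : e k ∈ P.biUnion id := by rw [hU]; exact (mem_S he hk).2 hkm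
    rw [Finset.mem_biUnion] at hkS
    obtain ⟨b, hb, hkb⟩ := hkS
    obtain ⟨a, ha, rfl⟩ := exists_S he (hB b (hPB hb)).1
    have hsub : S e a ⊆ S e m := by
      rw [← hU]; exact Finset.subset_biUnion_of_mem id hb
    have hka := (mem_S he hk).1 hkb
    apply part_succ
    refine ⟨a, hA a ha (hPB hb) hsub, S_sub he ha hsub, ?_, ?_⟩
    · rw [hlow]
      intro h0
      have := congrArg (fun z => Nat.testBit z k) h0
      simp [Nat.testBit_and, hka] at this
    · apply ih (P.erase (S e a))
      · exact Nat.xor_lt_two_pow (n := 10) hm ha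
      · exact (Finset.erase_subset _ _).trans hPB
      · exact hP.mono (by simp)
      · rw [S_sdiff he hsub, ← hU]
        ext x
        simp only [Finset.mem_biUnion, Finset.mem_erase, Finset.mem_sdiff, id]
        constructor
        · rintro ⟨c, ⟨hca, hcP⟩, hx⟩
          refine ⟨⟨c, hcP, hx⟩, fun hxa => ?_⟩
          exact Finset.disjoint_left.1 (hP hcP hb hca) hx hxa
        · rintro ⟨⟨c, hcP, hx⟩, hxa⟩
          exact ⟨c, ⟨fun h => hxa (h ▸ hx), hcP⟩, hx⟩
      · rw [Finset.card_erase_of_mem hb, hc]; rfl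
      · intro c hc1 hcB hcs
        have hcm : S e c ⊆ S e m := by
          rw [S_sdiff he hsub] at hcs
          exact hcs.trans Finset.sdiff_subset
        rw [List.mem_filter]
        exact ⟨hA c hc1 hcB hcm, Nat.beq_eq.mpr (S_sub he hc1 hcm)⟩

theorem dig_lt (n p : ℕ) : ∀ x ∈ dig n p, x < 10 := by
  induction n generalizing p with
  | zero => simp [dig]
  | succ n ih =>
    intro x hx
    rw [dig, List.mem_cons] at hx
    rcases hx with rfl | hx
    · exact Nat.mod_lt _ (by norm_num)
    · exact ih _ x hx

theorem dig_len (n p : ℕ) : (dig n p).length = n := by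
  induction n generalizing p with
  | zero => rfl
  | succ n ih => rw [dig, List.length_cons, ih]

theorem leaf_sound (he : Set.InjOn e (Set.Iio 10)) (V : Finset α) (B : Finset (Finset α))
    (hV : V = (Finset.range 10).image e) (hB : ∀ b ∈ B, b ⊆ V ∧ b.card = 3)
    (d A : List ℕ) (hd : ∀ x ∈ d, x < 10) (hl : d.length = 10)
    (hA : ∀ a < 1024, S e a ∈ B → a ∈ A) (h : leafOK d A = true) : Sequenceable V B := by
  subst hV
  rw [leafOK, Bool.and_eq_true] at h
  obtain ⟨h1, h2⟩ := h
  have h1 := Nat.beq_eq.mp h1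
  have hmem : ∀ k < 10, k ∈ d := by
    intro k hk
    rw [← testBit_mk, h1]
    interval_cases k <;> decide
  have hfin : d.toFinset = Finset.range 10 := by
    ext k
    rw [List.mem_toFinset, Finset.mem_range]
    exact ⟨hd k, hmem k⟩
  have hnd : d.Nodup := by
    rw [← Multiset.coe_nodup, ← Multiset.toFinset_card_eq_card_iff_nodup]
    change d.toFinset.card = d.length
    rw [hfin, hl]; simp
  refine ⟨d.map e, ?_, ?_, ?_⟩
  · exact List.Nodup.map_on (fun x hx y hy hxy => he (hd x hx) (hd y hy) hxy) hnd
  · rw [← hfin]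
    ext x; simp
  · intro i m hne hlt hpart
    obtain ⟨P, hPB, hP, hU⟩ := hpart
    set s := (d.drop i).take m with hs
    have hseg : ((d.map e).drop i).take m = s.map e := by simp [hs, List.map_take, List.map_drop]
    rw [hseg] at hne hlt hU
    have hsd : ∀ x ∈ s, x ∈ d := fun x hx => List.mem_of_mem_drop (List.mem_of_mem_take hx)
    have hs10 : ∀ x ∈ s, x < 10 := fun x hx => hd x (hsd x hx)
    have hsnd : s.Nodup := (hnd.sublist (List.drop_sublist _ _)).sublist (List.take_sublist _ _)
    have hc : s.length = 3 * P.card := by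
      have e1 : (s.map e).toFinset.card = s.length := by
        rw [List.toFinset_card_of_nodup, List.length_map]
        exact List.Nodup.map_on (fun x hx y hy hxy => he (hs10 x hx) (hs10 y hy) hxy) hsnd
      rw [← e1, ← hU, Finset.card_biUnion (t := id) (fun x hx y hy hxy => hP hx hy hxy),
        Finset.sum_congr (f := fun u => (id u).card) (g := fun _ => 3) rfl (fun x hx => (hB x (hPB hx)).2)]
      simp [mul_comm]
    have hlen : s.length = min m (10 - i) := by simp [hs, hl]
    have hpos : 0 < s.length := by
      rw [List.length_pos_iff]
      intro h0; apply hne; rw [h0]; rfl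
    simp only [List.length_map, hl] at hlt
    have hseq : s = (d.drop i).take (3 * P.card) := by
      rw [← hc, hs]
      simp [List.take_eq_take_iff]
    have hp := part_sound he B hB P.card P A (mk s) (mk_lt s hs10) hPB hP
      (by rw [S_mk he s hs10]; exact hU) rfl (fun a ha hb _ => hA a ha hb)
    rw [List.all_eq_true] at h2
    have h2 := h2 P.card (by
      have : P.card = 1 ∨ P.card = 2 ∨ P.card = 3 := by omega
      simpa using this)
    rw [List.all_eq_true] at h2
    have h2 := h2 i (by rw [List.mem_range]; omega)
    rw [← hseq, hp] at h2
    exact absurd h2 (by simp)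

theorem compat_dec : ∀ m < 1024, ((Finset.range 10).filter (fun k => m.testBit k = true)).card ≤ 1 →
    (m &&& (m - 1)) = 0 := by decide +kernel

theorem pcb_dec : ∀ m < 1024, ((Finset.range 10).filter (fun k => m.testBit k = true)).card = 3 →
    pcb m = 3 := by decide +kernel

theorem compat_sound (he : Set.InjOn e (Set.Iio 10)) (B : Finset (Finset α))
    (hB2 : ∀ b₁ ∈ B, ∀ b₂ ∈ B, b₁ ≠ b₂ → (b₁ ∩ b₂).card ≤ 1) {t a : ℕ} (ha : a < 1024)
    (ht : t < 1024) (hat : S e a ∈ B) (htb : S e t ∈ B) : compat t a = true := by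
  rw [compat, cnd_eq]
  by_cases hat' : a = t
  · subst hat'; simp
  · have hne : S e a ≠ S e t := by
      intro h
      apply hat'
      rw [← S_sub he ha h.subset, Nat.and_comm, S_sub he ht h.symm.subset]
    have h1 := hB2 _ hat _ htb hne
    rw [← S_inter he, S_card he] at h1
    have h2 := compat_dec (a &&& t) (lt_of_le_of_lt Nat.and_le_left ha) h1
    have h3 : Nat.beq (Nat.land (Nat.land a t) (Nat.sub (Nat.land a t) 1)) 0 = true :=
      Nat.beq_eq.mpr h2
    rw [h3]; simp

theorem chk_sound (he : Set.InjOn e (Set.Iio 10)) (V : Finset α) (B : Finset (Finset α))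
    (hV : V = (Finset.range 10).image e) (hT : IsPSTS V B)
    (T : Tr) : ∀ A : List ℕ, (∀ a ∈ A, a < 1024) → (∀ a < 1024, S e a ∈ B → a ∈ A) →
      chk T A = true → Sequenceable V B := by
  induction T with
  | L p =>
    intro A _ hA h
    exact leaf_sound he V B hV hT.1 (dig 10 p) A (dig_lt 10 p) (dig_len 10 p) hA h
  | N t l r ihl ihr =>
    intro A hlt hA h
    have h' : cnd (flt (compat t) A (chk l))
      (flt (fun a => cnd (Nat.beq a t) false true) A (chk r)) false = true := h
    rw [cnd_eq, flt_eq, flt_eq] at h'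
    have h1 : chk l (A.filter (compat t)) = true := by
      revert h'; cases chk l (A.filter (compat t)) <;> simp
    rw [h1] at h'
    have h2 : chk r (A.filter (fun a => cnd (Nat.beq a t) false true)) = true := h'
    by_cases htB : t < 1024 ∧ S e t ∈ B
    · apply ihl _ _ _ h1
      · intro a ha; exact hlt a (List.mem_filter.1 ha).1
      · intro a ha haB
        rw [List.mem_filter]
        exact ⟨hA a ha haB, compat_sound he B hT.2 ha htB.1 haB htB.2⟩
    · apply ihr _ _ _ h2
      · intro a ha; exact hlt a (List.mem_filter.1 ha).1
      · intro a ha haB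
        rw [List.mem_filter]
        refine ⟨hA a ha haB, ?_⟩
        have : a ≠ t := by rintro rfl; exact htB ⟨ha, haB⟩
        have hb : Nat.beq a t = false := by
          rw [Bool.eq_false_iff]
          intro hh
          exact this (Nat.beq_eq.mp hh)
        rw [hb]; rfl

theorem root_sound (he : Set.InjOn e (Set.Iio 10)) (V : Finset α) (B : Finset (Finset α))
    (hV : V = (Finset.range 10).image e) (hT : IsPSTS V B)
    (h1 : S e 14 ∈ B) (h2 : S e 112 ∈ B) (h3 : S e 896 ∈ B) : Sequenceable V B := by
  have h := root_ok
  rw [root, flt_eq] at h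
  apply chk_sound he V B hV hT _ _ _ _ h
  · intro a ha
    exact List.mem_range.1 (List.mem_filter.1 ha).1
  · intro a ha haB
    rw [List.mem_filter]
    refine ⟨List.mem_range.2 ha, ?_⟩
    have hc := (hT.1 _ haB).2
    rw [S_card he] at hc
    rw [pcb_dec a ha hc, compat_sound he B hT.2 ha (by norm_num) haB h1,
      compat_sound he B hT.2 ha (by norm_num) haB h2,
      compat_sound he B hT.2 ha (by norm_num) haB h3]
    rfl

theorem main (V : Finset α) (B : Finset (Finset α)) (hT : IsPSTS V B)
    (h10 : V.card = 10) (h3 : HasDisjointBlocks B 3) : Sequenceable V B := by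
  obtain ⟨P, hPB, hPc, hPd⟩ := h3
  obtain ⟨x, y, z, hxy, hxz, hyz, rfl⟩ := Finset.card_eq_three.1 hPc
  have dxy : Disjoint x y := hPd (by simp) (by simp) hxy
  have dxz : Disjoint x z := hPd (by simp) (by simp) hxz
  have dyz : Disjoint y z := hPd (by simp) (by simp) hyz
  have hxB : x ∈ B := hPB (by simp)
  have hyB : y ∈ B := hPB (by simp)
  have hzB : z ∈ B := hPB (by simp)
  have hx := hT.1 x hxB
  have hy := hT.1 y hyB
  have hz := hT.1 z hzB
  obtain ⟨a1, a2, a3, ha12, ha13, ha23, rfl⟩ := Finset.card_eq_three.1 hx.2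
  obtain ⟨b1, b2, b3, hb12, hb13, hb23, rfl⟩ := Finset.card_eq_three.1 hy.2
  obtain ⟨c1, c2, c3, hc12, hc13, hc23, rfl⟩ := Finset.card_eq_three.1 hz.2
  obtain ⟨w, hwV, hw⟩ : ∃ w ∈ V, w ∉ ({a1, a2, a3} ∪ {b1, b2, b3} ∪ {c1, c2, c3} : Finset α) := by
    apply Finset.exists_mem_notMem_of_card_lt_card
    have e1 := Finset.card_union_le ({a1, a2, a3} ∪ {b1, b2, b3} : Finset α) {c1, c2, c3}
    have e2 := Finset.card_union_le ({a1, a2, a3} : Finset α) {b1, b2, b3}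
    rw [hx.2, hy.2] at e2
    rw [hz.2] at e1
    omega
  have hnd : [w, a1, a2, a3, b1, b2, b3, c1, c2, c3].Nodup := by
    simp only [Finset.disjoint_insert_left, Finset.disjoint_singleton_left, Finset.mem_insert,
      Finset.mem_singleton, Finset.mem_union, not_or] at dxy dxz dyz hw
    simp only [List.nodup_cons, List.mem_cons, List.not_mem_nil, not_or]
    grind
  set l := [w, a1, a2, a3, b1, b2, b3, c1, c2, c3] with hl
  have hll : l.length = 10 := rfl
  have he : Set.InjOn (fun k => l.getD k w) (Set.Iio 10) := by
    intro i hi j hj hij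
    simp only [Set.mem_Iio] at hi hj
    simp only [List.getD_eq_getElem _ _ (hll.symm ▸ hi), List.getD_eq_getElem _ _ (hll.symm ▸ hj)] at hij
    exact (hnd.getElem_inj_iff).1 hij
  have hV : V = (Finset.range 10).image (fun k => l.getD k w) := by
    symm
    apply Finset.eq_of_subset_of_card_le
    · intro v hv
      simp only [Finset.mem_image, Finset.mem_range] at hv
      obtain ⟨k, hk, rfl⟩ := hv
      have hx := hx.1
      have hy := hy.1
      have hz := hz.1
      simp only [Finset.insert_subset_iff, Finset.singleton_subset_iff] at hx hy hz
      interval_cases k <;> simp [hl, hwV, hx, hy, hz]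
    · rw [h10, Finset.card_image_of_injOn]
      · simp
      · intro i hi j hj hij
        exact he (by simpa using hi) (by simpa using hj) hij
  have f1 : (Finset.range 10).filter (fun k => Nat.testBit 14 k = true) = {1, 2, 3} := by
    decide +kernel
  have f2 : (Finset.range 10).filter (fun k => Nat.testBit 112 k = true) = {4, 5, 6} := by
    decide +kernel
  have f3 : (Finset.range 10).filter (fun k => Nat.testBit 896 k = true) = {7, 8, 9} := by
    decide +kernel
  apply root_sound he V B hV hT
  · rw [S, f1]; simpa [hl] using hxB
  · rw [S, f2]; simpa [hl] using hyB
  · rw [S, f3]; simpa [hl] using hzB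

end

end SeqTen

/-- Every partial Steiner triple system of order 10 having three pairwise
disjoint blocks is sequenceable. -/
theorem sequenceable_order_ten {α : Type*} [DecidableEq α]
    (V : Finset α) (B : Finset (Finset α)) (hT : IsPSTS V B)
    (h10 : V.card = 10) (h3 : HasDisjointBlocks B 3) :
    Sequenceable V B := by
  exact SeqTen.main V B hT h10 h3
end

section
/- Every partial Steiner triple system of order 11 that has three pairwise disjoint blocks is sequenceable. -/
namespace Eleven

inductive Tr where
  | leaf (l : List ℕ) : Tr
  | node (t : ℕ) (p q : Tr) : Tr

def filtK (p : ℕ → Bool) (k : List ℕ → Bool) : List ℕ → List ℕ → Bool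
  | [], acc => k acc
  | m :: l, acc => cond (p m) (filtK p k l (m :: acc)) (filtK p k l acc)

def keep (t m : ℕ) : Bool := Nat.beq m t || Nat.beq (Nat.land (Nat.land m t) (Nat.pred (Nat.land m t))) 0

def force (f : ℕ → Bool) (n : ℕ) : Bool := Nat.rec (f 0) (fun k _ => f (Nat.succ k)) n

def anyK (f : ℕ → Bool) : List ℕ → Bool
  | [] => false
  | m :: l => cond (f m) true (anyK f l)

def hp : ℕ → List ℕ → ℕ → Bool
  | 0, _, S => Nat.beq S 0
  | k + 1, al, S => filtK (fun m => Nat.beq (Nat.land m S) m)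
      (fun al' => anyK (fun m => force (hp k al') (Nat.xor S m)) al') al []

def mask : List ℕ → ℕ
  | [] => 0
  | i :: l => (1 <<< i) ||| mask l

def segs (al l : List ℕ) (k n : ℕ) : Bool :=
  (List.range n).all fun i => !(force (hp k al) (mask ((l.drop i).take (3 * k))))

def good (l al : List ℕ) : Bool :=
  Nat.beq l.length 11 && (Nat.beq (mask l) 2047 && (segs al l 1 9 && (segs al l 2 6 && segs al l 3 3)))

def check : Tr → List ℕ → Bool
  | .leaf l, al => good l al
  | .node t p q, al => Nat.blt t 2048 &&
      (filtK (keep t) (check p) al [] && filtK (fun m => !(Nat.beq m t)) (check q) al [])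

def allM : List ℕ := [7, 11, 13, 14, 19, 21, 22, 25, 26, 28, 35, 37, 38, 41, 42, 44, 49, 50, 52, 56, 67, 69, 70,
  73, 74, 76, 81, 82, 84, 88, 97, 98, 100, 104, 112, 131, 133, 134, 137, 138, 140, 145, 146,
  148, 152, 161, 162, 164, 168, 176, 193, 194, 196, 200, 208, 224, 259, 261, 262, 265, 266,
  268, 273, 274, 276, 280, 289, 290, 292, 296, 304, 321, 322, 324, 328, 336, 352, 385, 386,
  388, 392, 400, 416, 448, 515, 517, 518, 521, 522, 524, 529, 530, 532, 536, 545, 546, 548,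
  552, 560, 577, 578, 580, 584, 592, 608, 641, 642, 644, 648, 656, 672, 704, 769, 770, 772,
  776, 784, 800, 832, 896, 1027, 1029, 1030, 1033, 1034, 1036, 1041, 1042, 1044, 1048, 1057,
  1058, 1060, 1064, 1072, 1089, 1090, 1092, 1096, 1104, 1120, 1153, 1154, 1156, 1160, 1168,
  1184, 1216, 1281, 1282, 1284, 1288, 1296, 1312, 1344, 1408, 1537, 1538, 1540, 1544, 1552,
  1568, 1600, 1664, 1792]

def dj : List ℕ := [146, 274, 162, 290, 148, 276, 164, 292]

def trs : List ℕ := [73, 137, 265, 81, 145, 273, 97, 161, 289, 74, 138, 266, 82, 146, 274, 98, 162,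
  290, 76, 140, 268, 84, 148, 276, 100, 164, 292]

def base : List ℕ := ((allM.filter (keep 7)).filter (keep 56)).filter (keep 448)

def c1 : Tr :=
 .node 548
 (.node 98
 (.node 140
 (.node 84
 (.leaf [10,6,0,4,3,7,9,1,5,8,2])
 (.leaf [10,7,4,0,3,1,2,6,9,8,5]))
 (.node 648
 (.leaf [10,5,1,4,3,0,7,2,9,8,6])
 (.node 161
 (.leaf [0,1,6,9,2,8,5,3,7,4,10])
 (.leaf [1,4,2,9,0,5,7,3,8,6,10]))))
 (.node 578
 (.leaf [10,2,9,0,5,1,4,6,3,8,7])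
 (.node 1092
 (.leaf [5,9,3,2,4,0,6,1,8,7,10])
 (.node 289
 (.leaf [10,0,6,1,8,7,5,4,2,9,3])
 (.leaf [10,7,8,9,2,6,0,5,1,3,4])))))
 (.node 1060
 (.node 140
 (.node 98
 (.node 161
 (.node 84
 (.leaf [5,9,3,4,6,1,0,10,7,2,8])
 (.leaf [10,3,5,9,6,0,4,2,7,8,1]))
 (.node 1153
 (.leaf [2,9,0,3,10,7,5,1,4,6,8])
 (.leaf [2,8,0,6,10,7,3,1,4,5,9])))
 (.node 290
 (.leaf [4,10,5,6,0,2,8,1,3,7,9])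
 (.node 161
 (.leaf [0,3,10,2,1,5,6,8,4,7,9])
 (.leaf [3,4,7,10,5,1,8,6,2,0,9]))))
 (.node 268
 (.node 290
 (.leaf [9,6,0,7,1,3,8,5,4,10,2])
 (.leaf [9,0,2,8,1,3,4,6,7,10,5]))
 (.node 580
 (.leaf [7,8,1,6,4,2,0,3,10,5,9])
 (.node 1153
 (.leaf [1,4,5,10,3,7,2,8,0,6,9])
 (.leaf [4,1,8,0,7,6,10,2,3,5,9])))))
 (.node 98
 (.node 140
 (.node 522
 (.node 276
 (.leaf [9,5,2,4,3,8,7,1,6,10,0])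
 (.leaf [0,2,4,5,1,10,7,3,8,9,6]))
 (.node 266
 (.node 161
 (.leaf [1,10,2,5,0,4,6,3,8,7,9])
 (.node 289
 (.leaf [2,10,5,3,0,1,6,8,9,7,4])
 (.node 641
 (.leaf [10,1,2,3,8,0,5,4,7,9,6])
 (.leaf [10,3,4,2,0,8,5,1,7,9,6]))))
 (.node 292
 (.leaf [9,7,4,8,1,5,0,2,3,10,6])
 (.node 1034
 (.node 276
 (.leaf [5,9,3,2,4,0,6,1,8,7,10])
 (.leaf [0,2,9,1,5,4,7,3,8,10,6]))
 (.leaf [10,7,4,8,3,5,1,2,9,0,6])))))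
 (.node 84
 (.node 161
 (.leaf [10,0,6,8,3,7,1,5,2,9,4])
 (.node 266
 (.leaf [8,10,6,2,7,0,5,1,3,4,9])
 (.leaf [8,10,7,4,6,3,1,5,2,0,9])))
 (.node 276
 (.leaf [9,8,7,0,3,4,2,1,6,10,5])
 (.node 266
 (.node 273
 (.leaf [8,10,3,6,7,4,0,2,5,1,9])
 (.leaf [9,7,4,2,0,6,5,3,1,10,8]))
 (.leaf [8,10,7,4,6,3,1,5,2,0,9])))))
 (.node 84
 (.node 161
 (.node 1312
 (.leaf [7,10,8,2,1,5,6,4,0,3,9])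
 (.leaf [7,10,5,8,6,4,1,3,0,2,9]))
 (.node 290
 (.leaf [7,10,6,0,8,3,1,4,5,2,9])
 (.node 273
 (.node 545
 (.leaf [10,2,1,6,0,7,5,9,4,3,8])
 (.leaf [10,7,1,5,3,6,2,0,4,9,8]))
 (.leaf [3,9,4,1,0,5,6,2,7,8,10]))))
 (.node 268
 (.leaf [9,8,6,0,7,2,3,1,4,10,5])
 (.node 100
 (.node 641
 (.node 592
 (.node 1057
 (.leaf [3,9,5,2,1,4,0,6,7,10,8])
 (.leaf [8,1,7,2,0,4,9,5,6,3,10]))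
 (.leaf [3,10,5,2,4,1,0,6,7,9,8]))
 (.node 290
 (.node 161
 (.leaf [8,10,7,5,6,3,1,4,0,2,9])
 (.leaf [2,9,1,7,3,5,0,4,6,8,10]))
 (.node 289
 (.leaf [10,3,4,6,5,7,1,8,0,9,2])
 (.leaf [10,4,3,0,5,1,7,2,6,9,8]))))
 (.node 1104
 (.node 1058
 (.leaf [9,3,4,6,0,5,2,1,7,10,8])
 (.leaf [8,7,1,10,6,5,2,4,0,3,9]))
 (.leaf [8,10,7,4,6,3,1,5,2,0,9])))))))

def c2 : Tr :=
 .node 161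
 (.node 100
 (.node 140
 (.leaf [4,8,3,5,0,6,7,10,2,1,9])
 (.node 273
 (.node 82
 (.node 266
 (.leaf [2,9,0,1,6,7,4,8,3,10,5])
 (.leaf [6,9,3,0,4,1,2,8,7,5,10]))
 (.leaf [10,5,2,3,4,1,6,7,0,9,8]))
 (.node 268
 (.leaf [3,10,6,7,0,8,1,4,2,5,9])
 (.leaf [9,1,0,8,7,2,4,6,3,10,5]))))
 (.node 98
 (.node 84
 (.node 138
 (.leaf [8,10,6,3,7,5,1,0,9,2,4])
 (.node 273
 (.node 1042
 (.leaf [8,3,7,6,10,0,5,1,2,4,9])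
 (.leaf [9,6,2,8,7,1,3,4,0,10,5]))
 (.leaf [5,10,4,6,3,7,1,8,0,2,9])))
 (.node 268
 (.node 273
 (.leaf [9,8,4,6,1,3,2,0,5,10,7])
 (.leaf [5,9,0,7,2,1,8,4,6,3,10]))
 (.node 273
 (.leaf [0,9,3,6,4,5,1,2,7,8,10])
 (.leaf [10,3,4,8,6,2,1,5,0,9,7]))))
 (.node 82
 (.node 273
 (.node 266
 (.leaf [2,9,0,1,6,7,4,8,3,10,5])
 (.leaf [4,10,3,6,5,1,2,8,0,7,9]))
 (.leaf [1,9,6,0,2,4,8,3,5,7,10]))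
 (.node 1282
 (.leaf [7,10,8,5,4,6,1,3,2,0,9])
 (.leaf [9,3,0,2,6,1,8,4,5,10,7])))))
 (.node 138
 (.node 145
 (.node 289
 (.node 268
 (.node 82
 (.leaf [2,9,0,1,6,7,4,8,3,10,5])
 (.node 1282
 (.leaf [9,7,6,4,8,3,0,10,1,2,5])
 (.leaf [7,10,0,8,4,6,1,2,5,3,9])))
 (.node 100
 (.leaf [5,10,6,3,8,1,7,2,0,4,9])
 (.leaf [10,1,7,4,2,5,3,8,6,9,0])))
 (.node 268
 (.node 1282
 (.leaf [9,6,3,4,1,8,5,7,0,10,2])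
 (.leaf [9,3,4,6,5,8,0,7,1,10,2]))
 (.leaf [6,10,3,5,0,4,2,8,1,7,9])))
 (.node 1041
 (.leaf [9,6,3,7,5,2,4,8,0,10,1])
 (.node 1057
 (.leaf [9,6,3,2,4,7,5,8,0,10,1])
 (.leaf [1,10,3,0,2,5,7,4,6,8,9]))))
 (.node 98
 (.node 266
 (.node 140
 (.node 145
 (.leaf [9,2,0,4,1,7,3,5,6,10,8])
 (.node 289
 (.leaf [4,2,3,5,9,1,0,6,8,10,7])
 (.leaf [1,9,3,2,0,5,8,4,7,6,10])))
 (.node 289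
 (.leaf [4,2,3,5,9,1,0,6,8,10,7])
 (.leaf [4,10,5,6,7,3,2,8,0,1,9])))
 (.node 289
 (.node 1042
 (.leaf [5,2,4,7,8,3,6,10,1,0,9])
 (.leaf [5,10,0,3,4,1,8,2,7,6,9]))
 (.leaf [6,10,3,0,8,7,1,2,4,5,9])))
 (.node 140
 (.node 145
 (.node 289
 (.node 266
 (.node 84
 (.leaf [5,1,7,6,10,2,0,4,3,8,9])
 (.leaf [9,8,7,5,6,4,2,3,1,10,0]))
 (.leaf [9,0,2,6,1,8,4,7,3,10,5]))
 (.node 1057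
 (.leaf [4,10,5,1,8,6,3,7,0,2,9])
 (.leaf [9,7,6,1,8,0,5,2,3,10,4])))
 (.node 273
 (.node 642
 (.leaf [2,9,0,3,1,7,4,5,8,6,10])
 (.leaf [2,9,7,8,1,4,0,5,6,3,10]))
 (.node 289
 (.node 266
 (.leaf [2,10,3,5,7,4,6,0,1,8,9])
 (.leaf [9,0,2,6,1,8,4,7,3,10,5]))
 (.leaf [3,10,7,2,4,5,8,1,0,6,9]))))
 (.node 100
 (.node 266
 (.node 273
 (.leaf [10,2,5,1,4,3,8,0,6,9,7])
 (.leaf [1,9,8,6,3,7,0,2,4,5,10]))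
 (.node 145
 (.node 82
 (.node 546
 (.leaf [5,9,3,1,7,2,8,4,6,0,10])
 (.leaf [5,9,4,0,3,1,8,7,2,6,10]))
 (.leaf [2,10,5,6,4,3,0,1,8,7,9]))
 (.leaf [4,9,3,0,5,1,7,8,2,6,10])))
 (.leaf [4,10,3,0,5,1,7,2,6,8,9])))))

def c3 : Tr :=
 .node 1104
 (.leaf [9,3,4,1,7,2,0,5,6,10,8])
 (.leaf [5,10,4,6,3,7,1,8,0,2,9])


theorem check1 : check c1 ((base.filter (keep 73)).filter (keep 146)) = true := by decide +kernel
theorem check2 : check c2 ((base.filter (keep 73)).filter (fun m => !(dj.contains m))) = true := by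
  decide +kernel
theorem check3 : check c3 (base.filter (fun m => !(trs.contains m))) = true := by decide +kernel


theorem filtK_eq (p : ℕ → Bool) (k : List ℕ → Bool) (l acc : List ℕ) :
    filtK p k l acc = k ((l.filter p).reverse ++ acc) := by
  induction l generalizing acc with
  | nil => rfl
  | cons m l ih =>
    by_cases h : p m = true
    · simp [filtK, h, ih]
    · simp [filtK, h, ih]

theorem anyK_eq (f : ℕ → Bool) (l : List ℕ) : anyK f l = l.any f := by
  induction l with
  | nil => rfl
  | cons m l ih => cases h : f m <;> simp [anyK, h, ih]

theorem force_eq (f : ℕ → Bool) (n : ℕ) : force f n = f n := by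
  cases n <;> rfl

theorem testBit_mask (l : List ℕ) (n : ℕ) : (mask l).testBit n = true ↔ n ∈ l := by
  induction l with
  | nil => simp [mask]
  | cons i l ih =>
    have h1 : mask (i :: l) = (1 <<< i) ||| mask l := rfl
    rw [h1, Nat.testBit_or, Bool.or_eq_true, ih, Nat.one_shiftLeft, Nat.testBit_two_pow,
      List.mem_cons, decide_eq_true_iff]
    constructor
    · rintro (h | h)
      · exact Or.inl h.symm
      · exact Or.inr h
    · rintro (h | h)
      · exact Or.inl h.symm
      · exact Or.inr h

section
variable {α : Type*} [DecidableEq α]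

def bits (S : ℕ) : Finset ℕ := (Finset.range 11).filter (fun i => S.testBit i = true)

def D (e : ℕ → α) (S : ℕ) : Finset α := (bits S).image e

structure Lab (V : Finset α) (B : Finset (Finset α)) (e : ℕ → α) : Prop where
  inj : ∀ i < 11, ∀ j < 11, e i = e j → i = j
  im : (Finset.range 11).image e = V
  b0 : D e 7 ∈ B
  b1 : D e 56 ∈ B
  b2 : D e 448 ∈ B

def Cov (B : Finset (Finset α)) (e : ℕ → α) (al : List ℕ) : Prop :=
  ∀ b ∈ B, ∃ m ∈ al, m < 2048 ∧ D e m = b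

theorem mem_bits {S i : ℕ} : i ∈ bits S ↔ i < 11 ∧ S.testBit i = true := by
  simp [bits]

theorem mem_D {V : Finset α} {B : Finset (Finset α)} {e : ℕ → α} (h : Lab V B e) {S i : ℕ}
    (hi : i < 11) : e i ∈ D e S ↔ S.testBit i = true := by
  simp only [D, Finset.mem_image, mem_bits]
  constructor
  · rintro ⟨j, ⟨hj, hb⟩, he⟩
    rwa [← h.inj j hj i hi he]
  · intro hb
    exact ⟨i, ⟨hi, hb⟩, rfl⟩

theorem tb_lt {m i : ℕ} (hm : m < 2048) (h : m.testBit i = true) : i < 11 := by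
  by_contra hc
  have : m < 2 ^ i := lt_of_lt_of_le hm
    (le_trans (by norm_num) (Nat.pow_le_pow_right (by norm_num) (not_lt.mp hc) : 2 ^ 11 ≤ 2 ^ i))
  rw [Nat.testBit_lt_two_pow this] at h
  exact absurd h (by simp)

theorem D_inj {V : Finset α} {B : Finset (Finset α)} {e : ℕ → α} (h : Lab V B e) {m t : ℕ}
    (hm : m < 2048) (ht : t < 2048) (he : D e m = D e t) : m = t := by
  apply Nat.eq_of_testBit_eq
  intro i
  rw [Bool.eq_iff_iff]
  constructor
  · intro hb
    have hi := tb_lt hm hb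
    rw [← mem_D h hi, ← he, mem_D h hi]; exact hb
  · intro hb
    have hi := tb_lt ht hb
    rw [← mem_D h hi, he, mem_D h hi]; exact hb

theorem two_bits : ∀ x < 2048, Nat.beq (Nat.land x (Nat.pred x)) 0 = false →
    ∃ i < 11, ∃ j < 11, i ≠ j ∧ x.testBit i = true ∧ x.testBit j = true := by
  decide +kernel

theorem cov_sub {B : Finset (Finset α)} {e : ℕ → α} {al al' : List ℕ} (h : Cov B e al)
    (hs : ∀ m ∈ al, m < 2048 → D e m ∈ B → m ∈ al') : Cov B e al' := by
  intro b hb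
  obtain ⟨m, hm, hl, rfl⟩ := h b hb
  exact ⟨m, hs m hm hl hb, hl, rfl⟩

theorem keep_of {V : Finset α} {B : Finset (Finset α)} {e : ℕ → α} (hT : IsPSTS V B)
    (h : Lab V B e) {m t : ℕ} (hm : m < 2048) (ht : t < 2048) (hmB : D e m ∈ B)
    (htB : D e t ∈ B) : keep t m = true := by
  by_contra hk
  simp only [keep, Bool.or_eq_true, not_or, Bool.not_eq_true] at hk
  obtain ⟨h1, h2⟩ := hk
  have hne : m ≠ t := Nat.ne_of_beq_eq_false h1
  obtain ⟨i, hi, j, hj, hij, bi, bj⟩ := two_bits (Nat.land m t)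
    (lt_of_le_of_lt (Nat.and_le_left : m &&& t ≤ m) hm) h2
  change (m &&& t).testBit i = true at bi
  change (m &&& t).testBit j = true at bj
  simp only [Nat.testBit_and, Bool.and_eq_true] at bi bj
  have hc := hT.2 _ hmB _ htB (fun he => hne (D_inj h hm ht he))
  have hlt : 1 < (D e m ∩ D e t).card := by
    rw [Finset.one_lt_card]
    refine ⟨e i, ?_, e j, ?_, fun he => hij (h.inj i hi j hj he)⟩
    · rw [Finset.mem_inter, mem_D h hi, mem_D h hi]; exact bi
    · rw [Finset.mem_inter, mem_D h hj, mem_D h hj]; exact bj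
  omega

theorem cov_keep {V : Finset α} {B : Finset (Finset α)} {e : ℕ → α} (hT : IsPSTS V B)
    (h : Lab V B e) {t : ℕ} (ht : t < 2048) (htB : D e t ∈ B) {al : List ℕ} (hc : Cov B e al) :
    Cov B e (al.filter (keep t)) :=
  cov_sub hc fun _ hm hl hB => List.mem_filter.mpr ⟨hm, keep_of hT h hl ht hB htB⟩

theorem cov_rm {B : Finset (Finset α)} {e : ℕ → α} {L : List ℕ} (hL : ∀ t ∈ L, D e t ∉ B)
    {al : List ℕ} (hc : Cov B e al) :
    Cov B e (al.filter (fun m => !(L.contains m))) :=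
  cov_sub hc fun m hm _ hB => List.mem_filter.mpr ⟨hm, by
    simp only [List.contains_eq_mem, Bool.not_eq_true', decide_eq_false_iff_not]
    exact fun hmL => hL m hmL hB⟩

theorem hp_sound {V : Finset α} {B : Finset (Finset α)} {e : ℕ → α} (hT : IsPSTS V B)
    (h : Lab V B e) : ∀ (k S : ℕ) (al : List ℕ) (P : Finset (Finset α)), S < 2048 → P.card = k →
    P ⊆ B → (P : Set (Finset α)).Pairwise Disjoint → P.biUnion id = D e S →
    (∀ b ∈ P, ∃ m ∈ al, m < 2048 ∧ D e m = b) → hp k al S = true := by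
  intro k
  induction k with
  | zero =>
    intro S al P hS hP _ _ hU _
    rw [Finset.card_eq_zero] at hP
    subst hP
    have : S = 0 := D_inj h hS (by norm_num) (by rw [← hU]; simp [D, bits])
    subst this
    rfl
  | succ k ih =>
    intro S al P hS hP hPB hd hU hc
    have sub : ∀ m < 2048, D e m ∈ P → Nat.land m S = m := by
      intro m hm hmP
      change m &&& S = m
      apply Nat.eq_of_testBit_eq
      intro i
      rw [Nat.testBit_and]
      cases hb : m.testBit i
      · rfl
      · have hi := tb_lt hm hb
        have : e i ∈ D e S := by
          rw [← hU]
          exact Finset.mem_biUnion.mpr ⟨_, hmP, (mem_D h hi).mpr hb⟩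
        rw [(mem_D h hi).mp this]; rfl
    have hne : P.Nonempty := Finset.card_pos.mp (by omega)
    obtain ⟨b, hb⟩ := hne
    simp only [hp, filtK_eq, anyK_eq, force_eq, List.append_nil]
    have key : ∀ b ∈ P, ∃ m ∈ (List.filter (fun m => Nat.beq (Nat.land m S) m) al).reverse,
        m < 2048 ∧ D e m = b := by
      intro b hb
      obtain ⟨m, hm, hl, rfl⟩ := hc b hb
      refine ⟨m, ?_, hl, rfl⟩
      rw [List.mem_reverse, List.mem_filter]
      exact ⟨hm, Nat.beq_eq ▸ sub m hl hb⟩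
    obtain ⟨m, hm, hl, rfl⟩ := key b hb
    rw [List.any_eq_true]
    refine ⟨m, hm, ih _ _ (P.erase (D e m)) ?_ ?_ ?_ ?_ ?_ ?_⟩
    · exact Nat.xor_lt_two_pow (n := 11) hS hl
    · rw [Finset.card_erase_of_mem hb]; omega
    · exact (Finset.erase_subset _ _).trans hPB
    · exact hd.mono (by simp)
    · ext x
      constructor
      · intro hx
        obtain ⟨c, hcP, hxc⟩ := Finset.mem_biUnion.mp hx
        obtain ⟨hcn, hcP⟩ := Finset.mem_erase.mp hcP
        have hxS : x ∈ D e S := by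
          rw [← hU]; exact Finset.mem_biUnion.mpr ⟨c, hcP, hxc⟩
        have hxm : x ∉ D e m := Finset.disjoint_left.mp (hd hcP hb hcn) hxc
        obtain ⟨i, hi, rfl⟩ := Finset.mem_image.mp hxS
        obtain ⟨hi, hbi⟩ := mem_bits.mp hi
        rw [mem_D h hi] at hxm ⊢
        change (S ^^^ m).testBit i = true
        rw [Nat.testBit_xor, hbi]
        simpa using hxm
      · intro hx
        obtain ⟨i, hi, rfl⟩ := Finset.mem_image.mp hx
        obtain ⟨hi, hbi⟩ := mem_bits.mp hi
        change (S ^^^ m).testBit i = true at hbi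
        have hsub := sub m hl hb
        change m &&& S = m at hsub
        have hmS : m.testBit i = true → S.testBit i = true := by
          intro hmi
          rw [← hsub, Nat.testBit_and, Bool.and_eq_true] at hmi
          exact hmi.2
        rw [Nat.testBit_xor] at hbi
        have h1 : S.testBit i = true ∧ m.testBit i = false := by
          cases hS1 : S.testBit i <;> cases hm1 : m.testBit i <;> simp_all
        have : e i ∈ P.biUnion id := by rw [hU, mem_D h hi]; exact h1.1
        obtain ⟨c, hcP, hxc⟩ := Finset.mem_biUnion.mp this
        refine Finset.mem_biUnion.mpr ⟨c, Finset.mem_erase.mpr ⟨?_, hcP⟩, hxc⟩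
        rintro rfl
        have := (mem_D h hi).mp hxc
        rw [h1.2] at this
        exact absurd this (by simp)
    · intro c hcP
      exact key c (Finset.mem_of_mem_erase hcP)

theorem mask_lt (l : List ℕ) (h : ∀ i ∈ l, i < 11) : mask l < 2048 := by
  induction l with
  | nil => simp [mask]
  | cons i l ih =>
    have h1 : 1 <<< i < 2 ^ 11 := by
      rw [Nat.one_shiftLeft]
      exact Nat.pow_lt_pow_right (by norm_num) (h i (by simp))
    exact Nat.or_lt_two_pow (n := 11) h1 (ih fun j hj => h j (by simp [hj]))

theorem D_mask (e : ℕ → α) (l : List ℕ) (h : ∀ i ∈ l, i < 11) :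
    D e (mask l) = (l.map e).toFinset := by
  ext x
  simp only [D, Finset.mem_image, mem_bits, testBit_mask, List.mem_toFinset, List.mem_map]
  constructor
  · rintro ⟨i, ⟨_, hi⟩, rfl⟩; exact ⟨i, hi, rfl⟩
  · rintro ⟨i, hi, rfl⟩; exact ⟨i, ⟨h i hi, hi⟩, rfl⟩

theorem good_sound {V : Finset α} {B : Finset (Finset α)} {e : ℕ → α} (hT : IsPSTS V B)
    (h : Lab V B e) (l al : List ℕ) (hc : Cov B e al) (hg : good l al = true) :
    Sequenceable V B := by
  simp only [good, Bool.and_eq_true] at hg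
  obtain ⟨h11, hm, s1, s2, s3⟩ := hg
  have h11 := Nat.eq_of_beq_eq_true h11
  have hm := Nat.eq_of_beq_eq_true hm
  have hmem : ∀ i, i ∈ l ↔ i < 11 := by
    intro i
    rw [← testBit_mask, hm, show (2047 : ℕ) = 2 ^ 11 - 1 by norm_num, Nat.testBit_two_pow_sub_one]
    simp
  have hlt : ∀ i ∈ l, i < 11 := fun i hi => (hmem i).mp hi
  have hV : (l.map e).toFinset = V := by
    rw [← h.im]
    ext x
    simp [hmem]
  have hnd : l.Nodup := by
    rw [← Multiset.coe_nodup, ← Multiset.toFinset_card_eq_card_iff_nodup]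
    have : (l : Multiset ℕ).toFinset = Finset.range 11 := by
      ext i; simp [hmem]
    rw [this]; simp [h11]
  have hinj : ∀ x ∈ l, ∀ y ∈ l, e x = e y → x = y :=
    fun x hx y hy he => h.inj x (hlt x hx) y (hlt y hy) he
  have hnde : (l.map e).Nodup := List.Nodup.map_on hinj hnd
  refine ⟨l.map e, hnde, hV, ?_⟩
  intro i m hne hlen ⟨P, hPB, hd, hU⟩
  have hseg : ((l.map e).drop i).take m = ((l.drop i).take m).map e := by
    simp [List.map_take, List.map_drop]
  rw [hseg] at hne hlen hU
  set s := (l.drop i).take m with hs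
  have hsub : s.Sublist l := (List.take_sublist _ _).trans (List.drop_sublist _ _)
  have hslt : ∀ j ∈ s, j < 11 := fun j hj => hlt j (hsub.subset hj)
  have hcard : P.card * 3 = s.length := by
    have h1 : (P.biUnion id).card = ∑ b ∈ P, b.card :=
      Finset.card_biUnion (fun x hx y hy hxy => hd hx hy hxy)
    rw [hU, List.toFinset_card_of_nodup (hnde.sublist (hsub.map e)), List.length_map] at h1
    rw [h1, Finset.sum_const_nat (m := 3) (fun b hb => (hT.1 b (hPB hb)).2)]
  have hs0 : s.length ≠ 0 := by
    intro h0; apply hne; rw [List.length_eq_zero_iff.mp h0]; rfl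
  simp only [List.length_map, h11] at hlen
  have hlen2 : s.length = min m (11 - i) := by simp [hs, h11]
  have hs2 : s = (l.drop i).take (3 * P.card) := by
    rw [mul_comm, hcard, hlen2, ← h11, ← List.length_drop, hs]
    rcases le_total m (l.drop i).length with hle | hle
    · rw [min_eq_left hle]
    · rw [min_eq_right hle, List.take_of_length_le hle, List.take_length]
  have htrue : hp P.card al (mask s) = true :=
    hp_sound hT h _ _ al P (mask_lt s hslt) rfl hPB hd (by rw [hU, D_mask e s hslt])
      (fun b hb => hc b (hPB hb))
  have fin : ∀ n, segs al l P.card n = true → i < n → False := by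
    intro n hn hin
    simp only [segs, List.all_eq_true, List.mem_range] at hn
    have := hn i hin
    rw [force_eq, ← hs2, htrue] at this
    exact absurd this (by simp)
  have hk : P.card = 1 ∨ P.card = 2 ∨ P.card = 3 := by omega
  rcases hk with hk | hk | hk
  · exact fin 9 (by rw [hk]; exact s1) (by omega)
  · exact fin 6 (by rw [hk]; exact s2) (by omega)
  · exact fin 3 (by rw [hk]; exact s3) (by omega)

theorem check_sound {V : Finset α} {B : Finset (Finset α)} {e : ℕ → α} (hT : IsPSTS V B)
    (h : Lab V B e) : ∀ (t : Tr) (al : List ℕ), Cov B e al → check t al = true →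
    Sequenceable V B := by
  intro t
  induction t with
  | leaf l => exact fun al hc hk => good_sound hT h l al hc hk
  | node t p q ihp ihq =>
    intro al hc hk
    simp only [check, Bool.and_eq_true, filtK_eq, List.append_nil] at hk
    obtain ⟨ht, h1, h2⟩ := hk
    have ht : t < 2048 := by simpa using ht
    by_cases htB : D e t ∈ B
    · refine ihp _ ?_ h1
      exact cov_sub (cov_keep hT h ht htB hc) (fun m hm _ _ => List.mem_reverse.mpr hm)
    · refine ihq _ ?_ h2
      refine cov_sub hc (fun m hm _ hB => List.mem_reverse.mpr (List.mem_filter.mpr ⟨hm, ?_⟩))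
      have : m ≠ t := by rintro rfl; exact htB hB
      show (!(Nat.beq m t)) = true
      rw [Bool.not_eq_true', Bool.eq_false_iff]
      exact fun hh => this (Nat.eq_of_beq_eq_true hh)

theorem allM_spec : ∀ i < 11, ∀ j < 11, ∀ k < 11, i < j → j < k →
    ∃ m ∈ allM, m < 2048 ∧ bits m = {i, j, k} := by
  have : ∀ i ∈ List.range 11, ∀ j ∈ List.range 11, ∀ k ∈ List.range 11, i < j → j < k →
    (2 ^ i + 2 ^ j + 2 ^ k) ∈ allM ∧ (2 ^ i + 2 ^ j + 2 ^ k) < 2048 ∧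
      bits (2 ^ i + 2 ^ j + 2 ^ k) = {i, j, k} := by decide +kernel
  intro i hi j hj k hk hij hjk
  exact ⟨_, this i (List.mem_range.mpr hi) j (List.mem_range.mpr hj) k (List.mem_range.mpr hk)
    hij hjk⟩

theorem cov_all {V : Finset α} {B : Finset (Finset α)} {e : ℕ → α} (hT : IsPSTS V B)
    (h : Lab V B e) : Cov B e allM := by
  intro b hb
  obtain ⟨hbV, hb3⟩ := hT.1 b hb
  let s : Finset ℕ := (Finset.range 11).filter (fun i => e i ∈ b)
  have hsb : s.image e = b := by
    ext x
    simp only [s, Finset.mem_image, Finset.mem_filter, Finset.mem_range]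
    constructor
    · rintro ⟨i, ⟨_, hi⟩, rfl⟩; exact hi
    · intro hx
      have := hbV hx
      rw [← h.im] at this
      obtain ⟨i, hi, rfl⟩ := Finset.mem_image.mp this
      exact ⟨i, ⟨Finset.mem_range.mp hi, hx⟩, rfl⟩
  have hs3 : s.card = 3 := by
    rw [← hb3, ← hsb, Finset.card_image_of_injOn]
    intro i hi j hj he
    simp only [s, Finset.coe_filter, Finset.mem_range, Set.mem_ofPred_eq] at hi hj
    exact h.inj i hi.1 j hj.1 he
  have hlt : ∀ i ∈ s, i < 11 := by
    intro i hi
    simp only [s, Finset.mem_filter, Finset.mem_range] at hi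
    exact hi.1
  have : ∃ i < 11, ∃ j < 11, ∃ k < 11, i < j ∧ j < k ∧ s = {i, j, k} := by
    let f := s.orderEmbOfFin hs3
    have h0 := hlt _ (s.orderEmbOfFin_mem hs3 0)
    have h1 := hlt _ (s.orderEmbOfFin_mem hs3 1)
    have h2 := hlt _ (s.orderEmbOfFin_mem hs3 2)
    refine ⟨_, h0, _, h1, _, h2, (s.orderEmbOfFin hs3).strictMono (by decide),
      (s.orderEmbOfFin hs3).strictMono (by decide), ?_⟩
    have := Finset.image_orderEmbOfFin_univ s hs3
    refine this.symm.trans ?_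
    have hu : (Finset.univ : Finset (Fin 3)) = {0, 1, 2} := by decide
    rw [hu, Finset.image_insert, Finset.image_insert, Finset.image_singleton]
  obtain ⟨i, hi, j, hj, k, hk, hij, hjk, hsE⟩ := this
  obtain ⟨m, hm, hl, hbits⟩ := allM_spec i hi j hj k hk hij hjk
  exact ⟨m, hm, hl, by rw [D, hbits, ← hsE, hsb]⟩

theorem cov_base {V : Finset α} {B : Finset (Finset α)} {e : ℕ → α} (hT : IsPSTS V B)
    (h : Lab V B e) : Cov B e base :=
  cov_keep hT h (by norm_num) h.b2 (cov_keep hT h (by norm_num) h.b1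
    (cov_keep hT h (by norm_num) h.b0 (cov_all hT h)))

def OkPerm (s : ℕ → ℕ) : Prop :=
  (Finset.range 11).image s = Finset.range 11 ∧ (bits 7).image s = bits 7 ∧
    (bits 56).image s = bits 56 ∧ (bits 448).image s = bits 448

instance (s : ℕ → ℕ) : Decidable (OkPerm s) := by unfold OkPerm; infer_instance

theorem D_comp (e : ℕ → α) (s : ℕ → ℕ) (m m' : ℕ) (h : (bits m).image s = bits m') :
    D (e ∘ s) m = D e m' := by
  rw [D, ← Finset.image_image, h, D]

theorem Lab.comp {V : Finset α} {B : Finset (Finset α)} {e : ℕ → α} (h : Lab V B e)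
    {s : ℕ → ℕ} (hs : OkPerm s) : Lab V B (e ∘ s) := by
  obtain ⟨h0, h1, h2, h3⟩ := hs
  have hlt : ∀ i < 11, s i < 11 := by
    intro i hi
    have : s i ∈ (Finset.range 11).image s := Finset.mem_image_of_mem _ (Finset.mem_range.mpr hi)
    rw [h0] at this
    exact Finset.mem_range.mp this
  refine ⟨?_, ?_, ?_, ?_, ?_⟩
  · intro i hi j hj he
    have h4 := h.inj _ (hlt i hi) _ (hlt j hj) he
    have h5 : Set.InjOn s (Finset.range 11) := by
      rw [← Finset.card_image_iff, h0]
    exact h5 (by simpa using hi) (by simpa using hj) h4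
  · rw [← Finset.image_image, h0, h.im]
  · rw [D_comp e s 7 7 h1]; exact h.b0
  · rw [D_comp e s 56 56 h2]; exact h.b1
  · rw [D_comp e s 448 448 h3]; exact h.b2

def sw (a b n : ℕ) : ℕ := if n = a then b else if n = b then a else n

def sig (a i b j c k n : ℕ) : ℕ := sw a i (sw b j (sw c k n))

theorem perm_trs : ∀ m ∈ trs, ∃ i ∈ Finset.range 11, ∃ j ∈ Finset.range 11, ∃ k ∈ Finset.range 11,
    OkPerm (sig 0 i 3 j 6 k) ∧ (bits 73).image (sig 0 i 3 j 6 k) = bits m := by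
  have : ∀ m ∈ trs, ∃ i ∈ [0, 1, 2], ∃ j ∈ [3, 4, 5], ∃ k ∈ [6, 7, 8],
    OkPerm (sig 0 i 3 j 6 k) ∧ (bits 73).image (sig 0 i 3 j 6 k) = bits m := by decide +kernel
  intro m hm
  obtain ⟨i, hi, j, hj, k, hk, h⟩ := this m hm
  simp only [List.mem_cons, List.not_mem_nil, or_false] at hi hj hk
  exact ⟨i, Finset.mem_range.mpr (by omega), j, Finset.mem_range.mpr (by omega), k,
    Finset.mem_range.mpr (by omega), h⟩

theorem perm_dj : ∀ m ∈ dj, ∃ i ∈ [1, 2], ∃ j ∈ [4, 5], ∃ k ∈ [7, 8],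
    OkPerm (sig 1 i 4 j 7 k) ∧ (bits 146).image (sig 1 i 4 j 7 k) = bits m ∧
      (bits 73).image (sig 1 i 4 j 7 k) = bits 73 := by decide +kernel

theorem main_of_lab {V : Finset α} {B : Finset (Finset α)} {e₀ : ℕ → α} (hT : IsPSTS V B)
    (h₀ : Lab V B e₀) : Sequenceable V B := by
  by_cases h1 : ∃ e, Lab V B e ∧ D e 73 ∈ B ∧ D e 146 ∈ B
  · obtain ⟨e, h, ha, hb⟩ := h1
    exact check_sound hT h c1 _ (cov_keep hT h (by norm_num) hb
      (cov_keep hT h (by norm_num) ha (cov_base hT h))) check1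
  by_cases h2 : ∃ e, Lab V B e ∧ D e 73 ∈ B
  · obtain ⟨e, h, ha⟩ := h2
    refine check_sound hT h c2 _ (cov_rm ?_ (cov_keep hT h (by norm_num) ha (cov_base hT h))) check2
    intro t ht hB
    obtain ⟨i, _, j, _, k, _, hok, hi1, hi2⟩ := perm_dj t ht
    exact h1 ⟨_, h.comp hok, by rw [D_comp e _ _ _ hi2]; exact ha,
      by rw [D_comp e _ _ _ hi1]; exact hB⟩
  · refine check_sound hT h₀ c3 _ (cov_rm ?_ (cov_base hT h₀)) check3
    intro t ht hB
    obtain ⟨i, _, j, _, k, _, hok, hi1⟩ := perm_trs t ht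
    exact h2 ⟨_, h₀.comp hok, by rw [D_comp e₀ _ _ _ hi1]; exact hB⟩

theorem exists_lab {V : Finset α} {B : Finset (Finset α)} (hT : IsPSTS V B)
    (h11 : V.card = 11) (h3 : HasDisjointBlocks B 3) : ∃ e, Lab V B e := by
  obtain ⟨P, hPB, hP3, hd⟩ := h3
  obtain ⟨X, Y, Z, hXY, hXZ, hYZ, rfl⟩ := Finset.card_eq_three.mp hP3
  have hX : X ∈ B := hPB (by simp)
  have hY : Y ∈ B := hPB (by simp)
  have hZ : Z ∈ B := hPB (by simp)
  have dXY : Disjoint X Y := hd (by simp) (by simp) hXY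
  have dXZ : Disjoint X Z := hd (by simp) (by simp) hXZ
  have dYZ : Disjoint Y Z := hd (by simp) (by simp) hYZ
  have hUV : X ∪ Y ∪ Z ⊆ V :=
    Finset.union_subset (Finset.union_subset (hT.1 X hX).1 (hT.1 Y hY).1) (hT.1 Z hZ).1
  have hU9 : (X ∪ Y ∪ Z).card = 9 := by
    rw [Finset.card_union_of_disjoint (Finset.disjoint_union_left.mpr ⟨dXZ, dYZ⟩),
      Finset.card_union_of_disjoint dXY, (hT.1 X hX).2, (hT.1 Y hY).2, (hT.1 Z hZ).2]
  have hW : (V \ (X ∪ Y ∪ Z)).card = 2 := by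
    rw [Finset.card_sdiff_of_subset hUV]; omega
  obtain ⟨u, v, _, huv⟩ := Finset.card_eq_two.mp hW
  obtain ⟨x0, x1, x2, _, _, _, eX⟩ := Finset.card_eq_three.mp (hT.1 X hX).2
  obtain ⟨y0, y1, y2, _, _, _, eY⟩ := Finset.card_eq_three.mp (hT.1 Y hY).2
  obtain ⟨z0, z1, z2, _, _, _, eZ⟩ := Finset.card_eq_three.mp (hT.1 Z hZ).2
  let L : List α := [x0, x1, x2, y0, y1, y2, z0, z1, z2, u, v]
  have hr : Finset.range 11 = {0, 1, 2, 3, 4, 5, 6, 7, 8, 9, 10} := by decide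
  have him : (Finset.range 11).image (fun i => L.getD i u) = V := by
    rw [← Finset.union_sdiff_of_subset hUV, huv, eX, eY, eZ, hr]
    simp only [Finset.image_insert, Finset.image_singleton, L, List.getD_cons_zero,
      List.getD_cons_succ, Finset.insert_union, Finset.singleton_union, Finset.union_assoc]
  refine ⟨fun i => L.getD i u, ?_, him, ?_, ?_, ?_⟩
  · have h5 : Set.InjOn (fun i => L.getD i u) (Finset.range 11) := by
      rw [← Finset.card_image_iff, him, h11, Finset.card_range]
    intro i hi j hj he
    exact h5 (by simpa using hi) (by simpa using hj) he
  · have : bits 7 = {0, 1, 2} := by decide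
    rw [D, this]
    simpa [L, eX] using hX
  · have : bits 56 = {3, 4, 5} := by decide
    rw [D, this]
    simpa [L, eY] using hY
  · have : bits 448 = {6, 7, 8} := by decide
    rw [D, this]
    simpa [L, eZ] using hZ

end

end Eleven


/-- Every partial Steiner triple system of order 11 having three pairwise
disjoint blocks is sequenceable. -/
theorem sequenceable_order_eleven {α : Type*} [DecidableEq α]
    (V : Finset α) (B : Finset (Finset α)) (hT : IsPSTS V B)
    (h11 : V.card = 11) (h3 : HasDisjointBlocks B 3) :
    Sequenceable V B := by
  obtain ⟨e, h⟩ := Eleven.exists_lab hT h11 h3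
  exact Eleven.main_of_lab hT h
end

section
/- Let T be a partial Steiner triple system of order 12 having three pairwise disjoint blocks B₁, B₂, B₃ but no four pairwise disjoint blocks, and let L be the set of the three points not in B₁ ∪ B₂ ∪ B₃. Then for every a ∈ L and every point t ∈ B₁, there exist at least two distinct points w ∈ B₃ with the following property: B₂ and B₃ can be labelled B₂ = {x₄, x₅, x₆} and B₃ = {x₇, x₈, x₉} with x₉ = w so that the six-term sequence t, x₅, x₇, x₆, x₈, a is admissible, i.e., no segment of it (no set of consecutive entries) can be partitioned into pairwise disjoint blocks of T. -/
/-- A sequence of points is admissible if no nonempty segment of it can be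
partitioned into pairwise disjoint blocks of `B`. -/
def AdmissibleList {α : Type*} [DecidableEq α] (B : Finset (Finset α))
    (l : List α) : Prop :=
  ∀ i m : ℕ, (l.drop i).take m ≠ [] →
    ¬ IsBlockPartition B ((l.drop i).take m).toFinset


set_option synthInstance.maxHeartbeats 400000 in
set_option synthInstance.maxSize 2000 in
theorem comb_aux : ∀ M N : Fin 2 → Option (Fin 3),
    (∀ p, M p ≠ none → M p ≠ N p) → (M 0 ≠ none → M 0 ≠ M 1) → (N 0 ≠ none → N 0 ≠ N 1) →
    ∃ u v : Fin 3, ∃ x y : Fin 2, u ≠ v ∧ x ≠ y ∧ M x ≠ some u ∧ N y ≠ some v ∧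
      ¬ (M y = some u ∧ N x = some v) ∧ ¬ (M x = some v ∧ N y = some u) ∧
      ¬ (M y = some v ∧ N x = some u) := by
  decide +kernel

theorem opt_aux (f : Fin 3 → Prop) (h : ∀ i j, f i → f j → i = j) :
    ∃ o : Option (Fin 3), ∀ i, f i ↔ o = some i := by
  by_cases hf : ∃ i, f i
  · obtain ⟨i, hi⟩ := hf
    refine ⟨some i, fun j => ⟨fun hj => by rw [h i j hi hj], fun hj => ?_⟩⟩
    simp only [Option.some.injEq] at hj
    exact hj ▸ hi
  · push Not at hf
    exact ⟨none, fun j => by simp [hf j]⟩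

theorem comb_aux2 (M N : Fin 2 → Fin 3 → Prop)
    (hM : ∀ p i j, M p i → M p j → i = j) (hN : ∀ p i j, N p i → N p j → i = j)
    (hMN : ∀ p i, M p i → ¬ N p i)
    (hM' : ∀ i, M 0 i → ¬ M 1 i) (hN' : ∀ i, N 0 i → ¬ N 1 i) :
    ∃ u v : Fin 3, ∃ x y : Fin 2, u ≠ v ∧ x ≠ y ∧ ¬ M x u ∧ ¬ N y v ∧
      ¬ (M y u ∧ N x v) ∧ ¬ (M x v ∧ N y u) ∧ ¬ (M y v ∧ N x u) := by
  choose m hm using fun p => opt_aux (M p) (hM p)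
  choose n hn using fun p => opt_aux (N p) (hN p)
  simp only [hm, hn] at *
  apply comb_aux m n
  · intro p hp he
    obtain ⟨i, hi⟩ := Option.ne_none_iff_exists'.1 hp
    exact hMN p i hi (he ▸ hi)
  · intro hp he
    obtain ⟨i, hi⟩ := Option.ne_none_iff_exists'.1 hp
    exact hM' i hi (he ▸ hi)
  · intro hp he
    obtain ⟨i, hi⟩ := Option.ne_none_iff_exists'.1 hp
    exact hN' i hi (he ▸ hi)

theorem psts_eq {α : Type*} [DecidableEq α] {V : Finset α} {B : Finset (Finset α)}
    (hT : IsPSTS V B) {b c : Finset α} (hb : b ∈ B) (hc : c ∈ B) {x y : α} (hxy : x ≠ y)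
    (h1 : x ∈ b) (h2 : y ∈ b) (h3 : x ∈ c) (h4 : y ∈ c) : b = c := by
  by_contra hne
  have h := hT.2 b hb c hc hne
  have : ({x, y} : Finset α) ⊆ b ∩ c := by
    intro z hz
    simp only [Finset.mem_insert, Finset.mem_singleton] at hz
    rcases hz with rfl | rfl <;> simp [*]
  have := Finset.card_le_card this
  rw [Finset.card_pair hxy] at this
  omega

theorem three_aux {α : Type*} [DecidableEq α] {b : Finset α} (hb : b.card = 3) {x y z : α}
    (hxy : x ≠ y) (hxz : x ≠ z) (hyz : y ≠ z) (hx : x ∈ b) (hy : y ∈ b) (hz : z ∈ b) :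
    b = {x, y, z} := by
  symm
  apply Finset.eq_of_subset_of_card_le
  · intro w hw
    simp only [Finset.mem_insert, Finset.mem_singleton] at hw
    rcases hw with rfl | rfl | rfl <;> assumption
  · rw [hb, Finset.card_eq_three.2 ⟨x, y, z, hxy, hxz, hyz, rfl⟩]

theorem part_card {α : Type*} [DecidableEq α] {V : Finset α} {B : Finset (Finset α)}
    (hT : IsPSTS V B) {P : Finset (Finset α)} (hP : P ⊆ B)
    (hd : (P : Set (Finset α)).Pairwise Disjoint) : (P.biUnion id).card = 3 * P.card := by
  rw [Finset.card_biUnion (t := id) (fun x hx y hy h => hd hx hy h)]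
  rw [Finset.sum_congr rfl (fun b hb => show (id b).card = 3 from (hT.1 b (hP hb)).2)]
  simp [mul_comm]

theorem part_three {α : Type*} [DecidableEq α] {V : Finset α} {B : Finset (Finset α)}
    (hT : IsPSTS V B) {S : Finset α} (hS : S.card = 3) (h : IsBlockPartition B S) : S ∈ B := by
  obtain ⟨P, hP, hd, rfl⟩ := h
  rw [part_card hT hP hd] at hS
  obtain ⟨b, rfl⟩ := Finset.card_eq_one.1 (show P.card = 1 by omega)
  simpa using hP

theorem part_six {α : Type*} [DecidableEq α] {V : Finset α} {B : Finset (Finset α)}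
    (hT : IsPSTS V B) {S : Finset α} (hS : S.card = 6) (h : IsBlockPartition B S)
    {t : α} (ht : t ∈ S) :
    ∃ b ∈ B, ∃ c ∈ B, b ∪ c = S ∧ t ∈ b ∧ Disjoint b c := by
  obtain ⟨P, hP, hd, rfl⟩ := h
  rw [part_card hT hP hd] at hS
  obtain ⟨b, c, hbc, rfl⟩ := Finset.card_eq_two.1 (show P.card = 2 by omega)
  have hb : b ∈ B := hP (by simp)
  have hc : c ∈ B := hP (by simp)
  have hdis : Disjoint b c := hd (by simp) (by simp) hbc
  have : t ∈ b ∨ t ∈ c := by simpa using ht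
  rcases this with h | h
  · exact ⟨b, hb, c, hc, by simp, h, hdis⟩
  · exact ⟨c, hc, b, hb, by simp [Finset.union_comm], h, hdis.symm⟩

theorem rot3 {α : Type*} [DecidableEq α] (x y z : α) :
    ({x, y, z} : Finset α) = [y, z, x].toFinset := by
  ext; simp; tauto

set_option maxHeartbeats 2000000 in
theorem adm_aux {α : Type*} [DecidableEq α] {V : Finset α} {B : Finset (Finset α)}
    (hT : IsPSTS V B) {t a x4 x5 x6 x7 x8 x9 : α}
    (hnd : [t, a, x4, x5, x6, x7, x8, x9].Nodup)
    (h2 : ({x4, x5, x6} : Finset α) ∈ B) (h3 : ({x7, x8, x9} : Finset α) ∈ B)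
    (c1 : {t, x5, x7} ∉ B) (c2 : {a, x6, x8} ∉ B)
    (c3 : ¬ ({t, x5, x8} ∈ B ∧ {a, x6, x7} ∈ B))
    (c4 : ¬ ({t, x6, x7} ∈ B ∧ {a, x5, x8} ∈ B))
    (c5 : ¬ ({t, x6, x8} ∈ B ∧ {a, x5, x7} ∈ B)) :
    AdmissibleList B [t, x5, x7, x6, x8, a] := by
  simp only [List.nodup_cons, List.mem_cons, List.not_mem_nil, not_or, List.nodup_nil] at hnd
  obtain ⟨⟨n1, n2, n3, n4, n5, n6, n7, -⟩, ⟨m1, m2, m3, m4, m5, m6, -⟩, ⟨k1, k2, k3, k4, k5, -⟩,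
    ⟨l1, l2, l3, l4, -⟩, ⟨j1, j2, j3, -⟩, ⟨i1, i2, -⟩, ⟨i3, -⟩, -⟩ := hnd
  have k56 : ∀ b ∈ B, x4 ∉ b → x5 ∈ b → x6 ∈ b → False := by
    intro b hb h4 h5 h6
    have := psts_eq hT hb h2 l1 h5 h6 (by simp) (by simp)
    exact h4 (by rw [this]; simp)
  have k78 : ∀ b ∈ B, x9 ∉ b → x7 ∈ b → x8 ∈ b → False := by
    intro b hb h4 h5 h6
    have := psts_eq hT hb h3 i1 h5 h6 (by simp) (by simp)
    exact h4 (by rw [this]; simp)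
  intro i m hne hp
  have hnodup : [t, x5, x7, x6, x8, a].Nodup := by
    simp; grind
  have hcard := List.toFinset_card_of_nodup
    (((List.take_sublist m _).trans (List.drop_sublist i _)).nodup hnodup)
  obtain ⟨k, hk⟩ : ∃ k, (([t, x5, x7, x6, x8, a].drop i).take m).toFinset.card = 3 * k := by
    obtain ⟨P, hP, hd, he⟩ := hp
    exact ⟨P.card, by rw [← he, part_card hT hP hd]⟩
  have hlen : (([t, x5, x7, x6, x8, a].drop i).take m).length = 3 ∨
      (([t, x5, x7, x6, x8, a].drop i).take m).length = 6 := by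
    have h1 := List.length_pos_of_ne_nil hne
    have h2 : (([t, x5, x7, x6, x8, a].drop i).take m).length ≤ 6 := by
      simp
    omega
  rcases hlen with hlen | hlen
  · have hB := part_three hT (hcard.trans hlen) hp
    have hi : m = 3 ∧ i < 4 ∨ 3 < m ∧ i = 3 := by
      simp at hlen; omega
    have e3 : (([t, x5, x7, x6, x8, a].drop i).take m) =
      (([t, x5, x7, x6, x8, a].drop i).take 3) := by
      rcases hi with ⟨rfl, -⟩ | ⟨h, rfl⟩
      · rfl
      · rw [List.take_of_length_le (by simp; omega)]; rfl
    have hi4 : i < 4 := by omega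
    rw [e3] at hB
    interval_cases i
    · apply c1; convert hB using 1; ext; simp
    · exact k56 _ hB (by simp; grind) (by simp) (by simp)
    · exact k78 _ hB (by simp; grind) (by simp) (by simp)
    · apply c2; convert hB using 1; exact rot3 _ _ _
  · have hi : 6 ≤ m ∧ i = 0 := by
      simp at hlen; omega
    obtain ⟨hm, rfl⟩ := hi
    have e6 : (([t, x5, x7, x6, x8, a].drop 0).take m) = [t, x5, x7, x6, x8, a] := by
      rw [List.take_of_length_le (by simp; omega)]; rfl
    have h6 := hcard.trans hlen
    rw [e6] at h6 hp
    obtain ⟨b, hb, c, hc, hu, htb, hdis⟩ := part_six hT h6 hp (t := t) (by simp)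
    have mem : ∀ z, (z ∈ b ∨ z ∈ c) ↔ (z = t ∨ z = x5 ∨ z = x7 ∨ z = x6 ∨ z = x8 ∨ z = a) := by
      intro z
      rw [← Finset.mem_union, hu]; simp
    have h4 : ¬ (x4 ∈ b ∨ x4 ∈ c) := by rw [mem]; grind
    have h9 : ¬ (x9 ∈ b ∨ x9 ∈ c) := by rw [mem]; grind
    push Not at h4 h9
    have hb3 := (hT.1 b hb).2
    have hc3 := (hT.1 c hc).2
    have m5 := (mem x5).2 (by simp)
    have m6 := (mem x6).2 (by simp)
    have m7 := (mem x7).2 (by simp)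
    have m8 := (mem x8).2 (by simp)
    have ma := (mem a).2 (by simp)
    have b56 := k56 b hb h4.1
    have c56 := k56 c hc h4.2
    have b78 := k78 b hb h9.1
    have c78 := k78 c hc h9.2
    have key : ∀ u v u' v', t ≠ u → t ≠ v → u ≠ v → a ≠ u' → a ≠ v' → u' ≠ v' → a ≠ u → a ≠ v →
        u ∈ b → v ∈ b → u' ∈ c → v' ∈ c → {t, u, v} ∈ B ∧ {a, u', v'} ∈ B := by
      intro u v u' v' h1 h2 h3 h4 h5 h6 h7 h8 hu hv hu' hv'
      have e1 := three_aux hb3 h1 h2 h3 htb hu hv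
      have hac : a ∈ c := by
        rcases ma with h | h
        · rw [e1] at h; simp at h; grind
        · exact h
      have e2 := three_aux hc3 h4 h5 h6 hac hu' hv'
      exact ⟨e1 ▸ hb, e2 ▸ hc⟩
    rcases m5 with q5 | q5 <;> rcases m6 with q6 | q6
    · exact b56 q5 q6
    · rcases m7 with q7 | q7 <;> rcases m8 with q8 | q8
      · exact b78 q7 q8
      · exact c1 (key x5 x7 x6 x8 (by grind) (by grind) (by grind) (by grind) (by grind) (by grind) (by grind) (by grind) q5 q7 q6 q8).1
      · exact c3 (key x5 x8 x6 x7 (by grind) (by grind) (by grind) (by grind) (by grind) (by grind) (by grind) (by grind) q5 q8 q6 q7)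
      · exact c78 q7 q8
    · rcases m7 with q7 | q7 <;> rcases m8 with q8 | q8
      · exact b78 q7 q8
      · exact c4 (key x6 x7 x5 x8 (by grind) (by grind) (by grind) (by grind) (by grind) (by grind) (by grind) (by grind) q6 q7 q5 q8)
      · exact c5 (key x6 x8 x5 x7 (by grind) (by grind) (by grind) (by grind) (by grind) (by grind) (by grind) (by grind) q6 q8 q5 q7)
      · exact c78 q7 q8
    · exact c56 q5 q6

theorem perm3 {α : Type*} [DecidableEq α] (f : Fin 3 → α) {u v : Fin 3} (huv : u ≠ v) :
    ∃ k, k ≠ u ∧ k ≠ v ∧ ({f 0, f 1, f 2} : Finset α) = {f k, f u, f v} := by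
  obtain ⟨k, h1, h2, h3⟩ : ∃ k : Fin 3, k ≠ u ∧ k ≠ v ∧
    ∀ i : Fin 3, i = k ∨ i = u ∨ i = v := by revert u v; decide
  refine ⟨k, h1, h2, ?_⟩
  ext z
  simp only [Finset.mem_insert, Finset.mem_singleton]
  have : (z = f 0 ∨ z = f 1 ∨ z = f 2) ↔ ∃ i, z = f i := by simp [Fin.exists_fin_succ]
  rw [this]
  constructor
  · rintro ⟨i, rfl⟩
    rcases h3 i with rfl | rfl | rfl <;> simp
  · rintro (h | h | h) <;> exact ⟨_, h⟩

theorem main_aux {α : Type*} [DecidableEq α] {V : Finset α} {B : Finset (Finset α)}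
    (hT : IsPSTS V B) {t a w : α} (U : Fin 3 → α) (P : Fin 2 → α)
    (hU : U.Injective) (hPi : P.Injective) (hUP : ∀ i p, U i ≠ P p) (hw : ∀ p, P p ≠ w)
    (hUw : ∀ i, U i ≠ w)
    (ht : ∀ i, t ≠ U i) (ht' : ∀ p, t ≠ P p) (htw : t ≠ w) (hta : t ≠ a)
    (ha : ∀ i, a ≠ U i) (ha' : ∀ p, a ≠ P p) (haw : a ≠ w)
    (h2 : ({U 0, U 1, U 2} : Finset α) ∈ B) (h3 : ({P 0, P 1, w} : Finset α) ∈ B) :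
    ∃ x₄ x₅ x₆ x₇ x₈ : α,
        ({U 0, U 1, U 2} : Finset α) = {x₄, x₅, x₆} ∧ ({P 0, P 1, w} : Finset α) = {x₇, x₈, w} ∧
        AdmissibleList B [t, x₅, x₇, x₆, x₈, a] := by
  have g1 : ∀ s : α, (∀ i, s ≠ U i) → (∀ p, s ≠ P p) →
      ∀ p i j, {s, U i, P p} ∈ B → {s, U j, P p} ∈ B → i = j := by
    intro s hs hs' p i j hi hj
    have e := psts_eq hT hi hj (hs' p) (by simp) (by simp) (by simp) (by simp)
    have : U i ∈ ({s, U j, P p} : Finset α) := by rw [← e]; simp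
    simp only [Finset.mem_insert, Finset.mem_singleton] at this
    rcases this with h | h | h
    · exact absurd h.symm (hs i)
    · exact hU h
    · exact absurd h (hUP i p)
  have g2 : ∀ s : α, (∀ i, s ≠ U i) → (∀ p, s ≠ P p) →
      ∀ i, {s, U i, P 0} ∈ B → {s, U i, P 1} ∉ B := by
    intro s hs hs' i hi hj
    have e := psts_eq hT hi hj (hs i) (by simp) (by simp) (by simp) (by simp)
    have : P 0 ∈ ({s, U i, P 1} : Finset α) := by rw [← e]; simp
    simp only [Finset.mem_insert, Finset.mem_singleton] at this
    rcases this with h | h | h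
    · exact absurd h.symm (hs' 0)
    · exact absurd h.symm (hUP i 0)
    · exact absurd (hPi h) (by decide)
  obtain ⟨u, v, x, y, huv, hxy, c1, c2, c3, c4, c5⟩ := comb_aux2
    (fun p i => {t, U i, P p} ∈ B) (fun p i => {a, U i, P p} ∈ B)
    (g1 t ht ht') (g1 a ha ha') (by
      intro p i hi hj
      have e := psts_eq hT hi hj (hUP i p) (by simp) (by simp) (by simp) (by simp)
      have : t ∈ ({a, U i, P p} : Finset α) := by rw [← e]; simp
      simp only [Finset.mem_insert, Finset.mem_singleton] at this
      rcases this with h | h | h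
      · exact hta h
      · exact ht i h
      · exact ht' p h) (g2 t ht ht') (g2 a ha ha')
  obtain ⟨k, hku, hkv, hk⟩ := perm3 U huv
  have e3 : ({P 0, P 1, w} : Finset α) = {P x, P y, w} := by
    have : (x = 0 ∧ y = 1) ∨ (x = 1 ∧ y = 0) := by omega
    rcases this with ⟨rfl, rfl⟩ | ⟨rfl, rfl⟩
    · rfl
    · exact Finset.insert_comm _ _ _
  refine ⟨U k, U u, U v, P x, P y, hk, e3, ?_⟩
  have hku' := hU.ne hku
  have hkv' := hU.ne hkv
  have huv' := hU.ne huv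
  have hxy' := hPi.ne hxy
  exact adm_aux hT (x4 := U k) (x9 := w) (by simp; grind) (hk ▸ h2) (e3 ▸ h3) c1 c2 c3 c4 c5

/-- In a partial Steiner triple system of order 12 with three pairwise disjoint
blocks `B₁, B₂, B₃` but no four pairwise disjoint blocks, for every `a` in the
set `L` of the three remaining points and every `t ∈ B₁` there are at least two
points `w ∈ B₃` such that `B₂` and `B₃` can be labelled `B₂ = {x₄, x₅, x₆}`,
`B₃ = {x₇, x₈, x₉}` with `x₉ = w` making the sequence `t, x₅, x₇, x₆, x₈, a`
admissible. -/
theorem flexible_six_segment {α : Type*} [DecidableEq α]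
    (V : Finset α) (B : Finset (Finset α)) (hT : IsPSTS V B)
    (h12 : V.card = 12) (B₁ B₂ B₃ : Finset α)
    (h₁ : B₁ ∈ B) (h₂ : B₂ ∈ B) (h₃ : B₃ ∈ B)
    (hd₁₂ : Disjoint B₁ B₂) (hd₁₃ : Disjoint B₁ B₃) (hd₂₃ : Disjoint B₂ B₃)
    (h4 : ¬ HasDisjointBlocks B 4) (L : Finset α)
    (hL : L = V \ (B₁ ∪ B₂ ∪ B₃)) :
    ∀ a ∈ L, ∀ t ∈ B₁, ∃ w₁ ∈ B₃, ∃ w₂ ∈ B₃, w₁ ≠ w₂ ∧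
      ∀ w ∈ ({w₁, w₂} : Finset α), ∃ x₄ x₅ x₆ x₇ x₈ : α,
        B₂ = {x₄, x₅, x₆} ∧ B₃ = {x₇, x₈, w} ∧
        AdmissibleList B [t, x₅, x₇, x₆, x₈, a] := by
  intro a ha t ht
  obtain ⟨u0, u1, u2, hu01, hu02, hu12, rfl⟩ := Finset.card_eq_three.1 (hT.1 _ h₂).2
  obtain ⟨p, q, r, hpq, hpr, hqr, rfl⟩ := Finset.card_eq_three.1 (hT.1 _ h₃).2
  have aux : ∀ p' q' r' : α, p' ≠ q' → p' ≠ r' → q' ≠ r' →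
      ({p, q, r} : Finset α) = {p', q', r'} → ∃ x₄ x₅ x₆ x₇ x₈ : α,
        ({u0, u1, u2} : Finset α) = {x₄, x₅, x₆} ∧ ({p, q, r} : Finset α) = {x₇, x₈, r'} ∧
        AdmissibleList B [t, x₅, x₇, x₆, x₈, a] := by
    intro p' q' r' n1 n2 n3 e
    rw [hL] at ha
    rw [e] at h₃ hd₁₃ hd₂₃ ha ⊢
    clear e hL
    have t2 := Finset.disjoint_left.1 hd₁₂ ht
    have t3 := Finset.disjoint_left.1 hd₁₃ ht
    simp only [Finset.mem_sdiff, Finset.mem_union, not_or] at ha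
    obtain ⟨-, ⟨a1, a2⟩, a3⟩ := ha
    have hta : t ≠ a := fun h => a1 (h ▸ ht)
    have d0 := Finset.disjoint_left.1 hd₂₃ (show u0 ∈ _ by simp)
    have d1 := Finset.disjoint_left.1 hd₂₃ (show u1 ∈ _ by simp)
    have d2 := Finset.disjoint_left.1 hd₂₃ (show u2 ∈ _ by simp)
    simp only [Finset.mem_insert, Finset.mem_singleton, not_or] at t2 t3 a2 a3 d0 d1 d2
    refine main_aux hT (w := r') ![u0, u1, u2] ![p', q'] ?_ ?_ ?_ ?_ ?_ ?_ ?_ ?_ hta ?_ ?_ ?_ h₂ h₃ <;>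
      clear hd₁₂ hd₁₃ hd₂₃ h₁ h₂ h₃ hT h4 h12
    · intro i j; fin_cases i <;> fin_cases j <;> simp <;> grind
    · intro i j; fin_cases i <;> fin_cases j <;> simp <;> grind
    · intro i j; fin_cases i <;> fin_cases j <;> simp <;> grind
    · intro i; fin_cases i <;> simp <;> grind
    · intro i; fin_cases i <;> simp <;> grind
    · intro i; fin_cases i <;> simp <;> grind
    · intro i; fin_cases i <;> simp <;> grind
    · grind
    · intro i; fin_cases i <;> simp <;> grind
    · intro i; fin_cases i <;> simp <;> grind
    · grind
  refine ⟨q, by simp, r, by simp, hqr, ?_⟩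
  intro w hw
  simp only [Finset.mem_insert, Finset.mem_singleton] at hw
  rcases hw with rfl | rfl
  · exact aux p r w hpr hpq hqr.symm (by ext; simp; tauto)
  · exact aux p q w hpq hpr hqr rfl
end
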